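/- (Colombo–Spolaor–Velichkov, n ≥ 3.) Let n ≥ 3 and let u be a solution of the normalized obstacle problem on Ω ⊆ ℝⁿ. Then there exists a constant ε > 0 depending only on n such that for every compact set K ⊆ Ω there is a constant C with: for every singular point x0 ∈ Σ ∩ K and every sufficiently small r > 0, sup_{x ∈ B_r(0)} |u(x0 + x) − p_{*,x0}(x)| ≤ C r² |log r|^{−ε}. -/

import Mathlib

open MeasureTheory Filter Metric Set
open scoped NNReal ENNReal Topology

noncomputable section

/-- The (pointwise a.e. defined) Laplacian of a `C^{1,1}_loc` function, as the
trace of the derivative of the gradient. -/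
def lapGrad {n : ℕ} (w : EuclideanSpace ℝ (Fin n) → ℝ)
    (x : EuclideanSpace ℝ (Fin n)) : ℝ :=
  ∑ i : Fin n, fderiv ℝ (gradient w) x (EuclideanSpace.single i 1) i

/-- `u` is a solution of the normalized obstacle problem on `Ω`:
`u ∈ C^{1,1}_loc(Ω)`, `u ≥ 0`, and `Δu = χ_{{u>0}}` a.e. on `Ω`. -/
def IsObstacleSol {n : ℕ} (Ω : Set (EuclideanSpace ℝ (Fin n)))
    (u : EuclideanSpace ℝ (Fin n) → ℝ) : Prop :=
  (∀ x ∈ Ω, DifferentiableAt ℝ u x) ∧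
  (∀ K : Set (EuclideanSpace ℝ (Fin n)), K ⊆ Ω → IsCompact K →
    ∃ L : ℝ≥0, LipschitzOnWith L (gradient u) K) ∧
  (∀ x ∈ Ω, 0 ≤ u x) ∧
  (∀ᵐ x ∂(volume.restrict Ω), lapGrad u x = if 0 < u x then 1 else 0)

/-- The free boundary `∂{u > 0} ∩ Ω`. -/
def freeBoundary {n : ℕ} (Ω : Set (EuclideanSpace ℝ (Fin n)))
    (u : EuclideanSpace ℝ (Fin n) → ℝ) : Set (EuclideanSpace ℝ (Fin n)) :=
  frontier {x | x ∈ Ω ∧ 0 < u x} ∩ Ω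

/-- The quadratic polynomial `p(x) = (1/2)⟨Ax, x⟩` associated with a matrix `A`. -/
def quadForm {n : ℕ} (A : Matrix (Fin n) (Fin n) ℝ)
    (x : EuclideanSpace ℝ (Fin n)) : ℝ :=
  (1 / 2) * ∑ i, ∑ j, A i j * x i * x j

/-- `A` encodes an element of `𝒫`: a symmetric nonnegative-definite matrix of
trace `1`. -/
def MemP {n : ℕ} (A : Matrix (Fin n) (Fin n) ℝ) : Prop :=
  A.PosSemidef ∧ A.trace = 1

/-- `x0` is a singular free boundary point: along some sequence `r_k → 0⁺` the
rescalings `u(x0 + r_k x)/r_k²` converge locally uniformly to some `p ∈ 𝒫`. -/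
def IsSingularPt {n : ℕ} (Ω : Set (EuclideanSpace ℝ (Fin n)))
    (u : EuclideanSpace ℝ (Fin n) → ℝ) (x0 : EuclideanSpace ℝ (Fin n)) : Prop :=
  x0 ∈ freeBoundary Ω u ∧
  ∃ (r : ℕ → ℝ) (A : Matrix (Fin n) (Fin n) ℝ),
    (∀ k, 0 < r k) ∧ Tendsto r atTop (𝓝 0) ∧ MemP A ∧
    TendstoLocallyUniformly (fun k x => u (x0 + r k • x) / r k ^ 2)
      (quadForm A) atTop

/-- `p(x) = (1/2)⟨Ax, x⟩ ∈ 𝒫` is the (full) blow-up of `u` at `x0`: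
`u(x0 + r x)/r² → p(x)` locally uniformly as `r → 0⁺`. -/
def IsBlowup {n : ℕ} (u : EuclideanSpace ℝ (Fin n) → ℝ)
    (x0 : EuclideanSpace ℝ (Fin n)) (A : Matrix (Fin n) (Fin n) ℝ) : Prop :=
  MemP A ∧
  TendstoLocallyUniformly (fun (r : ℝ) x => u (x0 + r • x) / r ^ 2)
    (quadForm A) (𝓝[>] 0)

/-- Euclidean space. -/
abbrev EE (n : ℕ) := EuclideanSpace ℝ (Fin n)

/-- `f` has gradient `g` at `x`. -/
def HG {n : ℕ} (f : EE n → ℝ) (g : EE n) (x : EE n) : Prop :=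
  HasFDerivAt f (innerSL ℝ g) x

theorem HG.mul {n : ℕ} {f h : EE n → ℝ} {a b x : EE n} (hf : HG f a x) (hh : HG h b x) :
    HG (fun y => f y * h y) (f x • b + h x • a) x := by
  refine HasFDerivAt.congr_fderiv (HasFDerivAt.mul hf hh) ?_
  ext v
  simp [inner_add_left, inner_smul_left]

theorem HG.const_mul {n : ℕ} {f : EE n → ℝ} {a x : EE n} (c : ℝ) (hf : HG f a x) :
    HG (fun y => c * f y) (c • a) x := by
  refine HasFDerivAt.congr_fderiv (HasFDerivAt.const_mul hf c) ?_
  ext v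
  simp [inner_smul_left]

theorem HG.congr {n : ℕ} {f h : EE n → ℝ} {a x : EE n} (hf : HG f a x) (e : h =ᶠ[𝓝 x] f) :
    HG h a x := HasFDerivAt.congr_of_eventuallyEq hf e

theorem HG.of_zero {n : ℕ} {h : EE n → ℝ} {x : EE n} (e : ∀ᶠ y in 𝓝 x, h y = 0) :
    HG h 0 x := by
  have : HG (fun _ : EE n => (0:ℝ)) 0 x := by
    unfold HG
    simpa using hasFDerivAt_const (0:ℝ) x
  exact this.congr e

theorem HG.curve {n : ℕ} {f : EE n → ℝ} {a : EE n} {c : ℝ → EE n} {c' : EE n} {s : ℝ}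
    (hf : HG f a (c s)) (hc : HasDerivAt c c' s) :
    HasDerivAt (fun s => f (c s)) (inner ℝ a c') s := by
  exact HasFDerivAt.comp_hasDerivAt s hf hc

theorem HG.continuousAt {n : ℕ} {f : EE n → ℝ} {a x : EE n} (hf : HG f a x) : ContinuousAt f x :=
  HasFDerivAt.continuousAt hf

theorem HG.lineDeriv {n : ℕ} {f : EE n → ℝ} {a x : EE n} (hf : HG f a x) (v : EE n) :
    HasLineDerivAt ℝ f (inner ℝ a v) x v := by
  have := HasFDerivAt.hasLineDerivAt hf v
  simpa using this

/-- positive part powers -/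
def pp (k : ℕ) (τ : ℝ) : ℝ := (max 0 (1 - τ)) ^ k

theorem pp_continuous (k : ℕ) : Continuous (pp k) := by unfold pp; fun_prop

theorem pp_nonneg (k : ℕ) (τ : ℝ) : 0 ≤ pp k τ := by unfold pp; positivity

theorem pp_le_one (k : ℕ) {τ : ℝ} (h : 0 ≤ τ) : pp k τ ≤ 1 := by
  unfold pp
  exact pow_le_one₀ (le_max_left _ _) (max_le (by norm_num) (by linarith))

theorem pp_eq_zero {k : ℕ} (hk : k ≠ 0) {τ : ℝ} (h : 1 ≤ τ) : pp k τ = 0 := by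
  unfold pp
  rw [max_eq_left (by linarith), zero_pow hk]

theorem pp_hasDerivAt (k : ℕ) (τ : ℝ) :
    HasDerivAt (pp (k+2)) (-((k:ℝ)+2) * pp (k+1) τ) τ := by
  rcases lt_trichotomy τ 1 with h | h | h
  · have h1 : HasDerivAt (fun τ : ℝ => (1 - τ) ^ (k+2)) (-((k:ℝ)+2) * (1-τ)^(k+1)) τ := by
      refine (((hasDerivAt_id τ).const_sub 1).pow (k+2)).congr_deriv ?_
      simp
      ring
    have h2 : pp (k+1) τ = (1-τ)^(k+1) := by
      unfold pp; rw [max_eq_right (by linarith)]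
    rw [h2]
    refine h1.congr_of_eventuallyEq ?_
    filter_upwards [gt_mem_nhds h] with y hy
    unfold pp; rw [max_eq_right (by linarith)]
  · subst h
    have h2 : -((k:ℝ)+2) * pp (k+1) 1 = 0 := by simp [pp]
    rw [h2]
    have : pp (k+2) =O[𝓝 1] fun x => ‖x - 1‖ ^ (k+2) := by
      refine Asymptotics.IsBigO.of_bound 1 (Eventually.of_forall fun x => ?_)
      unfold pp
      simp only [norm_pow, norm_norm, one_mul]
      apply pow_le_pow_left₀ (norm_nonneg _)
      rw [Real.norm_eq_abs, Real.norm_eq_abs, abs_of_nonneg (le_max_left _ _)]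
      apply max_le (abs_nonneg _)
      rw [abs_sub_comm]; exact le_abs_self _
    have := this.hasFDerivAt (𝕜 := ℝ) (by omega)
    exact (hasDerivAt_iff_hasFDerivAt.2 (by simpa using this))
  · have h2 : -((k:ℝ)+2) * pp (k+1) τ = 0 := by rw [pp_eq_zero (by omega) h.le]; simp
    rw [h2]
    refine (hasDerivAt_const τ (0:ℝ)).congr_of_eventuallyEq ?_
    filter_upwards [lt_mem_nhds h] with y hy
    exact pp_eq_zero (by omega) hy.le

/-- gradient of radial kernels -/
theorem pp_HG {n : ℕ} (k : ℕ) (b : ℝ) (c y : EE n) :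
    HG (fun y => pp (k+2) (b * ‖y - c‖^2))
      ((-((k:ℝ)+2) * pp (k+1) (b * ‖y - c‖^2) * (2*b)) • (y - c)) y := by
  have h1 : HasFDerivAt (fun y : EE n => b * ‖y - c‖^2) (b • ((2:ℝ) • innerSL ℝ (y - c))) y := by
    have h0 : HasFDerivAt (fun y : EE n => y - c) (ContinuousLinearMap.id ℝ (EE n)) y :=
      (hasFDerivAt_id y).sub_const c
    refine (h0.norm_sq.const_mul b).congr_fderiv ?_
    ext v
    simp
  have h2 := (pp_hasDerivAt k (b * ‖y - c‖^2)).comp_hasFDerivAt y h1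
  refine h2.congr_fderiv ?_
  ext v
  simp [inner_smul_left]
  ring

/-- the cutoff -/
def phi {n : ℕ} (x : EE n) : ℝ := pp 2 (‖x‖^2)
/-- the weight -/
def wt {n : ℕ} (x : EE n) : ℝ := 4 * pp 1 (‖x‖^2)

theorem phi_continuous {n : ℕ} : Continuous (phi (n := n)) := by
  unfold phi; exact (pp_continuous 2).comp (by fun_prop)
theorem wt_continuous {n : ℕ} : Continuous (wt (n := n)) := by
  unfold wt; exact ((pp_continuous 1).comp (by fun_prop)).const_mul 4
theorem phi_nonneg {n : ℕ} (x : EE n) : 0 ≤ phi x := pp_nonneg _ _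
theorem wt_nonneg {n : ℕ} (x : EE n) : 0 ≤ wt x := by
  have := pp_nonneg 1 (‖x‖^2); unfold wt; linarith
theorem phi_le {n : ℕ} (x : EE n) : phi x ≤ 1 := pp_le_one _ (by positivity)
theorem wt_le {n : ℕ} (x : EE n) : wt x ≤ 4 := by
  have := pp_le_one 1 (sq_nonneg ‖x‖); unfold wt; linarith
theorem phi_zero {n : ℕ} {x : EE n} (h : 1 ≤ ‖x‖) : phi x = 0 :=
  pp_eq_zero (by norm_num) (by nlinarith)
theorem wt_zero {n : ℕ} {x : EE n} (h : 1 ≤ ‖x‖) : wt x = 0 := by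
  unfold wt; rw [pp_eq_zero (by norm_num) (by nlinarith)]; simp
theorem phi_HG {n : ℕ} (x : EE n) : HG phi (-(wt x) • x) x := by
  have := pp_HG 0 1 0 x
  simp only [sub_zero, one_mul] at this
  unfold phi wt
  convert this using 2
  push_cast; ring

/-- integrability of continuous functions vanishing off the unit ball -/
theorem integ_cont {n : ℕ} {f : EE n → ℝ} (hf : Continuous f) (h0 : ∀ x, 1 ≤ ‖x‖ → f x = 0) :
    Integrable f := by
  refine hf.integrable_of_hasCompactSupport ?_
  refine HasCompactSupport.of_support_subset_isCompact (isCompact_closedBall (0: EE n) 1) ?_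
  intro x hx
  by_contra h
  simp only [mem_closedBall, dist_zero_right, not_le] at h
  exact hx (h0 x h.le)

theorem integ_phi {n : ℕ} {f : EE n → ℝ} (hf : Continuous f) : Integrable (fun x => f x * phi x) :=
  integ_cont (hf.mul phi_continuous) (fun x hx => by rw [phi_zero hx, mul_zero])

theorem integ_wt {n : ℕ} {f : EE n → ℝ} (hf : Continuous f) : Integrable (fun x => f x * wt x) :=
  integ_cont (hf.mul wt_continuous) (fun x hx => by rw [wt_zero hx, mul_zero])

theorem integ_bdd {n : ℕ} {f k : EE n → ℝ} {C : ℝ} (hk : Measurable k) (hb : ∀ x, |k x| ≤ C)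
    (hf : Integrable f) :
    Integrable (fun x => k x * f x) :=
  hf.bdd_mul hk.aestronglyMeasurable (Eventually.of_forall (fun x => by simpa using hb x))

/-- divergence theorem for compactly supported `C¹` functions -/
theorem integral_grad_zero {n : ℕ} {F : EE n → ℝ} {g : EE n → EE n} (hF : ∀ x, HG F (g x) x)
    (hg : Continuous g) (h0 : ∀ x, 1 ≤ ‖x‖ → F x = 0 ∧ g x = 0) (v : EE n) :
    ∫ x, inner ℝ (g x) v = 0 := by
  have hFc : Continuous F := continuous_iff_continuousAt.2 fun x => (hF x).continuousAt
  have i1 : Integrable F := integ_cont hFc fun x hx => (h0 x hx).1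
  have i2 : Integrable (fun x => inner ℝ (g x) v) :=
    integ_cont (by fun_prop) fun x hx => by rw [(h0 x hx).2, inner_zero_left]
  have := integral_bilinear_hasLineDerivAt_right_eq_neg_left_of_integrable
    (μ := volume) (f := F) (f' := fun x => inner ℝ (g x) v) (g := fun _ : EE n => (1:ℝ))
    (g' := fun _ => (0:ℝ)) (v := v) (B := (ContinuousLinearMap.mul ℝ ℝ : ℝ →L[ℝ] ℝ →L[ℝ] ℝ))
    (by simpa using i2) (by simp) (by simpa using i1) (fun x _ => (hF x).lineDeriv v)
    (fun x _ => by
      have := (hasFDerivAt_const (𝕜 := ℝ) (1:ℝ) x).hasLineDerivAt v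
      simpa using this)
  simp at this
  linarith

/-- admissible test functions in the unit ball -/
structure Tst {n : ℕ} (ψ : EE n → ℝ) (g : EE n → EE n) : Prop where
  grad : ∀ x, HG ψ (g x) x
  cont : Continuous g
  zero : ∀ x, 1 ≤ ‖x‖ → ψ x = 0 ∧ g x = 0

theorem Tst.continuous {n : ℕ} {ψ : EE n → ℝ} {g : EE n → EE n} (h : Tst ψ g) : Continuous ψ :=
  continuous_iff_continuousAt.2 fun x => (h.grad x).continuousAt

/-- `u` is `C¹` on the ball of radius `3/2` and satisfies `Δ u = k` weakly in the unit ball -/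
structure CW {n : ℕ} (u : EE n → ℝ) (G : EE n → EE n) (k : EE n → ℝ) : Prop where
  cu : Continuous u
  cG : Continuous G
  grad : ∀ x, ‖x‖ < 3/2 → HG u (G x) x
  meas : Measurable k
  bk : ∃ C, ∀ x, |k x| ≤ C
  weak : ∀ ψ g, Tst ψ g → ∫ x, inner ℝ (G x) (g x) = - ∫ x, k x * ψ x

theorem mul_test {n : ℕ} {v : EE n → ℝ} {H : EE n → EE n} (cv : Continuous v) (cH : Continuous H)
    (grad : ∀ x, ‖x‖ < 3/2 → HG v (H x) x) {ψ : EE n → ℝ} {g : EE n → EE n} (h : Tst ψ g) :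
    Tst (fun x => v x * ψ x) (fun x => v x • g x + ψ x • H x) where
  grad x := by
    by_cases hx : ‖x‖ < 3/2
    · exact (grad x hx).mul (h.grad x)
    · have h1 : 1 < ‖x‖ := by linarith
      rw [(h.zero x h1.le).1, (h.zero x h1.le).2]
      simp only [smul_zero, zero_smul, add_zero]
      apply HG.of_zero
      filter_upwards [continuous_norm.continuousAt.eventually (lt_mem_nhds h1)] with y hy
      rw [(h.zero y hy.le).1, mul_zero]
  cont := by
    have := h.continuous
    have := h.cont
    fun_prop
  zero x hx := by
    rw [(h.zero x hx).1, (h.zero x hx).2]; simp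

theorem phi_test {n : ℕ} : Tst (phi (n := n)) (fun x => -(wt x) • x) where
  grad := phi_HG
  cont := by have := wt_continuous (n := n); fun_prop
  zero x hx := by rw [phi_zero hx, wt_zero hx]; simp

/-- Green's identity -/
theorem green {n : ℕ} {u v : EE n → ℝ} {G H : EE n → EE n} {k l : EE n → ℝ}
    (hu : CW u G k) (hv : CW v H l) :
    ∫ x, (u x * inner ℝ x (H x) - v x * inner ℝ x (G x)) * wt x
      = (∫ x, l x * (u x * phi x)) - ∫ x, k x * (v x * phi x) := by
  have cu := hu.cu; have cG := hu.cG; have cv := hv.cu; have cH := hv.cG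
  have e1 := hu.weak _ _ (mul_test hv.cu hv.cG hv.grad phi_test)
  have e2 := hv.weak _ _ (mul_test hu.cu hu.cG hu.grad phi_test)
  have a1 : ∀ x, inner ℝ (G x) (v x • -(wt x) • x + phi x • H x)
      = inner ℝ (G x) (H x) * phi x - (v x * inner ℝ x (G x)) * wt x := by
    intro x
    rw [inner_add_right, inner_smul_right, inner_smul_right, inner_smul_right,
      real_inner_comm x (G x)]; ring
  have a2 : ∀ x, inner ℝ (H x) (u x • -(wt x) • x + phi x • G x)
      = inner ℝ (G x) (H x) * phi x - (u x * inner ℝ x (H x)) * wt x := by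
    intro x
    rw [inner_add_right, inner_smul_right, inner_smul_right, inner_smul_right,
      real_inner_comm x (H x), real_inner_comm (H x) (G x)]; ring
  simp_rw [a1] at e1
  simp_rw [a2] at e2
  have i0 : Integrable (fun x => inner ℝ (G x) (H x) * phi x) := integ_phi (by fun_prop)
  have i1 : Integrable (fun x => (v x * inner ℝ x (G x)) * wt x) := integ_wt (by fun_prop)
  have i2 : Integrable (fun x => (u x * inner ℝ x (H x)) * wt x) := integ_wt (by fun_prop)
  rw [integral_sub i0 i1] at e1
  rw [integral_sub i0 i2] at e2
  simp_rw [sub_mul]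
  rw [integral_sub i2 i1]
  linarith

section

/-- linear map of a matrix -/
def Aq {n : ℕ} (A : Matrix (Fin n) (Fin n) ℝ) : EE n →L[ℝ] EE n :=
  Matrix.toEuclideanCLM (𝕜 := ℝ) (n := Fin n) A

theorem Aq_apply {n : ℕ} (A : Matrix (Fin n) (Fin n) ℝ) (x : EE n) (i : Fin n) :
    Aq A x i = ∑ j, A i j * x j := by
  unfold Aq
  rw [Matrix.ofLp_toEuclideanCLM]
  rfl

theorem quadForm_eq {n : ℕ} (A : Matrix (Fin n) (Fin n) ℝ) (x : EE n) :
    quadForm A x = (1/2) * inner ℝ x (Aq A x) := by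
  unfold quadForm
  rw [PiLp.inner_apply]
  congr 1
  refine Finset.sum_congr rfl fun i _ => ?_
  simp only [Aq_apply]
  simp [Finset.sum_mul]
  exact Finset.sum_congr rfl fun j _ => by ring

theorem Aq_symm {n : ℕ} {A : Matrix (Fin n) (Fin n) ℝ} (hA : A.IsSymm) (x y : EE n) :
    inner ℝ (Aq A x) y = inner ℝ x (Aq A y) := by
  simp only [PiLp.inner_apply, Aq_apply]
  simp only [RCLike.inner_apply, conj_trivial, Finset.mul_sum, Finset.sum_mul]
  rw [Finset.sum_comm]
  refine Finset.sum_congr rfl fun j _ => Finset.sum_congr rfl fun i _ => ?_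
  rw [← hA.apply i j]; ring

theorem quadForm_continuous {n : ℕ} (A : Matrix (Fin n) (Fin n) ℝ) : Continuous (quadForm A) := by
  have : quadForm A = fun x => (1/2) * inner ℝ x (Aq A x) := funext (quadForm_eq A)
  rw [this]; fun_prop

theorem quadForm_HG {n : ℕ} {A : Matrix (Fin n) (Fin n) ℝ} (hA : A.IsSymm) (x : EE n) :
    HG (quadForm A) (Aq A x) x := by
  have : quadForm A = fun x => (1/2) * inner ℝ x (Aq A x) := funext (quadForm_eq A)
  rw [this]
  have h1 := ((hasFDerivAt_id x).inner ℝ ((Aq A).hasFDerivAt (x := x))).const_mul (1/2)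
  refine HasFDerivAt.congr_fderiv h1 ?_
  ext v
  simp
  rw [Aq_symm hA, ← Aq_symm hA v x, real_inner_comm, Aq_symm hA]
  ring

theorem quad_CW {n : ℕ} {A : Matrix (Fin n) (Fin n) ℝ} (hA : A.IsSymm) :
    CW (quadForm A) (Aq A) (fun _ => A.trace) where
  cu := quadForm_continuous A
  cG := (Aq A).continuous
  grad x _ := quadForm_HG hA x
  meas := measurable_const
  bk := ⟨|A.trace|, fun _ => le_rfl⟩
  weak ψ g h := by
    have cψ := h.continuous
    have cg := h.cont
    have key : ∀ i : Fin n, ∫ x, (Aq A x i * g x i + A i i * ψ x) = 0 := by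
      intro i
      have e : ∀ x : EE n, inner ℝ (Aq A (EuclideanSpace.single i 1)) x = Aq A x i := by
        intro x
        rw [Aq_symm hA]
        simp [EuclideanSpace.inner_single_left]
      have hg : ∀ x : EE n, HG (fun x => Aq A x i) (Aq A (EuclideanSpace.single i 1)) x := by
        intro x
        have : (fun x => Aq A x i) = innerSL ℝ (Aq A (EuclideanSpace.single i 1)) := by
          ext x; simp [e]
        rw [this]
        exact ContinuousLinearMap.hasFDerivAt _
      have t := mul_test (v := fun x => Aq A x i)
        (H := fun _ => Aq A (EuclideanSpace.single i 1)) (by fun_prop) (by fun_prop)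
        (fun x _ => hg x) h
      have := integral_grad_zero t.grad t.cont t.zero (EuclideanSpace.single i 1)
      rw [← this]
      congr 1
      ext x
      rw [inner_add_left, inner_smul_left, inner_smul_left, e, Aq_apply A (EuclideanSpace.single i 1)]
      simp [EuclideanSpace.inner_single_right]
      ring
    have i1 : ∀ i : Fin n, Integrable (fun x => Aq A x i * g x i) := fun i =>
      integ_cont (by fun_prop) fun x hx => by rw [(h.zero x hx).2]; simp
    have i2 : Integrable ψ := integ_cont cψ fun x hx => (h.zero x hx).1
    have key2 : ∀ i : Fin n, ∫ x, (Aq A x i * g x i) = - (A i i * ∫ x, ψ x) := by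
      intro i
      have := key i
      rw [integral_add (i1 i) (i2.const_mul _), integral_const_mul] at this
      linarith
    have e : ∀ x, inner ℝ (Aq A x) (g x) = ∑ i, Aq A x i * g x i := by
      intro x
      rw [PiLp.inner_apply]
      refine Finset.sum_congr rfl fun i _ => ?_
      simp; ring
    simp_rw [e]
    rw [integral_finsetSum _ (fun i _ => i1 i), integral_const_mul]
    simp_rw [key2]
    rw [Finset.sum_neg_distrib, ← Finset.sum_mul]
    rfl

/-- indicator of positivity -/
def posInd {n : ℕ} (u : EE n → ℝ) (x : EE n) : ℝ := if 0 < u x then 1 else 0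
/-- indicator of the contact set -/
def zi {n : ℕ} (u : EE n → ℝ) (x : EE n) : ℝ := if 0 < u x then 0 else 1

/-- normalized solutions -/
structure NSol {n : ℕ} (L : ℝ) (u : EE n → ℝ) (G : EE n → EE n) : Prop extends
    CW u G (posInd u) where
  hL : 1 ≤ L
  lip : ∀ x y, ‖x‖ < 3/2 → ‖y‖ < 3/2 → ‖G x - G y‖ ≤ L * ‖x - y‖
  nonneg : ∀ x, ‖x‖ < 3/2 → 0 ≤ u x
  u0 : u 0 = 0
  G0 : G 0 = 0

/-- deviation from 2-homogeneity -/
def dot {n : ℕ} (u : EE n → ℝ) (G : EE n → EE n) (x : EE n) : ℝ := 2 * u x - inner ℝ x (G x)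

/-- energy -/
def En {n : ℕ} (u : EE n → ℝ) (G : EE n → EE n) : ℝ :=
  (∫ x, u x * phi x) - ∫ x, (u x * dot u G x) * wt x

/-- dissipation -/
def Jn {n : ℕ} (u : EE n → ℝ) (G : EE n → EE n) : ℝ := ∫ x, (dot u G x)^2 * wt x

theorem posInd_meas {n : ℕ} {u : EE n → ℝ} (hu : Continuous u) : Measurable (posInd u) :=
  Measurable.ite (measurableSet_lt measurable_const hu.measurable) measurable_const measurable_const
theorem zi_meas {n : ℕ} {u : EE n → ℝ} (hu : Continuous u) : Measurable (zi u) :=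
  Measurable.ite (measurableSet_lt measurable_const hu.measurable) measurable_const measurable_const
theorem zi_abs {n : ℕ} (u : EE n → ℝ) (x) : |zi u x| ≤ 1 := by unfold zi; split_ifs <;> simp
theorem zi_nonneg {n : ℕ} (u : EE n → ℝ) (x) : 0 ≤ zi u x := by unfold zi; split_ifs <;> simp
theorem zi_le {n : ℕ} (u : EE n → ℝ) (x) : zi u x ≤ 1 := by unfold zi; split_ifs <;> simp
theorem posInd_abs {n : ℕ} (u : EE n → ℝ) (x) : |posInd u x| ≤ 1 := by
  unfold posInd; split_ifs <;> simp
theorem posInd_eq {n : ℕ} (u : EE n → ℝ) (x) : posInd u x = 1 - zi u x := by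
  unfold posInd zi; split_ifs <;> simp

theorem dot_continuous {n : ℕ} {u : EE n → ℝ} {G : EE n → EE n} (hu : Continuous u)
    (hG : Continuous G) : Continuous (dot u G) := by unfold dot; fun_prop

section
variable {n : ℕ} {L : ℝ} {u v : EE n → ℝ} {G H : EE n → EE n}

theorem NSol.G_le (h : NSol L u G) {x : EE n} (hx : ‖x‖ < 3/2) : ‖G x‖ ≤ L * ‖x‖ := by
  have := h.lip x 0 hx (by norm_num)
  rwa [h.G0, sub_zero, sub_zero] at this

theorem NSol.u_lip (h : NSol L u G) {x y : EE n} (hx : ‖x‖ < 3/2) (hy : ‖y‖ < 3/2) :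
    |u x - u y| ≤ 2 * L * ‖x - y‖ := by
  have hL := h.hL
  have := (convex_ball (0 : EE n) (3/2)).norm_image_sub_le_of_norm_hasFDerivWithin_le
    (f := u) (f' := fun x => innerSL ℝ (G x)) (C := 2 * L) (x := y) (y := x)
    (fun z hz => (show HasFDerivAt _ _ _ from h.grad z (by simpa using hz)).hasFDerivWithinAt)
    (fun z hz => by
      have hz' : ‖z‖ < 3/2 := by simpa using hz
      have := h.G_le hz'
      simp only [innerSL_apply_norm]
      nlinarith)
    (by simpa using hy) (by simpa using hx)
  simpa using this

theorem NSol.u_le (h : NSol L u G) {x : EE n} (hx : ‖x‖ < 3/2) : |u x| ≤ 2 * L * ‖x‖ := by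
  have := h.u_lip hx (y := 0) (by norm_num)
  rwa [h.u0, sub_zero, sub_zero] at this

theorem NSol.dot_le (h : NSol L u G) {x : EE n} (hx : ‖x‖ ≤ 1) : |dot u G x| ≤ 5 * L := by
  have hL := h.hL
  have h1 := h.u_le (x := x) (by linarith)
  have h2 := h.G_le (x := x) (by linarith)
  have h3 := abs_real_inner_le_norm x (G x)
  unfold dot
  have h4 : |2 * u x - inner ℝ x (G x)| ≤ 2 * |u x| + |inner ℝ x (G x)| := by
    rw [show 2 * |u x| = |2 * u x| by simp [abs_mul]]
    exact abs_sub _ _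
  have h5 : ‖x‖ * ‖G x‖ ≤ 1 * (L * 1) := by
    apply mul_le_mul hx _ (norm_nonneg _) (by norm_num)
    nlinarith
  have h6 : 2 * L * ‖x‖ ≤ 2 * L := by nlinarith
  linarith

theorem NSol.G_zero (h : NSol L u G) {x : EE n} (hx : ‖x‖ < 3/2) (h0 : u x = 0) : G x = 0 := by
  have hm : IsLocalMin u x := by
    have : ∀ᶠ y in 𝓝 x, ‖y‖ < 3/2 := continuous_norm.continuousAt.eventually (gt_mem_nhds hx)
    filter_upwards [this] with y hy
    rw [h0]; exact h.nonneg y hy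
  have := hm.hasFDerivAt_eq_zero (h.grad x hx)
  have h2 : innerSL ℝ (G x) (G x) = 0 := by rw [this]; simp
  simpa using h2

theorem NSol.dot_zero (h : NSol L u G) {x : EE n} (hx : ‖x‖ < 3/2) (h0 : u x = 0) :
    dot u G x = 0 := by
  unfold dot; rw [h.G_zero hx h0, h0]; simp

theorem NSol.zi_zero (h : NSol L u G) {x : EE n} (hx : ‖x‖ < 3/2) (h0 : zi u x ≠ 0) : u x = 0 := by
  have := h.nonneg x hx
  unfold zi at h0
  by_contra h1
  exact h0 (if_pos (lt_of_le_of_ne this (Ne.symm h1)))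

theorem MemP.symm {A : Matrix (Fin n) (Fin n) ℝ} (hA : MemP A) : A.IsSymm := by
  have := hA.1.isHermitian
  simpa [Matrix.IsHermitian, Matrix.IsSymm] using this

/-- key identity -/
theorem En_quad (h : CW u G (posInd u)) {A : Matrix (Fin n) (Fin n) ℝ} (hA : MemP A) :
    En u G = (∫ x, quadForm A x * phi x) - (∫ x, zi u x * (quadForm A x * phi x))
      - ∫ x, ((u x - quadForm A x) * dot u G x) * wt x := by
  have hs := hA.symm
  have g := green h (quad_CW hs)
  have cu := h.cu; have cG := h.cG
  have cq := quadForm_continuous A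
  have cd := dot_continuous cu cG
  have e1 : ∀ x, (u x * inner ℝ x (Aq A x) - quadForm A x * inner ℝ x (G x)) * wt x
      = quadForm A x * dot u G x * wt x := by
    intro x
    have : inner ℝ x (Aq A x) = 2 * quadForm A x := by rw [quadForm_eq]; ring
    rw [this]; unfold dot; ring
  simp_rw [e1] at g
  rw [hA.2] at g
  simp only [one_mul] at g
  have i0 : Integrable (fun x => quadForm A x * phi x) := integ_phi cq
  have e2 : ∫ x, posInd u x * (quadForm A x * phi x) =
      (∫ x, quadForm A x * phi x) - ∫ x, zi u x * (quadForm A x * phi x) := by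
    rw [← integral_sub i0 (integ_bdd (zi_meas cu) (zi_abs u) i0)]
    congr 1; ext x; rw [posInd_eq]; ring
  rw [e2] at g
  have e3 : ∫ x, ((u x - quadForm A x) * dot u G x) * wt x =
     (∫ x, u x * dot u G x * wt x) - ∫ x, quadForm A x * dot u G x * wt x := by
    rw [← integral_sub (integ_wt (by fun_prop)) (integ_wt (by fun_prop))]
    congr 1; ext x; ring
  rw [e3]
  unfold En
  linarith

/-- all elements of `P` have the same energy -/
theorem P_energy {A B : Matrix (Fin n) (Fin n) ℝ} (hA : MemP A) (hB : MemP B) :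
    ∫ x, quadForm A x * phi x = ∫ x, quadForm B x * phi x := by
  have g := green (quad_CW hA.symm) (quad_CW hB.symm)
  have e1 : ∀ x, (quadForm A x * inner ℝ x (Aq B x) - quadForm B x * inner ℝ x (Aq A x)) * wt x
      = 0 := by
    intro x
    have h1 : inner ℝ x (Aq A x) = 2 * quadForm A x := by rw [quadForm_eq]; ring
    have h2 : inner ℝ x (Aq B x) = 2 * quadForm B x := by rw [quadForm_eq]; ring
    rw [h1, h2]; ring
  simp_rw [e1, hA.2, hB.2] at g
  simp at g
  linarith

/-- two-solution identity -/
theorem En_two (hu : CW u G (posInd u)) (hv : CW v H (posInd v)) :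
    En v H - En u G = (∫ x, (zi u x * (v x * phi x) - zi v x * (u x * phi x)))
      - ∫ x, ((v x - u x) * (dot v H x + dot u G x)) * wt x := by
  have g := green hu hv
  have cu := hu.cu; have cG := hu.cG; have cv := hv.cu; have cH := hv.cG
  have cd := dot_continuous cu cG
  have cd' := dot_continuous cv cH
  have iu : Integrable (fun x => u x * phi x) := integ_phi cu
  have iv : Integrable (fun x => v x * phi x) := integ_phi cv
  have izu := integ_bdd (zi_meas cu) (zi_abs u) iv
  have izv := integ_bdd (zi_meas cv) (zi_abs v) iu
  have e1 : ∫ x, posInd v x * (u x * phi x) =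
      (∫ x, u x * phi x) - ∫ x, zi v x * (u x * phi x) := by
    rw [← integral_sub iu izv]
    congr 1; ext x; rw [posInd_eq]; ring
  have e2 : ∫ x, posInd u x * (v x * phi x) =
      (∫ x, v x * phi x) - ∫ x, zi u x * (v x * phi x) := by
    rw [← integral_sub iv izu]
    congr 1; ext x; rw [posInd_eq]; ring
  have e3 : ∫ x, ((v x - u x) * (dot v H x + dot u G x)) * wt x =
     (∫ x, v x * dot v H x * wt x) - (∫ x, u x * dot u G x * wt x) +
      ∫ x, (u x * inner ℝ x (H x) - v x * inner ℝ x (G x)) * wt x := by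
    have j1 : Integrable (fun x => v x * dot v H x * wt x) := integ_wt (by fun_prop)
    have j2 : Integrable (fun x => u x * dot u G x * wt x) := integ_wt (by fun_prop)
    have j3 : Integrable (fun x => (u x * inner ℝ x (H x) - v x * inner ℝ x (G x)) * wt x) :=
      integ_wt (by fun_prop)
    have j12 : Integrable (fun x => v x * dot v H x * wt x - u x * dot u G x * wt x) := j1.sub j2
    rw [← integral_sub j1 j2, ← integral_add j12 j3]
    congr 1; ext x; simp only [dot]; ring
  rw [e1, e2] at g
  rw [e3, integral_sub izu izv]
  unfold En
  linarith

end

end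

section

/-- volume of the unit ball -/
def VB (n : ℕ) : ℝ := volume.real (closedBall (0 : EE n) 1)

theorem VB_nonneg (n : ℕ) : 0 ≤ VB n := measureReal_nonneg

theorem int_bd {n : ℕ} {f : EE n → ℝ} {C : ℝ} (hC : 0 ≤ C) (hf : ∀ x, ‖x‖ < 1 → |f x| ≤ C)
    (h0 : ∀ x, 1 ≤ ‖x‖ → f x = 0) : |∫ x, f x| ≤ C * VB n := by
  have h1 : Integrable ((closedBall (0 : EE n) 1).indicator (fun _ => C)) := by
    rw [integrable_indicator_iff measurableSet_closedBall]
    exact integrableOn_const (measure_closedBall_lt_top.ne) (by simp)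
  have := norm_integral_le_of_norm_le h1 (f := f) (Eventually.of_forall fun x => by
    by_cases hx : ‖x‖ < 1
    · rw [indicator_of_mem (by simpa using hx.le)]
      exact hf x hx
    · rw [h0 x (not_lt.1 hx), norm_zero]
      exact indicator_nonneg (fun _ _ => hC) x)
  rw [Real.norm_eq_abs] at this
  refine this.trans (le_of_eq ?_)
  rw [integral_indicator measurableSet_closedBall, setIntegral_const]
  simp [VB, mul_comm]

theorem deriv_of_sq {f : ℝ → ℝ} {f' s C : ℝ}
    (h : ∀ᶠ t in 𝓝 s, |f t - f s - (t - s) * f'| ≤ C * (t - s)^2) : HasDerivAt f f' s := by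
  rw [hasDerivAt_iff_isLittleO]
  have h1 : (fun t => f t - f s - (t - s) • f') =O[𝓝 s] fun t => (t - s)^2 := by
    refine Asymptotics.IsBigO.of_bound C ?_
    filter_upwards [h] with t ht
    simpa using ht
  refine h1.trans_isLittleO ?_
  have : (fun x : ℝ => x^2) =o[𝓝 0] fun x => x := by
    simpa using Asymptotics.isLittleO_pow_pow (𝕜 := ℝ) (show 1 < 2 by norm_num)
  have h2 : Tendsto (fun t => t - s) (𝓝 s) (𝓝 0) := by
    have : ContinuousAt (fun t => t - s) s := by fun_prop
    simpa [ContinuousAt] using this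
  exact this.comp_tendsto h2

/-- rescaled solution -/
def Uf {n : ℕ} (u : EE n → ℝ) (t : ℝ) (x : EE n) : ℝ := Real.exp (2*t) * u (Real.exp (-t) • x)
/-- rescaled gradient -/
def Gf {n : ℕ} (G : EE n → EE n) (t : ℝ) (x : EE n) : EE n := Real.exp t • G (Real.exp (-t) • x)

section
variable {n : ℕ} {L : ℝ} {u : EE n → ℝ} {G : EE n → EE n}

theorem exp_smul_norm {t : ℝ} (ht : 0 ≤ t) (x : EE n) : ‖Real.exp (-t) • x‖ ≤ ‖x‖ := by
  rw [norm_smul, Real.norm_eq_abs, abs_of_pos (Real.exp_pos _)]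
  have : Real.exp (-t) ≤ 1 := Real.exp_le_one_iff.2 (by linarith)
  nlinarith [norm_nonneg x]

theorem flow_NSol (h : NSol L u G) {t : ℝ} (ht : 0 ≤ t) : NSol L (Uf u t) (Gf G t) where
  cu := by have := h.cu; unfold Uf; fun_prop
  cG := by have := h.cG; unfold Gf; fun_prop
  grad x hx := by
    have h1 := h.grad (Real.exp (-t) • x) ((exp_smul_norm ht x).trans_lt hx)
    unfold HG at h1 ⊢
    have h2 : HasFDerivAt (fun x : EE n => Real.exp (-t) • x)
      (Real.exp (-t) • ContinuousLinearMap.id ℝ (EE n)) x :=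
      (hasFDerivAt_id x).const_smul (Real.exp (-t))
    have h3 := (HasFDerivAt.comp x h1 h2).const_mul (Real.exp (2*t))
    refine HasFDerivAt.congr_fderiv h3 ?_
    ext v
    simp [Gf, inner_smul_left, inner_smul_right]
    rw [← mul_assoc, ← Real.exp_add]; congr 2; ring
  meas := posInd_meas (by have := h.cu; unfold Uf; fun_prop)
  bk := ⟨1, posInd_abs _⟩
  weak ψ g hψ := by
    have e1 : Real.exp t * Real.exp (-t) = 1 := by rw [← Real.exp_add]; simp
    have hT : Tst (fun y => ψ (Real.exp t • y)) (fun y => Real.exp t • g (Real.exp t • y)) := by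
      refine ⟨fun x => ?_, ?_, fun x hx => ?_⟩
      · have h1 := hψ.grad (Real.exp t • x)
        unfold HG at h1 ⊢
        have h2 : HasFDerivAt (fun x : EE n => Real.exp t • x)
          (Real.exp t • ContinuousLinearMap.id ℝ (EE n)) x :=
          (hasFDerivAt_id x).const_smul (Real.exp t)
        refine HasFDerivAt.congr_fderiv (HasFDerivAt.comp x h1 h2) ?_
        ext v
        simp [inner_smul_left, inner_smul_right]
      · have := hψ.cont; fun_prop
      · have : 1 ≤ ‖Real.exp t • x‖ := by
          rw [norm_smul, Real.norm_eq_abs, abs_of_pos (Real.exp_pos _)]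
          have : 1 ≤ Real.exp t := Real.one_le_exp ht
          nlinarith
        rw [(hψ.zero _ this).1, (hψ.zero _ this).2]; simp
    have hw := h.weak _ _ hT
    have c1 := Measure.integral_comp_smul (volume : Measure (EE n))
      (fun y => inner ℝ (G y) (Real.exp t • g (Real.exp t • y))) (Real.exp (-t))
    have c2 := Measure.integral_comp_smul (volume : Measure (EE n))
      (fun y => posInd u y * ψ (Real.exp t • y)) (Real.exp (-t))
    rw [hw, smul_neg, ← c2] at c1
    simp only [smul_smul, e1, one_smul] at c1
    have e2 : ∀ x, posInd (Uf u t) x = posInd u (Real.exp (-t) • x) := by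
      intro x
      unfold posInd Uf
      congr 1
      rw [mul_pos_iff_of_pos_left (Real.exp_pos _)]
    simp_rw [e2]
    rw [← c1]
    congr 1; ext x
    simp [Gf, inner_smul_left, inner_smul_right]
  hL := h.hL
  lip x y hx hy := by
    have := h.lip _ _ ((exp_smul_norm ht x).trans_lt hx) ((exp_smul_norm ht y).trans_lt hy)
    unfold Gf
    rw [← smul_sub, norm_smul, Real.norm_eq_abs, abs_of_pos (Real.exp_pos _)]
    rw [← smul_sub, norm_smul, Real.norm_eq_abs, abs_of_pos (Real.exp_pos _)] at this
    calc _ ≤ Real.exp t * (L * (Real.exp (-t) * ‖x - y‖)) := by gcongr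
      _ = (Real.exp t * Real.exp (-t)) * (L * ‖x - y‖) := by ring
      _ = _ := by rw [← Real.exp_add]; simp
  nonneg x hx := by
    unfold Uf
    exact mul_nonneg (Real.exp_pos _).le (h.nonneg _ ((exp_smul_norm ht x).trans_lt hx))
  u0 := by simp [Uf, h.u0]
  G0 := by simp [Gf, h.G0]

/-- abbreviation for the velocity -/
def gf {n : ℕ} (u : EE n → ℝ) (G : EE n → EE n) (t : ℝ) (x : EE n) : ℝ := dot (Uf u t) (Gf G t) x

theorem Uf_deriv (h : NSol L u G) {t : ℝ} (ht : 0 ≤ t) {x : EE n} (hx : ‖x‖ ≤ 1) :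
    HasDerivAt (fun t => Uf u t x) (gf u G t x) t := by
  have h1 := h.grad (Real.exp (-t) • x) (((exp_smul_norm ht x).trans hx).trans_lt (by norm_num))
  have hc : HasDerivAt (fun t => Real.exp (-t) • x) ((-Real.exp (-t)) • x) t := by
    refine HasDerivAt.smul_const ?_ x
    simpa using (hasDerivAt_id t).neg.exp
  have h2 := HG.curve h1 hc
  have h3 : HasDerivAt (fun t => Real.exp (2*t)) (Real.exp (2*t) * 2) t := by
    simpa using ((hasDerivAt_id t).const_mul 2).exp
  refine (h3.mul h2).congr_deriv ?_
  unfold gf dot Uf Gf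
  rw [inner_smul_right, inner_smul_right, real_inner_comm x]
  have : Real.exp (2*t) * Real.exp (-t) = Real.exp t := by rw [← Real.exp_add]; congr 1; ring
  linear_combination (-(inner ℝ x (G (Real.exp (-t) • x)))) * this

theorem Uf_diff (h : NSol L u G) {s t : ℝ} (hs : 0 ≤ s) (ht : 0 ≤ t) {x : EE n} (hx : ‖x‖ ≤ 1) :
    |Uf u t x - Uf u s x| ≤ 5 * L * |t - s| := by
  have := (convex_Ici (0:ℝ)).norm_image_sub_le_of_norm_hasDerivWithin_le (C := 5 * L)
    (f := fun t => Uf u t x) (f' := fun t => gf u G t x) (x := s) (y := t)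
    (fun τ hτ => (Uf_deriv h hτ hx).hasDerivWithinAt)
    (fun τ hτ => (flow_NSol h hτ).dot_le hx) hs ht
  simpa using this

theorem Gf_diff_aux (h : NSol L u G) {s t : ℝ} (hs : 0 ≤ s) (hst : s ≤ t) {x : EE n}
    (hx : ‖x‖ ≤ 1) : ‖Gf G t x - Gf G s x‖ ≤ 2 * L * |t - s| := by
  have hL := h.hL
  have ht : 0 ≤ t := hs.trans hst
  have e : Gf G t x - Gf G s x = Real.exp s • (G (Real.exp (-t) • x) - G (Real.exp (-s) • x)) +
      (Real.exp t - Real.exp s) • G (Real.exp (-t) • x) := by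
    unfold Gf; rw [smul_sub, sub_smul]; abel
  have hxt := ((exp_smul_norm ht x).trans hx).trans_lt (show (1:ℝ) < 3/2 by norm_num)
  have hxs := ((exp_smul_norm hs x).trans hx).trans_lt (show (1:ℝ) < 3/2 by norm_num)
  have h1 := h.lip _ _ hxt hxs
  have h2 := h.G_le hxt
  have m1 : Real.exp (-t) ≤ Real.exp (-s) := Real.exp_le_exp.2 (by linarith)
  have m2 : Real.exp s ≤ Real.exp t := Real.exp_le_exp.2 hst
  rw [← sub_smul, norm_smul, Real.norm_eq_abs, abs_sub_comm, abs_of_nonneg (by linarith)] at h1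
  rw [norm_smul, Real.norm_eq_abs, abs_of_pos (Real.exp_pos _)] at h2
  have p1 := Real.exp_pos s
  have p2 := Real.exp_pos (-t)
  have q1 : Real.exp s * Real.exp (-s) = 1 := by rw [← Real.exp_add]; simp
  have q2 : Real.exp t * Real.exp (-t) = 1 := by rw [← Real.exp_add]; simp
  have q3 : Real.exp s * Real.exp (-t) = Real.exp (s - t) := by
    rw [← Real.exp_add]; congr 1
  have q4 : s - t + 1 ≤ Real.exp (s - t) := Real.add_one_le_exp _
  rw [e, abs_of_nonneg (by linarith)]
  refine (norm_add_le _ _).trans ?_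
  rw [norm_smul, norm_smul, Real.norm_eq_abs, Real.norm_eq_abs, abs_of_pos p1,
    abs_of_nonneg (by linarith : 0 ≤ Real.exp t - Real.exp s)]
  have b1 : Real.exp s * ‖G (Real.exp (-t) • x) - G (Real.exp (-s) • x)‖ ≤ L * (t - s) := by
    calc _ ≤ Real.exp s * (L * ((Real.exp (-s) - Real.exp (-t)) * ‖x‖)) := by gcongr
      _ = L * ((1 - Real.exp (s-t)) * ‖x‖) := by
        linear_combination (L * ‖x‖) * q1 - (L * ‖x‖) * q3
      _ ≤ L * ((t - s) * 1) := by
        apply mul_le_mul_of_nonneg_left _ (by linarith)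
        apply mul_le_mul (by linarith) hx (norm_nonneg _) (by linarith)
      _ = _ := by ring
  have b2 : (Real.exp t - Real.exp s) * ‖G (Real.exp (-t) • x)‖ ≤ L * (t - s) := by
    calc _ ≤ (Real.exp t - Real.exp s) * (L * (Real.exp (-t) * ‖x‖)) := by
          apply mul_le_mul_of_nonneg_left h2 (by linarith)
      _ = L * ((1 - Real.exp (s-t)) * ‖x‖) := by
        linear_combination (L * ‖x‖) * q2 - (L * ‖x‖) * q3
      _ ≤ L * ((t - s) * 1) := by
        apply mul_le_mul_of_nonneg_left _ (by linarith)
        apply mul_le_mul (by linarith) hx (norm_nonneg _) (by linarith)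
      _ = _ := by ring
  linarith

theorem Gf_diff (h : NSol L u G) {s t : ℝ} (hs : 0 ≤ s) (ht : 0 ≤ t) {x : EE n}
    (hx : ‖x‖ ≤ 1) : ‖Gf G t x - Gf G s x‖ ≤ 2 * L * |t - s| := by
  rcases le_total s t with h1 | h1
  · exact Gf_diff_aux h hs h1 hx
  · rw [norm_sub_rev, abs_sub_comm]; exact Gf_diff_aux h ht h1 hx

theorem gf_diff (h : NSol L u G) {s t : ℝ} (hs : 0 ≤ s) (ht : 0 ≤ t) {x : EE n}
    (hx : ‖x‖ ≤ 1) : |gf u G t x - gf u G s x| ≤ 12 * L * |t - s| := by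
  have h1 := Uf_diff h hs ht hx
  have h2 := Gf_diff h hs ht hx
  have h3 := abs_real_inner_le_norm x (Gf G t x - Gf G s x)
  have e : gf u G t x - gf u G s x = 2 * (Uf u t x - Uf u s x) - inner ℝ x (Gf G t x - Gf G s x) := by
    unfold gf dot; rw [inner_sub_right]; ring
  have h4 : ‖x‖ * ‖Gf G t x - Gf G s x‖ ≤ 1 * (2 * L * |t - s|) :=
    mul_le_mul hx h2 (norm_nonneg _) (by norm_num)
  rw [e]
  refine (abs_sub _ _).trans ?_
  rw [abs_mul, abs_two]
  linarith

theorem Uf_taylor (h : NSol L u G) {s t : ℝ} (hs : 0 ≤ s) (ht : 0 ≤ t) {x : EE n} (hx : ‖x‖ ≤ 1) :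
    |Uf u t x - Uf u s x - (t - s) * gf u G s x| ≤ 12 * L * (t - s)^2 := by
  have hL := h.hL
  have hpos : ∀ τ ∈ uIcc s t, 0 ≤ τ := fun τ hτ => by
    have := hτ.1
    exact (le_min hs ht).trans this
  have := (convex_uIcc s t).norm_image_sub_le_of_norm_hasDerivWithin_le (C := 12 * L * |t - s|)
    (f := fun t => Uf u t x - t * gf u G s x) (f' := fun t => gf u G t x - gf u G s x)
    (x := s) (y := t)
    (fun τ hτ => by
      have := (Uf_deriv h (hpos τ hτ) hx).sub ((hasDerivAt_id τ).mul_const (gf u G s x))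
      simp only [one_mul] at this
      exact this.hasDerivWithinAt)
    (fun τ hτ => by
      refine (gf_diff h hs (hpos τ hτ) hx).trans ?_
      have := abs_sub_left_of_mem_uIcc hτ
      gcongr) left_mem_uIcc right_mem_uIcc
  simp only [Real.norm_eq_abs] at this
  calc _ = |Uf u t x - t * gf u G s x - (Uf u s x - s * gf u G s x)| := by congr 1; ring
    _ ≤ _ := this
    _ = 12 * L * |t-s|^2 := by ring
    _ = _ := by rw [sq_abs]

theorem zi_taylor (h : NSol L u G) {s t : ℝ} (hs : 0 ≤ s) (ht : 0 ≤ t) {x : EE n} (hx : ‖x‖ ≤ 1) :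
    |zi (Uf u s) x * Uf u t x| ≤ 12 * L * (t - s)^2 := by
  have hL := h.hL
  by_cases hz : zi (Uf u s) x = 0
  · rw [hz]; simp; positivity
  · have h0 := (flow_NSol h hs).zi_zero (by linarith) hz
    have h1 := (flow_NSol h hs).dot_zero (by linarith) h0
    have := Uf_taylor h hs ht hx
    unfold gf at this
    rw [h0, h1] at this
    simp at this
    rw [abs_mul]
    calc _ ≤ 1 * |Uf u t x| := by gcongr; exact zi_abs _ _
      _ ≤ _ := by linarith

/-- energy along the flow -/
def Ef {n : ℕ} (u : EE n → ℝ) (G : EE n → EE n) (t : ℝ) : ℝ := En (Uf u t) (Gf G t)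
/-- dissipation along the flow -/
def Jf {n : ℕ} (u : EE n → ℝ) (G : EE n → EE n) (t : ℝ) : ℝ := Jn (Uf u t) (Gf G t)
/-- squared distance -/
def Df {n : ℕ} (u : EE n → ℝ) (q : EE n → ℝ) (t : ℝ) : ℝ := ∫ x, (Uf u t x - q x)^2 * wt x

theorem Ef_taylor (h : NSol L u G) {s t : ℝ} (hs : 0 ≤ s) (ht : 0 ≤ t) :
    |Ef u G t - Ef u G s - (t - s) * (-2 * Jf u G s)| ≤ (744 * L^2 * VB n) * (t - s)^2 := by
  have hL := h.hL
  have nt := flow_NSol h ht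
  have ns := flow_NSol h hs
  have e := En_two ns.toCW nt.toCW
  have cU := ns.cu; have cV := nt.cu
  have cs := dot_continuous ns.cu ns.cG
  have ct := dot_continuous nt.cu nt.cG
  have iu : Integrable (fun x => Uf u s x * phi x) := integ_phi cU
  have iv : Integrable (fun x => Uf u t x * phi x) := integ_phi cV
  have izu := integ_bdd (zi_meas cU) (zi_abs _) iv
  have izv := integ_bdd (zi_meas cV) (zi_abs _) iu
  have i1 : Integrable (fun x => zi (Uf u s) x * (Uf u t x * phi x) - zi (Uf u t) x * (Uf u s x * phi x)) :=
    izu.sub izv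
  have i2 : Integrable (fun x => ((Uf u t x - Uf u s x) *
    (dot (Uf u t) (Gf G t) x + dot (Uf u s) (Gf G s) x)) * wt x) := integ_wt (by fun_prop)
  have i3 : Integrable (fun x => (dot (Uf u s) (Gf G s) x)^2 * wt x) := integ_wt (by fun_prop)
  have i12 : Integrable (fun x => (zi (Uf u s) x * (Uf u t x * phi x) -
    zi (Uf u t) x * (Uf u s x * phi x)) - ((Uf u t x - Uf u s x) *
    (dot (Uf u t) (Gf G t) x + dot (Uf u s) (Gf G s) x)) * wt x) := i1.sub i2
  have e2 : Ef u G t - Ef u G s - (t - s) * (-2 * Jf u G s) =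
      ∫ x, ((zi (Uf u s) x * (Uf u t x * phi x) -
    zi (Uf u t) x * (Uf u s x * phi x)) - ((Uf u t x - Uf u s x) *
    (dot (Uf u t) (Gf G t) x + dot (Uf u s) (Gf G s) x)) * wt x) + (2 * (t-s)) *
      ((dot (Uf u s) (Gf G s) x)^2 * wt x) := by
    rw [integral_add i12 (i3.const_mul _), integral_sub i1 i2, integral_const_mul]
    unfold Ef Jf Jn; rw [e]; ring
  rw [e2]
  have := int_bd (n := n) (C := 744 * L^2 * (t-s)^2) (f := fun x => ((zi (Uf u s) x * (Uf u t x * phi x) -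
    zi (Uf u t) x * (Uf u s x * phi x)) - ((Uf u t x - Uf u s x) *
    (dot (Uf u t) (Gf G t) x + dot (Uf u s) (Gf G s) x)) * wt x) + (2 * (t-s)) *
      ((dot (Uf u s) (Gf G s) x)^2 * wt x)) (by positivity) (fun x hx => ?_)
      (fun x hx => by rw [phi_zero hx, wt_zero hx]; ring)
  · refine this.trans (le_of_eq (by ring))
  · have z1 := zi_taylor h hs ht hx.le
    have z2 := zi_taylor h ht hs hx.le
    have d1 := Uf_taylor h hs ht hx.le
    have d2 := gf_diff h hs ht hx.le
    have d3 := nt.dot_le hx.le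
    have d4 := ns.dot_le hx.le
    have w1 := wt_nonneg x
    have w2 := wt_le x
    have w3 := phi_nonneg x
    have w4 := phi_le x
    change |Uf u t x - Uf u s x - (t - s) * dot (Uf u s) (Gf G s) x| ≤ _ at d1
    change |dot (Uf u t) (Gf G t) x - dot (Uf u s) (Gf G s) x| ≤ _ at d2
    generalize Uf u t x = A at *
    generalize Uf u s x = B at *
    generalize dot (Uf u t) (Gf G t) x = g at *
    generalize dot (Uf u s) (Gf G s) x = k at *
    generalize zi (Uf u s) x = a at *
    generalize zi (Uf u t) x = b at *
    have E : a * (A * phi x) - b * (B * phi x) - (A - B) * (g + k) * wt x + 2 * (t-s) * (k^2 * wt x)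
       = (a * A) * phi x - (b * B) * phi x - (A - B - (t-s)*k) * (g + k) * wt x
        - (t-s) * (k * (g - k)) * wt x := by ring
    rw [E]
    have f1 : |a * A * phi x| ≤ 12 * L * (t-s)^2 := by
      rw [abs_mul, abs_of_nonneg w3]
      nlinarith [abs_nonneg (a*A)]
    have f2 : |b * B * phi x| ≤ 12 * L * (t-s)^2 := by
      rw [abs_mul, abs_of_nonneg w3]
      rw [show (s-t)^2 = (t-s)^2 by ring] at z2
      nlinarith [abs_nonneg (b*B)]
    have f3 : |(A - B - (t-s)*k) * (g + k) * wt x| ≤ 12 * L * (t-s)^2 * (10 * L) * 4 := by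
      rw [abs_mul, abs_mul, abs_of_nonneg w1]
      have : |g + k| ≤ 10 * L := (abs_add_le _ _).trans (by linarith)
      gcongr
    have f4 : |(t-s) * (k * (g - k)) * wt x| ≤ |t-s| * (5 * L * (12 * L * |t-s|)) * 4 := by
      rw [abs_mul, abs_mul, abs_mul, abs_of_nonneg w1]
      gcongr
    have f5 : |t-s| * (5 * L * (12 * L * |t-s|)) * 4 = 240 * L^2 * (t-s)^2 := by
      rw [← sq_abs (t-s)]; ring
    rw [f5] at f4
    have f6 : L * (t-s)^2 ≤ L^2 * (t-s)^2 := by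
      apply mul_le_mul_of_nonneg_right _ (sq_nonneg _)
      nlinarith
    have := abs_sub (a * A * phi x - b * B * phi x - (A - B - (t-s)*k) * (g + k) * wt x) ((t-s) * (k * (g - k)) * wt x)
    have := abs_sub (a * A * phi x - b * B * phi x) ((A - B - (t-s)*k) * (g + k) * wt x)
    have := abs_sub (a * A * phi x) (b * B * phi x)
    nlinarith

theorem Ef_deriv (h : NSol L u G) {t : ℝ} (ht : 0 < t) :
    HasDerivAt (Ef u G) (-2 * Jf u G t) t := by
  apply deriv_of_sq (C := 744 * L^2 * VB n)
  filter_upwards [lt_mem_nhds ht] with s hs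
  exact Ef_taylor h ht.le hs.le

theorem Df_taylor (h : NSol L u G) {q : EE n → ℝ} (cq : Continuous q)
    (hq : ∀ x, ‖x‖ ≤ 1 → |q x| ≤ 2 * L) {s t : ℝ} (hs : 0 ≤ s) (ht : 0 ≤ t) :
    |Df u q t - Df u q s - (t - s) * (2 * ∫ x, (Uf u s x - q x) * gf u G s x * wt x)| ≤
      (484 * L^2 * VB n) * (t - s)^2 := by
  have hL := h.hL
  have nt := flow_NSol h ht
  have ns := flow_NSol h hs
  have cU := ns.cu; have cV := nt.cu
  have cs : Continuous (gf u G s) := dot_continuous ns.cu ns.cG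
  have i1 : Integrable (fun x => (Uf u t x - q x)^2 * wt x) := integ_wt (by fun_prop)
  have i2 : Integrable (fun x => (Uf u s x - q x)^2 * wt x) := integ_wt (by fun_prop)
  have i3 : Integrable (fun x => (Uf u s x - q x) * gf u G s x * wt x) := integ_wt (by fun_prop)
  have i12 : Integrable (fun x => (Uf u t x - q x)^2 * wt x - (Uf u s x - q x)^2 * wt x) := i1.sub i2
  have e2 : Df u q t - Df u q s - (t - s) * (2 * ∫ x, (Uf u s x - q x) * gf u G s x * wt x) =
      ∫ x, ((Uf u t x - q x)^2 * wt x - (Uf u s x - q x)^2 * wt x) -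
        (2 * (t - s)) * ((Uf u s x - q x) * gf u G s x * wt x) := by
    rw [integral_sub i12 (i3.const_mul _), integral_sub i1 i2, integral_const_mul]
    unfold Df; ring
  rw [e2]
  have := int_bd (n := n) (C := 484 * L^2 * (t-s)^2) (f := fun x => ((Uf u t x - q x)^2 * wt x -
    (Uf u s x - q x)^2 * wt x) - (2 * (t - s)) * ((Uf u s x - q x) * gf u G s x * wt x))
     (by positivity) (fun x hx => ?_)
      (fun x hx => by rw [wt_zero hx]; ring)
  · refine this.trans (le_of_eq (by ring))
  · have d1 := Uf_taylor h hs ht hx.le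
    have d2 := Uf_diff h hs ht hx.le
    have d3 := ns.u_le (x := x) (by linarith)
    have d4 := hq x hx.le
    have w1 := wt_nonneg x
    have w2 := wt_le x
    have d5 : |Uf u s x - q x| ≤ 4 * L := by
      refine (abs_sub _ _).trans ?_
      have : 2 * L * ‖x‖ ≤ 2 * L := by nlinarith
      linarith
    generalize Uf u t x = A at *
    generalize Uf u s x = B at *
    generalize q x = Q at *
    generalize gf u G s x = k at *
    have E : (A - Q)^2 * wt x - (B - Q)^2 * wt x - 2 * (t-s) * ((B - Q) * k * wt x) =
      (A - B)^2 * wt x + 2 * ((B - Q) * (A - B - (t-s) * k)) * wt x := by ring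
    rw [E]
    have f1 : |(A-B)^2 * wt x| ≤ (5 * L * |t-s|)^2 * 4 := by
      rw [abs_mul, abs_of_nonneg w1, abs_pow]
      gcongr
    have f2 : |2 * ((B - Q) * (A - B - (t-s) * k)) * wt x| ≤ 2 * (4 * L * (12 * L * (t-s)^2)) * 4 := by
      rw [abs_mul, abs_mul, abs_mul, abs_of_nonneg w1, abs_two]
      gcongr
    have f5 : (5 * L * |t-s|)^2 * 4 = 100 * L^2 * (t-s)^2 := by
      rw [← sq_abs (t-s)]; ring
    have := abs_add_le ((A - B)^2 * wt x) (2 * ((B - Q) * (A - B - (t-s) * k)) * wt x)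
    nlinarith

theorem Df_deriv (h : NSol L u G) {q : EE n → ℝ} (cq : Continuous q)
    (hq : ∀ x, ‖x‖ ≤ 1 → |q x| ≤ 2 * L) {t : ℝ} (ht : 0 < t) :
    HasDerivAt (Df u q) (2 * ∫ x, (Uf u t x - q x) * gf u G t x * wt x) t := by
  apply deriv_of_sq (C := 484 * L^2 * VB n)
  filter_upwards [lt_mem_nhds ht] with s hs
  exact Df_taylor h cq hq ht.le hs.le

end

end

section

section
variable {n : ℕ} {L : ℝ} {u : EE n → ℝ} {G : EE n → EE n}

theorem amgm {a b : EE n → ℝ} (ha : Continuous a) (hb : Continuous b) {l : ℝ} (hl : 0 < l) :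
    |∫ x, a x * b x * wt x| ≤ (1/2) * (l * (∫ x, (a x)^2 * wt x) + l⁻¹ * ∫ x, (b x)^2 * wt x) := by
  have i1 : Integrable (fun x => (a x)^2 * wt x) := integ_wt (by fun_prop)
  have i2 : Integrable (fun x => (b x)^2 * wt x) := integ_wt (by fun_prop)
  have e : (1/2) * (l * (∫ x, (a x)^2 * wt x) + l⁻¹ * ∫ x, (b x)^2 * wt x) =
      ∫ x, (1/2) * (l * ((a x)^2 * wt x) + l⁻¹ * ((b x)^2 * wt x)) := by
    rw [integral_const_mul, integral_add (i1.const_mul _) (i2.const_mul _), integral_const_mul,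
      integral_const_mul]
  rw [e, ← Real.norm_eq_abs]
  refine norm_integral_le_of_norm_le (((i1.const_mul _).add (i2.const_mul _)).const_mul _)
    (Eventually.of_forall fun x => ?_)
  have w := wt_nonneg x
  rw [Real.norm_eq_abs, abs_mul, abs_of_nonneg w]
  have h1 : |a x * b x| ≤ (1/2) * (l * (a x)^2 + l⁻¹ * (b x)^2) := by
    have hi : l * l⁻¹ = 1 := mul_inv_cancel₀ hl.ne'
    have hp : 0 < l⁻¹ := inv_pos.2 hl
    rw [abs_le]
    constructor
    · nlinarith [mul_nonneg hp.le (sq_nonneg (l * a x + b x))]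
    · nlinarith [mul_nonneg hp.le (sq_nonneg (l * a x - b x))]
  calc _ ≤ (1/2) * (l * (a x)^2 + l⁻¹ * (b x)^2) * wt x := by gcongr
    _ = _ := by ring

theorem lim_bound (h : NSol L u G) {q : EE n → ℝ}
    (hlim : ∀ η : ℝ, 0 < η → ∃ T, ∀ t, T ≤ t → ∀ x : EE n, ‖x‖ ≤ 1 → |Uf u t x - q x| ≤ η)
    {x : EE n} (hx : ‖x‖ ≤ 1) : |q x| ≤ 2 * L := by
  have hL := h.hL
  refine le_of_forall_pos_le_add fun η hη => ?_
  obtain ⟨T, hT⟩ := hlim η hη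
  have h1 := hT (max T 0) (le_max_left _ _) x hx
  have h2 := (flow_NSol h (le_max_right T 0)).u_le (x := x) (by linarith)
  have h3 : 2 * L * ‖x‖ ≤ 2 * L := by nlinarith
  have : |q x| ≤ |Uf u (max T 0) x| + |Uf u (max T 0) x - q x| := by
    have := abs_sub (Uf u (max T 0) x) (Uf u (max T 0) x - q x)
    rwa [sub_sub_cancel] at this
  linarith

theorem Df_tendsto (h : NSol L u G) {q : EE n → ℝ}
    (hlim : ∀ η : ℝ, 0 < η → ∃ T, ∀ t, T ≤ t → ∀ x : EE n, ‖x‖ ≤ 1 → |Uf u t x - q x| ≤ η) :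
    Tendsto (Df u q) atTop (𝓝 0) := by
  rw [Metric.tendsto_atTop]
  intro η hη
  have hV := VB_nonneg n
  set κ := min 1 (η / (8 * VB n + 8)) with hκ
  have hκ0 : 0 < κ := lt_min one_pos (by positivity)
  have hκ1 : κ ≤ 1 := min_le_left _ _
  have hκ2 : κ * (8 * VB n + 8) ≤ η := by
    rw [← le_div_iff₀ (by positivity)]; exact min_le_right _ _
  obtain ⟨T, hT⟩ := hlim κ hκ0
  refine ⟨T, fun t ht => ?_⟩
  rw [Real.dist_eq, sub_zero]
  have := int_bd (n := n) (C := 4 * κ) (f := fun x => (Uf u t x - q x)^2 * wt x) (by positivity)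
    (fun x hx => by
      have h1 := hT t ht x hx.le
      rw [abs_mul, abs_of_nonneg (wt_nonneg x), abs_pow]
      calc _ ≤ κ^2 * 4 := by have w1 := wt_nonneg x; have w2 := wt_le x; gcongr
        _ ≤ _ := by nlinarith) (fun x hx => by rw [wt_zero hx, mul_zero])
  unfold Df
  nlinarith

theorem Df_nonneg (q : EE n → ℝ) (t : ℝ) : 0 ≤ Df u q t :=
  integral_nonneg fun x => mul_nonneg (sq_nonneg _) (wt_nonneg x)

theorem Jf_nonneg (t : ℝ) : 0 ≤ Jf u G t :=
  integral_nonneg fun x => mul_nonneg (sq_nonneg _) (wt_nonneg x)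

theorem Df_bound (h : NSol L u G) {q : EE n → ℝ}
    (hq : ∀ x, ‖x‖ ≤ 1 → |q x| ≤ 2 * L) {t : ℝ} (ht : 0 ≤ t) : Df u q t ≤ 64 * L^2 * VB n := by
  have hL := h.hL
  refine (le_abs_self _).trans ?_
  apply int_bd (n := n) (f := fun x => (Uf u t x - q x)^2 * wt x) (by positivity)
    (fun x hx => ?_) (fun x hx => by rw [wt_zero hx, mul_zero])
  have h1 := hq x hx.le
  have h2 := (flow_NSol h ht).u_le (x := x) (by linarith)
  have h3 : 2 * L * ‖x‖ ≤ 2 * L := by nlinarith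
  have h4 : |Uf u t x - q x| ≤ 4 * L := (abs_sub _ _).trans (by linarith)
  rw [abs_mul, abs_of_nonneg (wt_nonneg x), abs_pow]
  calc _ ≤ (4*L)^2 * 4 := by have w1 := wt_nonneg x; have w2 := wt_le x; gcongr
    _ = _ := by ring

theorem Ef_antitone (h : NSol L u G) {s t : ℝ} (hs : 0 < s) (hst : s ≤ t) :
    Ef u G t ≤ Ef u G s := by
  have : AntitoneOn (Ef u G) (Ioi 0) := by
    apply antitoneOn_of_hasDerivWithinAt_nonpos (f' := fun t => -2 * Jf u G t) (convex_Ioi 0)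
    · exact fun t ht => (Ef_deriv h ht).continuousAt.continuousWithinAt
    · intro t ht
      rw [interior_Ioi] at ht
      exact (Ef_deriv h ht).hasDerivWithinAt
    · intro t _
      have := Jf_nonneg (u := u) (G := G) t
      linarith
  exact this hs (hs.trans_le hst) hst

theorem Ef_ge (h : NSol L u G) {A : Matrix (Fin n) (Fin n) ℝ} (hA : MemP A)
    (hlim : ∀ η : ℝ, 0 < η → ∃ T, ∀ t, T ≤ t → ∀ x : EE n, ‖x‖ ≤ 1 →
      |Uf u t x - quadForm A x| ≤ η) {t : ℝ} (ht : 0 < t) :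
    ∫ x, quadForm A x * phi x ≤ Ef u G t := by
  have hL := h.hL
  have hV := VB_nonneg n
  suffices hh : ∀ η : ℝ, 0 < η → ∫ x, quadForm A x * phi x ≤ Ef u G t + 21 * L * η * VB n by
    refine le_of_forall_pos_le_add fun η hη => ?_
    have := hh (η / (21 * L * (VB n + 1))) (by positivity)
    refine this.trans ?_
    have e : 21 * L * (η / (21 * L * (VB n + 1))) * VB n = η * (VB n / (VB n + 1)) := by
      field_simp
    rw [e]
    have : VB n / (VB n + 1) ≤ 1 := by rw [div_le_one (by positivity)]; linarith
    nlinarith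
  intro η hη
  obtain ⟨T, hT⟩ := hlim η hη
  have hs : 0 < max T t := ht.trans_le (le_max_right _ _)
  have hTs := hT (max T t) (le_max_left _ _)
  have hmono := Ef_antitone h ht (le_max_right T t)
  generalize max T t = s at *
  have ns := flow_NSol h hs.le
  have e := En_quad ns.toCW hA
  have b1 := int_bd (n := n) (C := η) (f := fun x => zi (Uf u s) x * (quadForm A x * phi x)) hη.le
    (fun x hx => by
      by_cases hz : zi (Uf u s) x = 0
      · rw [hz]; simp [hη.le]
      · have h0 := ns.zi_zero (by linarith) hz
        have := hTs x hx.le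
        rw [h0, zero_sub, abs_neg] at this
        rw [abs_mul, abs_mul, abs_of_nonneg (phi_nonneg x)]
        calc _ ≤ 1 * (η * 1) := by
              have w1 := phi_nonneg x; have w2 := phi_le x; have w3 := zi_abs (Uf u s) x
              gcongr
          _ = η := by ring) (fun x hx => by rw [phi_zero hx]; ring)
  have b2 := int_bd (n := n) (C := η * (5 * L) * 4)
    (f := fun x => ((Uf u s x - quadForm A x) * dot (Uf u s) (Gf G s) x) * wt x) (by positivity)
    (fun x hx => by
      rw [abs_mul, abs_mul, abs_of_nonneg (wt_nonneg x)]
      have w1 := wt_nonneg x; have w2 := wt_le x; have w3 := hTs x hx.le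
      have w4 := ns.dot_le hx.le
      gcongr) (fun x hx => by rw [wt_zero hx]; ring)
  have c1 := le_abs_self (∫ x, zi (Uf u s) x * (quadForm A x * phi x))
  have c2 := le_abs_self (∫ x, ((Uf u s x - quadForm A x) * dot (Uf u s) (Gf G s) x) * wt x)
  change Ef u G s = _ at e
  have c3 : η * VB n ≤ L * η * VB n := by
    have : 0 ≤ η * VB n := by positivity
    nlinarith
  nlinarith

end

end

theorem ode_f {f J : ℝ → ℝ} {c α : ℝ} (hc : 0 < c) (hα : 0 < α)
    (hf : ∀ t, 0 < t → HasDerivAt f (-2 * J t) t) (f0 : ∀ t, 0 < t → 0 ≤ f t)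
    (J0 : ∀ t, 0 ≤ J t) (hl : ∀ t, 0 < t → 0 < f t → c * f t ^ (1 + α) ≤ J t) {t : ℝ} (ht : 0 < t) :
    f t ≤ (α * c) ^ (-(1/α)) * t ^ (-(1/α)) := by
  have hanti : AntitoneOn f (Ioi 0) := by
    apply antitoneOn_of_hasDerivWithinAt_nonpos (f' := fun t => -2 * J t) (convex_Ioi 0)
    · exact fun t ht => (hf t ht).continuousAt.continuousWithinAt
    · intro t ht
      rw [interior_Ioi] at ht
      exact (hf t ht).hasDerivWithinAt
    · intro t _
      have := J0 t
      linarith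
  rcases (f0 t ht).eq_or_lt with h0 | hpos
  · rw [← h0]; positivity
  have hpos' : ∀ s ∈ Icc (t/2) t, 0 < f s := fun s hs =>
    hpos.trans_le (hanti (show 0 < s by linarith [hs.1]) ht hs.2)
  have hmono : MonotoneOn (fun s => f s ^ (-α) - 2 * α * c * s) (Icc (t/2) t) := by
    have hd : ∀ s ∈ Icc (t/2) t, HasDerivAt (fun s => f s ^ (-α) - 2 * α * c * s)
        (-2 * J s * (-α) * f s ^ (-α - 1) - 2 * α * c) s := by
      intro s hs
      have hs0 : 0 < s := by linarith [hs.1]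
      have h1 := (hf s hs0).rpow_const (p := -α) (Or.inl (hpos' s hs).ne')
      have h2 := (hasDerivAt_id s).const_mul (2 * α * c)
      simp only [mul_one] at h2
      exact h1.sub h2
    apply monotoneOn_of_hasDerivWithinAt_nonneg (convex_Icc _ _)
      (f' := fun s => -2 * J s * (-α) * f s ^ (-α - 1) - 2 * α * c)
    · exact fun s hs => (hd s hs).continuousAt.continuousWithinAt
    · exact fun s hs => (hd s (interior_subset hs)).hasDerivWithinAt
    · intro s hs
      have hs' := interior_subset hs
      have hs0 : 0 < s := by linarith [hs'.1]
      have hp := hpos' s hs'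
      have h1 := hl s hs0 hp
      have h2 : 0 < f s ^ (-α - 1) := Real.rpow_pos_of_pos hp _
      have h3 : f s ^ (1 + α) * f s ^ (-α - 1) = 1 := by
        rw [← Real.rpow_add hp, show 1 + α + (-α - 1) = 0 by ring, Real.rpow_zero]
      have h4 : c * f s ^ (1 + α) * f s ^ (-α - 1) ≤ J s * f s ^ (-α - 1) := by gcongr
      rw [mul_assoc, h3, mul_one] at h4
      nlinarith
  have h1 := hmono (left_mem_Icc.2 (by linarith)) (right_mem_Icc.2 (by linarith))
    (by linarith : t/2 ≤ t)
  simp only at h1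
  have h2 : 0 < f (t/2) ^ (-α) := Real.rpow_pos_of_pos (hpos' _ (left_mem_Icc.2 (by linarith))) _
  have h3 : α * c * t ≤ f t ^ (-α) := by nlinarith
  have h4 : f t = (f t ^ (-α)) ^ (-(1/α)) := by
    rw [← Real.rpow_mul hpos.le]
    have : -α * -(1/α) = 1 := by field_simp
    rw [this, Real.rpow_one]
  rw [h4, ← Real.mul_rpow (by positivity) ht.le]
  apply Real.rpow_le_rpow_of_nonpos (by positivity) h3
  have : 0 < 1/α := by positivity
  linarith

theorem ode_D {f J D D' : ℝ → ℝ} {c α C0 δ : ℝ} (hc : 0 < c) (hα : 0 < α) (hC0 : 0 ≤ C0)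
    (hδ : 0 < δ) (hαδ : 1/α = 1 + 2 * δ)
    (hf : ∀ t, 0 < t → HasDerivAt f (-2 * J t) t) (f0 : ∀ t, 0 < t → 0 ≤ f t)
    (J0 : ∀ t, 0 ≤ J t) (hl : ∀ t, 0 < t → 0 < f t → c * f t ^ (1 + α) ≤ J t)
    (hD : ∀ t, 0 < t → HasDerivAt D (D' t) t)
    (hD' : ∀ t, 0 < t → ∀ l, 0 < l → |D' t| ≤ l * C0 + l⁻¹ * J t)
    (hlim : Tendsto D atTop (𝓝 0)) {t : ℝ} (ht : 0 < t) :
    D t ≤ ((α * c) ^ (-(1/α)) + (C0 + (1 + δ) * (α * c) ^ (-(1/α))) / δ) * t ^ (-δ) := by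
  have hfb := fun t (ht : 0 < t) => ode_f hc hα hf f0 J0 hl ht
  have hF0 : 0 ≤ (α * c) ^ (-(1/α)) := by positivity
  rw [hαδ] at hfb hF0 ⊢
  generalize (α * c) ^ (-(1 + 2 * δ)) = F at *
  set K := (C0 + (1 + δ) * F) / δ with hK
  have hKδ : K * δ = C0 + (1 + δ) * F := by rw [hK]; field_simp
  have hK0 : 0 ≤ K := by positivity
  set Y : ℝ → ℝ := fun t => t ^ (1 + δ) * f t + K * t ^ (-δ) with hY
  have hmono : MonotoneOn (fun t => D t - Y t) (Ioi 0) := by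
    have hd : ∀ s ∈ Ioi (0:ℝ), HasDerivAt (fun t => D t - Y t)
      (D' s - (((1 + δ) * s ^ (1 + δ - 1) * f s + s ^ (1 + δ) * (-2 * J s)) +
        K * (-δ * s ^ (-δ - 1)))) s := by
      intro s hs
      have h1 := Real.hasDerivAt_rpow_const (x := s) (p := 1 + δ) (Or.inl (ne_of_gt hs))
      have h2 := Real.hasDerivAt_rpow_const (x := s) (p := -δ) (Or.inl (ne_of_gt hs))
      exact (hD s hs).sub ((h1.mul (hf s hs)).add (h2.const_mul K))
    apply monotoneOn_of_hasDerivWithinAt_nonneg (convex_Ioi _)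
      (f' := fun s => (D' s - (((1 + δ) * s ^ (1 + δ - 1) * f s + s ^ (1 + δ) * (-2 * J s)) +
        K * (-δ * s ^ (-δ - 1)))))
    · exact fun s hs => (hd s hs).continuousAt.continuousWithinAt
    · exact fun s hs => (hd s (interior_subset hs)).hasDerivWithinAt
    · intro s hs
      have hs0 : 0 < s := interior_subset hs
      have p1 : 0 < s ^ (-δ - 1) := Real.rpow_pos_of_pos hs0 _
      have p2 : (s ^ (-δ - 1))⁻¹ = s ^ (1 + δ) := by
        rw [← Real.rpow_neg hs0.le]; congr 1; ring
      have h1 := hD' s hs0 (s ^ (-δ - 1)) p1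
      rw [p2] at h1
      have h2 := neg_abs_le (D' s)
      have h3 : s ^ (1 + δ - 1) * f s ≤ F * s ^ (-δ - 1) := by
        calc _ ≤ s ^ (1 + δ - 1) * (F * s ^ (-(1 + 2 * δ))) := by
              gcongr; exact hfb s hs0
          _ = F * (s ^ (1 + δ - 1) * s ^ (-(1 + 2 * δ))) := by ring
          _ = _ := by rw [← Real.rpow_add hs0]; congr 2; ring
      have h4 : 0 < s ^ (1 + δ) := Real.rpow_pos_of_pos hs0 _
      have h5 := mul_nonneg h4.le (J0 s)
      have h6 : (1 + δ) * (s ^ (1 + δ - 1) * f s) ≤ (1 + δ) * (F * s ^ (-δ - 1)) := by gcongr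
      have h7 : K * (-δ * s ^ (-δ - 1)) = - (C0 + (1 + δ) * F) * s ^ (-δ - 1) := by
        rw [← hKδ]; ring
      rw [h7]
      nlinarith
  have hDY : D t ≤ Y t := by
    refine le_of_forall_pos_le_add fun η hη => ?_
    have : ∀ᶠ s in atTop, D s < η := hlim.eventually (gt_mem_nhds hη)
    obtain ⟨s, hs1, hs2⟩ := (this.and (eventually_ge_atTop t)).exists
    have h1 := hmono (show t ∈ Ioi (0:ℝ) from ht) (show s ∈ Ioi (0:ℝ) from ht.trans_le hs2) hs2
    have hs0 : 0 < s := ht.trans_le hs2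
    have h2 : 0 ≤ Y s := by
      have := f0 s hs0
      simp only [hY]; positivity
    simp only at h1
    linarith
  refine hDY.trans ?_
  have h3 : t ^ (1 + δ) * f t ≤ F * t ^ (-δ) := by
    calc _ ≤ t ^ (1 + δ) * (F * t ^ (-(1 + 2 * δ))) := by
          gcongr; exact hfb t ht
      _ = F * (t ^ (1 + δ) * t ^ (-(1 + 2 * δ))) := by ring
      _ = _ := by rw [← Real.rpow_add ht]; congr 2; ring
  simp only [hY]
  nlinarith

section

theorem vol_closedBall {n : ℕ} (x : EE n) {r : ℝ} (hr : 0 ≤ r) :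
    volume.real (closedBall x r) = r ^ n * VB n := by
  unfold VB Measure.real
  rw [Measure.addHaar_closedBall _ _ hr, Measure.addHaar_closedBall _ _ zero_le_one]
  simp [hr]

theorem VB_pos (n : ℕ) : 0 < VB n := by
  unfold VB Measure.real
  exact ENNReal.toReal_pos (measure_closedBall_pos _ _ one_pos).ne' measure_closedBall_lt_top.ne

section
variable {n : ℕ} {L : ℝ} {u : EE n → ℝ} {G : EE n → EE n}

theorem lim_lip (h : NSol L u G) {q : EE n → ℝ}
    (hlim : ∀ η : ℝ, 0 < η → ∃ T, ∀ t, T ≤ t → ∀ x : EE n, ‖x‖ ≤ 1 → |Uf u t x - q x| ≤ η)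
    {x y : EE n} (hx : ‖x‖ ≤ 1) (hy : ‖y‖ ≤ 1) : |q x - q y| ≤ 2 * L * ‖x - y‖ := by
  refine le_of_forall_pos_le_add fun η hη => ?_
  obtain ⟨T, hT⟩ := hlim (η/2) (by positivity)
  have h1 := abs_le.1 (hT (max T 0) (le_max_left _ _) x hx)
  have h3 := abs_le.1 (hT (max T 0) (le_max_left _ _) y hy)
  have h2 := abs_le.1 ((flow_NSol h (le_max_right T 0)).u_lip (x := x) (y := y) (by linarith) (by linarith))
  rw [abs_le]
  constructor <;> linarith [h1.1, h1.2, h2.1, h2.2, h3.1, h3.2]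

theorem sup_bound {w : EE n → ℝ} (cw : Continuous w) (hL : 1 ≤ L)
    (hl : ∀ x y : EE n, ‖x‖ ≤ 1 → ‖y‖ ≤ 1 → |w x - w y| ≤ 4 * L * ‖x - y‖)
    (hb : ∀ x, ‖x‖ ≤ 1 → |w x| ≤ 4 * L) {y : EE n} (hy : ‖y‖ ≤ 1/2) :
    |w y| ^ (n+2) ≤ (4 * (16 * L)^n / VB n) * ∫ x, (w x)^2 * wt x := by
  have hV := VB_pos n
  set m := |w y| with hm
  have hm0 : 0 ≤ m := abs_nonneg _
  have hm1 : m ≤ 4 * L := hb y (by linarith)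
  set ρ := m / (16 * L) with hρ
  have hρ0 : 0 ≤ ρ := by positivity
  have hρ1 : ρ * (16 * L) = m := by rw [hρ]; field_simp
  have hρ2 : ρ ≤ 1/4 := by
    rw [hρ, div_le_iff₀ (by positivity)]; linarith
  have i : Integrable (fun x => (w x)^2 * wt x) := integ_wt (by fun_prop)
  have h1 : (m/2)^2 * volume.real (closedBall y ρ) ≤ ∫ x, (w x)^2 * wt x := by
    calc _ = ∫ x in closedBall y ρ, (m/2)^2 := by
          rw [setIntegral_const, smul_eq_mul, mul_comm]
      _ ≤ ∫ x in closedBall y ρ, (w x)^2 * wt x := by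
          apply setIntegral_mono_on (integrableOn_const measure_closedBall_lt_top.ne (by simp))
            i.integrableOn measurableSet_closedBall
          intro x hx
          rw [mem_closedBall, dist_eq_norm] at hx
          have hx1 : ‖x‖ ≤ 3/4 := by
            have := norm_add_le (x - y) y
            rw [sub_add_cancel] at this
            linarith
          have hw : 1 ≤ wt x := by
            have : 1 - ‖x‖^2 ≤ max 0 (1 - ‖x‖^2) := le_max_right _ _
            unfold wt pp
            nlinarith [norm_nonneg x]
          have h2 := hl y x (by linarith) (by linarith)
          rw [norm_sub_rev] at h2
          have h3 : m ≤ |w x| + |w y - w x| := by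
            have := abs_add_le (w x) (w y - w x)
            rwa [add_sub_cancel] at this
          have h4 : 4 * L * ‖x - y‖ ≤ 4 * L * ρ := by gcongr
          have h5 : m/2 ≤ |w x| := by nlinarith
          have h6 : (m/2)^2 ≤ (w x)^2 := by
            rw [← sq_abs (w x)]; gcongr
          nlinarith [sq_nonneg (w x)]
      _ ≤ _ := setIntegral_le_integral i (Eventually.of_forall fun x =>
          mul_nonneg (sq_nonneg _) (wt_nonneg x))
  rw [vol_closedBall y hρ0] at h1
  have h2 : m ^ (n+2) = (4 * (16 * L)^n / VB n) * ((m/2)^2 * (ρ^n * VB n)) := by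
    field_simp
    rw [pow_add, ← hρ1, mul_pow]
    ring
  rw [h2]
  gcongr

end

end

section

theorem mv01 {f f' : ℝ → ℝ} {M : ℝ} (hM : 0 ≤ M) (hf : ∀ s ∈ Icc (0:ℝ) 1, HasDerivAt f (f' s) s)
    (hb : ∀ s ∈ Ioo (0:ℝ) 1, |f' s| ≤ M) {s : ℝ} (hs : s ∈ Icc (0:ℝ) 1) : |f s - f 0| ≤ M * s := by
  have m1 : MonotoneOn (fun s => M * s - f s) (Icc 0 1) := by
    apply monotoneOn_of_hasDerivWithinAt_nonneg (convex_Icc _ _) (f' := fun s => M - f' s)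
    · exact fun s hs => ((continuous_const.mul continuous_id).continuousAt.sub
        (hf s hs).continuousAt).continuousWithinAt
    · intro s hs
      have := ((hasDerivAt_id s).const_mul M).sub (hf s (interior_subset hs))
      simp only [mul_one] at this
      exact this.hasDerivWithinAt
    · intro s hs
      rw [interior_Icc] at hs
      have := (abs_le.1 (hb s hs)).2
      linarith
  have m2 : MonotoneOn (fun s => M * s + f s) (Icc 0 1) := by
    apply monotoneOn_of_hasDerivWithinAt_nonneg (convex_Icc _ _) (f' := fun s => M + f' s)
    · exact fun s hs => ((continuous_const.mul continuous_id).continuousAt.add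
        (hf s hs).continuousAt).continuousWithinAt
    · intro s hs
      have := ((hasDerivAt_id s).const_mul M).add (hf s (interior_subset hs))
      simp only [mul_one] at this
      exact this.hasDerivWithinAt
    · intro s hs
      rw [interior_Icc] at hs
      have := (abs_le.1 (hb s hs)).1
      linarith
  have h1 := m1 (left_mem_Icc.2 zero_le_one) hs hs.1
  have h2 := m2 (left_mem_Icc.2 zero_le_one) hs hs.1
  simp only at h1 h2
  rw [abs_le]
  constructor <;> linarith

theorem oneD {v v1 v2 v3 c0 c1 c2 c3 : ℝ → ℝ} {M η : ℝ} (hM : 0 ≤ M) (hη : 0 < η) (hη1 : η < 1)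
    (hv : ∀ s, |s| < 2 → HasDerivAt v (v1 s) s) (hv1 : ∀ s, |s| < 2 → HasDerivAt v1 (v2 s) s)
    (hv2 : ∀ s, |s| < 2 → HasDerivAt v2 (v3 s) s)
    (hc : ∀ s, |s| < 2 → HasDerivAt c0 (c1 s) s) (hc1 : ∀ s, |s| < 2 → HasDerivAt c1 (c2 s) s)
    (hc2 : ∀ s, |s| < 2 → HasDerivAt c2 (c3 s) s)
    (he : ∀ s ∈ Ioo (-η) (1+η), c0 s = 2 * v s - s * v1 s)
    (hb : ∀ s ∈ Icc (0:ℝ) 1, |c3 s| ≤ M) :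
    |v 1 - v 0 - v1 0 - v2 0 / 2| ≤ M := by
  have h2 : ∀ s ∈ Ioo (-η) (1+η), |s| < 2 := fun s hs => by
    rw [abs_lt]; constructor <;> linarith [hs.1, hs.2]
  have h3 : ∀ s ∈ Icc (0:ℝ) 1, |s| < 2 := fun s hs => by
    rw [abs_lt]; constructor <;> linarith [hs.1, hs.2]
  have he1 : ∀ s ∈ Ioo (-η) (1+η), c1 s = v1 s - s * v2 s := by
    intro s hs
    have d1 : HasDerivAt (fun s => 2 * v s - s * v1 s) (2 * v1 s - (1 * v1 s + s * v2 s)) s :=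
      ((hv s (h2 s hs)).const_mul 2).sub ((hasDerivAt_id s).mul (hv1 s (h2 s hs)))
    have d2 : HasDerivAt (fun s => 2 * v s - s * v1 s) (c1 s) s := by
      refine (hc s (h2 s hs)).congr_of_eventuallyEq ?_
      filter_upwards [Ioo_mem_nhds hs.1 hs.2] with t ht
      exact (he t ht).symm
    rw [d2.unique d1]; ring
  have he2 : ∀ s ∈ Ioo (-η) (1+η), c2 s = - s * v3 s := by
    intro s hs
    have d1 : HasDerivAt (fun s => v1 s - s * v2 s) (v2 s - (1 * v2 s + s * v3 s)) s :=
      (hv1 s (h2 s hs)).sub ((hasDerivAt_id s).mul (hv2 s (h2 s hs)))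
    have d2 : HasDerivAt (fun s => v1 s - s * v2 s) (c2 s) s := by
      refine (hc1 s (h2 s hs)).congr_of_eventuallyEq ?_
      filter_upwards [Ioo_mem_nhds hs.1 hs.2] with t ht
      exact (he1 t ht).symm
    rw [d2.unique d1]; ring
  have c20 : c2 0 = 0 := by rw [he2 0 ⟨by linarith, by linarith⟩]; ring
  have b3 : ∀ s ∈ Ioo (0:ℝ) 1, |v3 s| ≤ M := by
    intro s hs
    have h := mv01 hM (fun s hs => hc2 s (h3 s hs)) (fun s hs => hb s ⟨hs.1.le, hs.2.le⟩)
      (s := s) ⟨hs.1.le, hs.2.le⟩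
    rw [c20, sub_zero, he2 s ⟨by linarith [hs.1], by linarith [hs.2]⟩, abs_mul, abs_neg,
      abs_of_pos hs.1] at h
    nlinarith [hs.1]
  have b2 : ∀ s ∈ Icc (0:ℝ) 1, |v2 s - v2 0| ≤ M := by
    intro s hs
    have := mv01 hM (fun s hs => hv2 s (h3 s hs)) b3 hs
    nlinarith [hs.1, hs.2]
  have b1 : ∀ s ∈ Icc (0:ℝ) 1, |v1 s - s * v2 0 - v1 0| ≤ M := by
    intro s hs
    have := mv01 (f := fun s => v1 s - s * v2 0) (f' := fun s => v2 s - v2 0) hM (fun s hs => by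
      exact ((hv1 s (h3 s hs)).sub ((hasDerivAt_id s).mul_const (v2 0))).congr_deriv (by simp))
      (fun s hs => b2 s ⟨hs.1.le, hs.2.le⟩) hs
    simp only [zero_mul, sub_zero] at this
    nlinarith [hs.1, hs.2]
  have b0 := mv01 (f := fun s => v s - s^2 / 2 * v2 0 - s * v1 0)
    (f' := fun s => v1 s - s * v2 0 - v1 0) hM (fun s hs => by
      have d1 : HasDerivAt (fun s : ℝ => s^2/2) s s := by
        refine ((hasDerivAt_pow 2 s).div_const 2).congr_deriv ?_
        norm_num
      exact (((hv s (h3 s hs)).sub (d1.mul_const (v2 0))).sub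
        ((hasDerivAt_id s).mul_const (v1 0))).congr_deriv (by simp))
      (fun s hs => b1 s ⟨hs.1.le, hs.2.le⟩) (s := 1) ⟨zero_le_one, le_rfl⟩
  calc _ = |v 1 - 1 ^ 2 / 2 * v2 0 - 1 * v1 0 - (v 0 - 0 ^ 2 / 2 * v2 0 - 0 * v1 0)| := by
        congr 1; ring
    _ ≤ _ := by linarith

section
variable {n : ℕ}

/-- basic kernels -/
def TT (b : ℝ) (x : EE n) (k j : ℕ) (s : ℝ) (y : EE n) : ℝ :=
  pp k (b * ‖y - s • x‖^2) * (inner ℝ x (y - s • x))^j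

/-- moments -/
def MM (b : ℝ) (w : EE n → ℝ) (x : EE n) (k j : ℕ) (s : ℝ) : ℝ := ∫ y, w y * TT b x k j s y

theorem TT_cont (b : ℝ) (x : EE n) (k j : ℕ) (s : ℝ) : Continuous (TT b x k j s) := by
  unfold TT
  exact ((pp_continuous k).comp (by fun_prop)).mul (by fun_prop)

theorem TT_zero {b ε : ℝ} (hb : b * ε^2 = 1) (hε : 0 < ε) (x : EE n) {k : ℕ} (hk : k ≠ 0) (j : ℕ) (s : ℝ) {y : EE n}
    (hy : ε ≤ ‖y - s • x‖) : TT b x k j s y = 0 := by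
  unfold TT
  have hb0 : 0 < b := by by_contra h; nlinarith [sq_nonneg ε]
  rw [pp_eq_zero hk (by rw [← hb]; gcongr), zero_mul]

theorem TT_le {b ε : ℝ} (hb : b * ε^2 = 1) (hε : 0 < ε) {x : EE n} (hx : ‖x‖ ≤ 1) {k : ℕ}
    (hk : k ≠ 0) (j : ℕ) (s : ℝ) (y : EE n) : |TT b x k j s y| ≤ ε^j := by
  have hb0 : 0 < b := by by_contra h; nlinarith [sq_nonneg ε]
  by_cases hy : ε ≤ ‖y - s • x‖
  · rw [TT_zero hb hε x hk j s hy]; simp; positivity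
  · unfold TT
    have h1 := abs_real_inner_le_norm x (y - s • x)
    have h2 : |inner ℝ x (y - s • x)| ≤ ε := by
      refine h1.trans ?_
      calc _ ≤ 1 * ε := by gcongr; exact (not_le.1 hy).le
        _ = ε := one_mul _
    rw [abs_mul, abs_pow, abs_of_nonneg (pp_nonneg _ _)]
    calc _ ≤ 1 * ε^j := by
          gcongr
          exact pp_le_one _ (by positivity)
      _ = _ := one_mul _

theorem TT_deriv (b : ℝ) (x : EE n) (k j : ℕ) (s : ℝ) (y : EE n) :
    HasDerivAt (fun s => TT b x (k+2) j s y) (2 * b * (k+2) * TT b x (k+1) (j+1) s y -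
      j * ‖x‖^2 * TT b x (k+2) (j-1) s y) s := by
  have hm : HasDerivAt (fun s : ℝ => y - s • x) (-x) s := by
    simpa using ((hasDerivAt_id s).smul_const x).const_sub y
  have h1 : HasDerivAt (fun s : ℝ => b * ‖y - s • x‖^2) (b * (2 * inner ℝ (y - s • x) (-x))) s := by
    exact (hm.norm_sq).const_mul b
  have h2 : HasDerivAt (fun s => pp (k+2) (b * ‖y - s • x‖^2))
      (-((k:ℝ)+2) * pp (k+1) (b * ‖y - s • x‖^2) * (b * (2 * inner ℝ (y - s • x) (-x)))) s :=
    HasDerivAt.comp (h₂ := pp (k+2)) (h := fun s : ℝ => b * ‖y - s • x‖^2) s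
      (pp_hasDerivAt k (b * ‖y - s • x‖^2)) h1
  have h3 : HasDerivAt (fun s : ℝ => inner ℝ x (y - s • x)) (inner ℝ x (-x)) s := by
    have := (innerSL ℝ x).hasFDerivAt.comp_hasDerivAt s hm
    exact this
  have h4 := h2.mul (h3.pow j)
  refine h4.congr_deriv ?_
  simp only [Pi.pow_apply]
  unfold TT
  rw [inner_neg_right, inner_neg_right, real_inner_self_eq_norm_sq, real_inner_comm x (y - s • x)]
  ring

theorem TT_far {b ε : ℝ} (hb : b * ε^2 = 1) (hε : 0 < ε) (hε1 : ε ≤ 1) {x : EE n} (hx : ‖x‖ ≤ 1)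
    {k : ℕ} (hk : k ≠ 0) (j : ℕ) {s : ℝ} (hs : |s| ≤ 2) {y : EE n} (hy : 3 ≤ ‖y‖) :
    TT b x k j s y = 0 := by
  apply TT_zero hb hε x hk
  have h1 : ‖s • x‖ ≤ 2 := by
    rw [norm_smul, Real.norm_eq_abs]
    nlinarith [norm_nonneg x, abs_nonneg s]
  have := norm_sub_norm_le y (s • x)
  linarith

theorem w_integ {w : EE n → ℝ} (hw : IntegrableOn w (closedBall 0 3)) {K : EE n → ℝ}
    (hK : Continuous K) (h0 : ∀ y, 3 ≤ ‖y‖ → K y = 0) {C : ℝ} (hC : ∀ y, |K y| ≤ C) :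
    Integrable (fun y => w y * K y) := by
  have h1 : Integrable ((closedBall (0: EE n) 3).indicator w) := by
    rwa [integrable_indicator_iff measurableSet_closedBall]
  have h2 := h1.mul_bdd (g := K) (c := C) hK.aestronglyMeasurable (Eventually.of_forall fun y => by simpa using hC y)
  refine h2.congr (Eventually.of_forall fun y => ?_)
  by_cases hy : 3 ≤ ‖y‖
  · simp [h0 y hy]
  · simp only
    rw [indicator_of_mem (by simpa using (not_le.1 hy).le)]

theorem MM_deriv {b ε : ℝ} (hb : b * ε^2 = 1) (hε : 0 < ε) (hε1 : ε ≤ 1) {x : EE n} (hx : ‖x‖ ≤ 1)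
    {w : EE n → ℝ} (hw : IntegrableOn w (closedBall 0 3)) (k j : ℕ) {s : ℝ} (hs : |s| < 2) :
    HasDerivAt (MM b w x (k+2) j) (2 * b * (k+2) * MM b w x (k+1) (j+1) s -
      j * ‖x‖^2 * MM b w x (k+2) (j-1) s) s := by
  have hI : ∀ (k j : ℕ) {s : ℝ}, |s| < 2 → Integrable (fun y => w y * TT b x (k+1) j s y) :=
    fun k j s hs => w_integ hw (TT_cont _ _ _ _ _)
      (fun y hy => TT_far hb hε hε1 hx (by omega) _ hs.le hy)
      (fun y => TT_le hb hε hx (by omega) _ _ _)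
  have hb0 : 0 < b := by by_contra h; nlinarith [sq_nonneg ε]
  set K' : ℝ → EE n → ℝ := fun s y => 2 * b * (k+2) * TT b x (k+1) (j+1) s y -
      j * ‖x‖^2 * TT b x (k+2) (j-1) s y with hK'
  set C : ℝ := 2 * b * (k+2) + j with hC
  have hS : {s : ℝ | |s| < 2} ∈ 𝓝 s := (isOpen_lt continuous_abs continuous_const).mem_nhds hs
  have hbd : ∀ s y, |K' s y| ≤ C := by
    intro s y
    have h1 := TT_le hb hε hx (k := k+1) (by omega) (j+1) s y
    have h2 := TT_le hb hε hx (k := k+2) (by omega) (j-1) s y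
    have h3 : ε^(j+1) ≤ 1 := pow_le_one₀ hε.le hε1
    have h4 : ε^(j-1) ≤ 1 := pow_le_one₀ hε.le hε1
    have h5 : |2 * b * (k+2) * TT b x (k+1) (j+1) s y| ≤ 2 * b * (k+2) * 1 := by
      rw [abs_mul, abs_of_pos (by positivity)]
      have := h1.trans h3
      gcongr
    have h6 : |j * ‖x‖^2 * TT b x (k+2) (j-1) s y| ≤ j * 1^2 * 1 := by
      rw [abs_mul, abs_of_nonneg (by positivity)]
      have := h2.trans h4
      gcongr
    refine (abs_sub _ _).trans ?_
    simp only [hC]; linarith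
  have hiw : Integrable ((closedBall (0: EE n) 3).indicator w) := by
    rwa [integrable_indicator_iff measurableSet_closedBall]
  have key := (hasDerivAt_integral_of_dominated_loc_of_deriv_le (μ := volume) (x₀ := s)
    (F := fun s y => w y * TT b x (k+2) j s y) (F' := fun s y => w y * K' s y)
    (bound := fun y => |(closedBall (0: EE n) 3).indicator w y| * C) hS ?_ ?_ ?_ ?_ ?_ ?_).2
  · have e : ∫ y, w y * K' s y = 2 * b * (k+2) * MM b w x (k+1) (j+1) s -
      j * ‖x‖^2 * MM b w x (k+2) (j-1) s := by
      unfold MM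
      rw [← integral_const_mul, ← integral_const_mul, ← integral_sub
        ((hI k (j+1) hs).const_mul _) ((hI (k+1) (j-1) hs).const_mul _)]
      congr 1; ext y; simp only [hK']; ring
    rw [← e]; exact key
  · filter_upwards [hS] with t ht
    exact (hI (k+1) j ht).aestronglyMeasurable
  · exact hI (k+1) j hs
  · have : Integrable (fun y => w y * K' s y) := by
      have := ((hI k (j+1) hs).const_mul (2 * b * (k+2))).sub ((hI (k+1) (j-1) hs).const_mul (j * ‖x‖^2))
      refine this.congr (Eventually.of_forall fun y => ?_)
      simp only [hK', Pi.sub_apply]; ring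
    exact this.aestronglyMeasurable
  · refine Eventually.of_forall fun y t ht => ?_
    by_cases hy : 3 ≤ ‖y‖
    · have : K' t y = 0 := by
        simp only [hK']
        rw [TT_far hb hε hε1 hx (by omega) _ (le_of_lt ht) hy, TT_far hb hε hε1 hx (by omega) _ (le_of_lt ht) hy]
        ring
      rw [this, mul_zero, norm_zero]; positivity
    · rw [indicator_of_mem (by simpa using (not_le.1 hy).le), norm_mul, Real.norm_eq_abs, Real.norm_eq_abs]
      gcongr
      exact hbd t y
  · exact hiw.abs.mul_const _
  · refine Eventually.of_forall fun y t ht => ?_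
    exact (TT_deriv b x k j t y).const_mul (w y)

theorem MM_le {b ε : ℝ} (hb : b * ε^2 = 1) (hε : 0 < ε) {x : EE n} (hx : ‖x‖ ≤ 1 - 2 * ε)
    {w : EE n → ℝ} (hw : IntegrableOn w (closedBall 0 3)) {k : ℕ} (hk : k ≠ 0) (j : ℕ) {s : ℝ}
    (hs : s ∈ Icc (0:ℝ) 1) :
    |MM b w x k j s| ≤ ε^j * ∫ y in closedBall 0 (1 - ε), |w y| := by
  have hx1 : ‖x‖ ≤ 1 := by linarith
  have hi : IntegrableOn (fun y => |w y|) (closedBall 0 (1-ε)) :=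
    (hw.mono_set (closedBall_subset_closedBall (by linarith))).abs
  have h1 : Integrable ((closedBall (0: EE n) (1-ε)).indicator (fun y => |w y|)) := by
    rwa [integrable_indicator_iff measurableSet_closedBall]
  rw [← integral_indicator measurableSet_closedBall, ← integral_const_mul, ← Real.norm_eq_abs]
  refine norm_integral_le_of_norm_le (h1.const_mul _) (Eventually.of_forall fun y => ?_)
  by_cases hy : ε ≤ ‖y - s • x‖
  · rw [TT_zero hb hε x hk j s hy, mul_zero, norm_zero]
    exact mul_nonneg (by positivity) (indicator_nonneg (fun _ _ => abs_nonneg _) _)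
  · have h2 : ‖s • x‖ ≤ 1 - 2 * ε := by
      rw [norm_smul, Real.norm_eq_abs, abs_of_nonneg hs.1]
      nlinarith [norm_nonneg x, hs.1, hs.2]
    have h3 := norm_add_le (y - s • x) (s • x)
    rw [sub_add_cancel] at h3
    rw [indicator_of_mem (by simp; linarith [not_le.1 hy]), norm_mul, Real.norm_eq_abs, Real.norm_eq_abs, mul_comm]
    gcongr
    exact TT_le hb hε hx1 hk j s y

end

end

section

section
variable {n : ℕ} {L : ℝ} {u : EE n → ℝ} {G : EE n → EE n}

theorem ker_test {b ε : ℝ} (hb : b * ε^2 = 1) (hε : 0 < ε) {c : EE n} (hc : ‖c‖ ≤ 1 - ε) (k : ℕ) :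
    Tst (fun y => pp (k+2) (b * ‖y - c‖^2))
      (fun y => (-((k:ℝ)+2) * pp (k+1) (b * ‖y - c‖^2) * (2*b)) • (y - c)) := by
  have hb0 : 0 < b := by by_contra h; nlinarith [sq_nonneg ε]
  refine ⟨fun y => pp_HG k b c y, ?_, fun y hy => ?_⟩
  · have h : Continuous (fun y : EE n => pp (k+1) (b * ‖y - c‖^2)) :=
      (pp_continuous (k+1)).comp (by fun_prop)
    fun_prop
  · have h1 : ε ≤ ‖y - c‖ := by
      have := norm_sub_norm_le y c
      linarith
    have h2 : 1 ≤ b * ‖y - c‖^2 := by rw [← hb]; gcongr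
    rw [pp_eq_zero (by omega) h2, pp_eq_zero (by omega) h2]; simp

theorem v1_eq (h : NSol L u G) {b ε : ℝ} (hb : b * ε^2 = 1) (hε : 0 < ε) {x : EE n} {s : ℝ}
    (hc : ‖s • x‖ ≤ 1 - ε) :
    10 * b * MM b u x 4 1 s = ∫ y, inner ℝ (G y) x * pp 5 (b * ‖y - s • x‖^2) := by
  have cu := h.cu; have cG := h.cG
  have T0 := ker_test hb hε hc 3
  have T := mul_test h.cu h.cG h.grad T0
  have e := integral_grad_zero T.grad T.cont T.zero x
  have ck : ∀ k, Continuous (fun y : EE n => pp k (b * ‖y - s • x‖^2)) := fun k =>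
    (pp_continuous k).comp (by fun_prop)
  have c4 := ck 4
  have z : ∀ y : EE n, 1 ≤ ‖y‖ → ∀ k ≠ 0, pp k (b * ‖y - s • x‖^2) = 0 := by
    intro y hy k hk
    have hb0 : 0 < b := by by_contra h; nlinarith [sq_nonneg ε]
    have h1 : ε ≤ ‖y - s • x‖ := by
      have := norm_sub_norm_le y (s • x)
      linarith
    exact pp_eq_zero hk (by rw [← hb]; gcongr)
  have e2 : ∀ y, inner ℝ (u y • (-((3:ℕ):ℝ) - 2 + (0:ℝ)) • x) x = inner ℝ (u y • (-((3:ℕ):ℝ) - 2 + (0:ℝ)) • x) x := fun _ => rfl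
  clear e2
  have i1 : Integrable (fun y => u y * TT b x 4 1 s y) := by
    refine integ_cont (cu.mul (TT_cont _ _ _ _ _)) fun y hy => ?_
    unfold TT
    rw [z y hy 4 (by norm_num)]; simp
  have i2 : Integrable (fun y => inner ℝ (G y) x * pp 5 (b * ‖y - s • x‖^2)) := by
    refine integ_cont ((by fun_prop : Continuous fun y => inner ℝ (G y) x).mul (ck 5)) fun y hy => ?_
    rw [z y hy 5 (by norm_num)]; simp
  have e3 : (∫ y, inner ℝ (G y) x * pp 5 (b * ‖y - s • x‖^2)) - 10 * b * MM b u x 4 1 s = 0 := by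
    rw [← e]
    unfold MM
    rw [← integral_const_mul, ← integral_sub i2 (i1.const_mul _)]
    congr 1; ext y
    rw [inner_add_left, inner_smul_left, inner_smul_left, inner_smul_left]
    unfold TT
    rw [real_inner_comm x (y - s • x)]
    simp
    ring
  linarith

theorem gamma_id (h : NSol L u G) {b ε : ℝ} (hb : b * ε^2 = 1) (hε : 0 < ε) {x : EE n} {s : ℝ}
    (hc : ‖s • x‖ ≤ 1 - ε) :
    MM b (dot u G) x 5 0 s + (1/(12*b)) * ((∫ y : EE n, pp 6 (b * ‖y‖^2)) - MM b (zi u) x 6 0 s) =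
      2 * MM b u x 5 0 s - s * (10 * b * MM b u x 4 1 s) := by
  have hb0 : 0 < b := by by_contra h; nlinarith [sq_nonneg ε]
  have cu := h.cu; have cG := h.cG
  have ck : ∀ k, Continuous (fun y : EE n => pp k (b * ‖y - s • x‖^2)) := fun k =>
    (pp_continuous k).comp (by fun_prop)
  have z : ∀ y : EE n, 1 ≤ ‖y‖ → ∀ k ≠ 0, pp k (b * ‖y - s • x‖^2) = 0 := by
    intro y hy k hk
    have h1 : ε ≤ ‖y - s • x‖ := by
      have := norm_sub_norm_le y (s • x)
      linarith
    exact pp_eq_zero hk (by rw [← hb]; gcongr)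
  have ii : ∀ w : EE n → ℝ, Continuous w → ∀ k ≠ 0, Integrable (fun y => w y * pp k (b * ‖y - s • x‖^2)) := by
    intro w hw k hk
    refine integ_cont (hw.mul (ck k)) fun y hy => ?_
    rw [z y hy k hk, mul_zero]
  have i6 : Integrable (fun y => pp 6 (b * ‖y - s • x‖^2)) :=
    integ_cont (ck 6) fun y hy => z y hy 6 (by norm_num)
  have tr : (∫ y : EE n, pp 6 (b * ‖y‖^2)) = ∫ y : EE n, pp 6 (b * ‖y - s • x‖^2) :=
    (integral_sub_right_eq_self (fun y : EE n => pp 6 (b * ‖y‖^2)) (s • x)).symm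
  have hw := h.weak _ _ (ker_test hb hε hc 4)
  have e1 : ∫ y, posInd u y * pp 6 (b * ‖y - s • x‖^2) =
      (∫ y : EE n, pp 6 (b * ‖y‖^2)) - MM b (zi u) x 6 0 s := by
    unfold MM TT
    simp only [pow_zero, mul_one]
    rw [tr, ← integral_sub i6 (integ_bdd (zi_meas cu) (zi_abs u) i6)]
    congr 1; ext x; rw [posInd_eq]; ring
  have e2 : ∫ y, inner ℝ (G y) ((-(((4:ℕ):ℝ)+2) * pp (4+1) (b * ‖y - s • x‖^2) * (2*b)) • (y - s • x)) =
      -(12 * b) * ∫ y, inner ℝ (G y) (y - s • x) * pp 5 (b * ‖y - s • x‖^2) := by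
    rw [← integral_const_mul]
    congr 1; ext y
    rw [inner_smul_right]; push_cast; ring
  rw [e2] at hw
  have e1' : ∫ y, posInd u y * pp (4+2) (b * ‖y - s • x‖^2) =
      (∫ y : EE n, pp 6 (b * ‖y‖^2)) - MM b (zi u) x 6 0 s := e1
  rw [e1'] at hw
  have e3 : ∫ y, inner ℝ (G y) (y - s • x) * pp 5 (b * ‖y - s • x‖^2) =
      (1/(12*b)) * ((∫ y : EE n, pp 6 (b * ‖y‖^2)) - MM b (zi u) x 6 0 s) := by
    field_simp
    linarith
  rw [← e3, v1_eq h hb hε hc]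
  unfold MM TT
  simp only [pow_zero, mul_one]
  have j1 := ii _ (dot_continuous cu cG) 5 (by norm_num)
  have j2 := ii (fun y => inner ℝ (G y) (y - s • x)) (by fun_prop) 5 (by norm_num)
  have j3 := ii _ cu 5 (by norm_num)
  have j4 := ii (fun y => inner ℝ (G y) x) (by fun_prop) 5 (by norm_num)
  rw [← integral_const_mul, ← integral_const_mul, ← integral_add j1 j2,
    ← integral_sub (j3.const_mul _) (j4.const_mul _)]
  congr 1; ext y
  unfold dot
  rw [inner_sub_right, inner_smul_right, real_inner_comm y]
  ring

/-- Taylor bound for mollification -/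
theorem taylor_moll (h : NSol L u G) {b ε : ℝ} (hb : b * ε^2 = 1) (hε : 0 < ε) (hε1 : ε ≤ 1/4)
    {x : EE n} (hx : ‖x‖ ≤ 1 - 2 * ε) :
    |MM b u x 5 0 1 - MM b u x 5 0 0 - 10 * b * MM b u x 4 1 0 -
      (10 * b * (8 * b * MM b u x 3 2 0 - ‖x‖^2 * MM b u x 4 0 0)) / 2| ≤
      720 * ε⁻¹^3 * ((∫ y in closedBall (0: EE n) (1 - ε), |dot u G y|) +
        ∫ y in closedBall (0: EE n) (1 - ε), |zi u y|) := by
  have hb0 : 0 < b := by by_contra h; nlinarith [sq_nonneg ε]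
  have hbe : b = ε⁻¹^2 := by field_simp; linarith
  have hx1 : ‖x‖ ≤ 1 := by linarith
  have he1 : ε ≤ 1 := by linarith
  have cu := h.cu; have cG := h.cG
  have wu : IntegrableOn u (closedBall 0 3) := cu.continuousOn.integrableOn_compact (isCompact_closedBall _ _)
  have wg : IntegrableOn (dot u G) (closedBall 0 3) :=
    (dot_continuous cu cG).continuousOn.integrableOn_compact (isCompact_closedBall _ _)
  have wz : IntegrableOn (zi u) (closedBall 0 3) := by
    have : IntegrableOn (fun _ : EE n => (1:ℝ)) (closedBall 0 3) :=
      integrableOn_const measure_closedBall_lt_top.ne (by simp)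
    have := this.bdd_mul (f := zi u) (c := 1) (zi_meas cu).aestronglyMeasurable
      (Eventually.of_forall (fun x => by simpa using zi_abs u x))
    simpa [IntegrableOn] using this
  have D5 : ∀ {w : EE n → ℝ}, IntegrableOn w (closedBall 0 3) → ∀ s, |s| < 2 →
      HasDerivAt (MM b w x 5 0) (10 * b * MM b w x 4 1 s) s := fun hw s hs =>
    (MM_deriv hb hε he1 hx1 hw 3 0 hs).congr_deriv (by push_cast; ring)
  have D4 : ∀ {w : EE n → ℝ}, IntegrableOn w (closedBall 0 3) → ∀ s, |s| < 2 →
      HasDerivAt (fun s => 10 * b * MM b w x 4 1 s)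
        (10 * b * (8 * b * MM b w x 3 2 s - ‖x‖^2 * MM b w x 4 0 s)) s := fun hw s hs =>
    ((MM_deriv hb hε he1 hx1 hw 2 1 hs).const_mul (10 * b)).congr_deriv (by push_cast; ring)
  have D3 : ∀ {w : EE n → ℝ}, IntegrableOn w (closedBall 0 3) → ∀ s, |s| < 2 →
      HasDerivAt (fun s => 10 * b * (8 * b * MM b w x 3 2 s - ‖x‖^2 * MM b w x 4 0 s))
        (480 * b^3 * MM b w x 2 3 s - 240 * b^2 * ‖x‖^2 * MM b w x 3 1 s) s := fun hw s hs =>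
    ((((MM_deriv hb hε he1 hx1 hw 1 2 hs).const_mul (8 * b)).sub
      ((MM_deriv hb hε he1 hx1 hw 2 0 hs).const_mul (‖x‖^2))).const_mul (10 * b)).congr_deriv
      (by push_cast; ring)
  have F6 : ∀ {w : EE n → ℝ}, IntegrableOn w (closedBall 0 3) → ∀ s, |s| < 2 →
      HasDerivAt (MM b w x 6 0) (12 * b * MM b w x 5 1 s) s := fun hw s hs =>
    (MM_deriv hb hε he1 hx1 hw 4 0 hs).congr_deriv (by push_cast; ring)
  have F5 : ∀ {w : EE n → ℝ}, IntegrableOn w (closedBall 0 3) → ∀ s, |s| < 2 →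
      HasDerivAt (fun s => 12 * b * MM b w x 5 1 s)
        (12 * b * (10 * b * MM b w x 4 2 s - ‖x‖^2 * MM b w x 5 0 s)) s := fun hw s hs =>
    ((MM_deriv hb hε he1 hx1 hw 3 1 hs).const_mul (12 * b)).congr_deriv (by push_cast; ring)
  have F4 : ∀ {w : EE n → ℝ}, IntegrableOn w (closedBall 0 3) → ∀ s, |s| < 2 →
      HasDerivAt (fun s => 12 * b * (10 * b * MM b w x 4 2 s - ‖x‖^2 * MM b w x 5 0 s))
        (960 * b^3 * MM b w x 3 3 s - 360 * b^2 * ‖x‖^2 * MM b w x 4 1 s) s := fun hw s hs =>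
    ((((MM_deriv hb hε he1 hx1 hw 2 2 hs).const_mul (10 * b)).sub
      ((MM_deriv hb hε he1 hx1 hw 3 0 hs).const_mul (‖x‖^2))).const_mul (12 * b)).congr_deriv
      (by push_cast; ring)
  set Ig := ∫ y in closedBall (0: EE n) (1 - ε), |dot u G y| with hIg
  set Iz := ∫ y in closedBall (0: EE n) (1 - ε), |zi u y| with hIz
  have Ig0 : 0 ≤ Ig := integral_nonneg fun _ => abs_nonneg _
  have Iz0 : 0 ≤ Iz := integral_nonneg fun _ => abs_nonneg _
  have hx2 : ‖x‖^2 ≤ 1 := by nlinarith [norm_nonneg x]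
  refine oneD (v := MM b u x 5 0) (v1 := fun s => 10 * b * MM b u x 4 1 s)
    (v2 := fun s => 10 * b * (8 * b * MM b u x 3 2 s - ‖x‖^2 * MM b u x 4 0 s))
    (c0 := fun s => MM b (dot u G) x 5 0 s + (1/(12*b)) * ((∫ y : EE n, pp 6 (b * ‖y‖^2)) - MM b (zi u) x 6 0 s))
    (η := ε) (by positivity) hε (by linarith) (D5 wu) (D4 wu) (D3 wu)
    (fun s hs => (D5 wg s hs).add (((F6 wz s hs).const_sub _).const_mul (1/(12*b))))
    (fun s hs => (D4 wg s hs).add (((F5 wz s hs).neg).const_mul (1/(12*b))))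
    (fun s hs => (D3 wg s hs).add (((F4 wz s hs).neg).const_mul (1/(12*b)))) ?_ ?_
  · intro s hs
    apply gamma_id h hb hε
    rw [norm_smul, Real.norm_eq_abs]
    have : |s| ≤ 1 + ε := by rw [abs_le]; constructor <;> linarith [hs.1, hs.2]
    calc _ ≤ (1 + ε) * (1 - 2 * ε) := by gcongr
      _ ≤ _ := by nlinarith
  · intro s hs
    have a1 := MM_le hb hε hx wg (k := 2) (by norm_num) 3 hs
    have a2 := MM_le hb hε hx wg (k := 3) (by norm_num) 1 hs
    have a3 := MM_le hb hε hx wz (k := 3) (by norm_num) 3 hs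
    have a4 := MM_le hb hε hx wz (k := 4) (by norm_num) 1 hs
    rw [← hIg] at a1 a2
    rw [← hIz] at a3 a4
    have t1 : |480 * b^3 * MM b (dot u G) x 2 3 s| ≤ 480 * ε⁻¹^3 * Ig := by
      rw [abs_mul, abs_of_pos (by positivity)]
      calc _ ≤ 480 * b^3 * (ε^3 * Ig) := by gcongr
        _ = _ := by rw [hbe]; field_simp
    have t2 : |240 * b^2 * ‖x‖^2 * MM b (dot u G) x 3 1 s| ≤ 240 * ε⁻¹^3 * Ig := by
      rw [abs_mul, abs_of_nonneg (by positivity)]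
      calc _ ≤ 240 * b^2 * 1 * (ε^1 * Ig) := by gcongr
        _ = _ := by rw [hbe]; field_simp
    have t3 : |960 * b^3 * MM b (zi u) x 3 3 s| ≤ 960 * ε⁻¹^3 * Iz := by
      rw [abs_mul, abs_of_pos (by positivity)]
      calc _ ≤ 960 * b^3 * (ε^3 * Iz) := by gcongr
        _ = _ := by rw [hbe]; field_simp
    have t4 : |360 * b^2 * ‖x‖^2 * MM b (zi u) x 4 1 s| ≤ 360 * ε⁻¹^3 * Iz := by
      rw [abs_mul, abs_of_nonneg (by positivity)]
      calc _ ≤ 360 * b^2 * 1 * (ε^1 * Iz) := by gcongr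
        _ = _ := by rw [hbe]; field_simp
    have hb1 : 1/(12*b) ≤ 1/12 := by
      rw [hbe]
      apply one_div_le_one_div_of_le (by norm_num)
      have : 1 ≤ ε⁻¹ := (one_le_inv₀ hε).2 he1
      nlinarith
    have hb2 : 0 < 1/(12*b) := by positivity
    refine (abs_add_le _ _).trans ?_
    have s1 := (abs_sub (480 * b^3 * MM b (dot u G) x 2 3 s) (240 * b^2 * ‖x‖^2 * MM b (dot u G) x 3 1 s))
    have s2 := (abs_sub (960 * b^3 * MM b (zi u) x 3 3 s) (360 * b^2 * ‖x‖^2 * MM b (zi u) x 4 1 s))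
    have s3 : |1/(12*b) * -(960 * b^3 * MM b (zi u) x 3 3 s - 360 * b^2 * ‖x‖^2 * MM b (zi u) x 4 1 s)| ≤
        (1/12) * (1320 * ε⁻¹^3 * Iz) := by
      rw [abs_mul, abs_neg, abs_of_pos hb2]
      have := s2.trans (add_le_add t3 t4)
      calc _ ≤ (1/12) * (960 * ε⁻¹^3 * Iz + 360 * ε⁻¹^3 * Iz) := by gcongr
        _ = _ := by ring
    have p : 0 ≤ ε⁻¹^3 * Iz := by positivity
    linarith

end

end

section

section
variable {n : ℕ} {L : ℝ} {u : EE n → ℝ} {G : EE n → EE n}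

theorem ker_zero {b ε : ℝ} (hb : b * ε^2 = 1) (hε : 0 < ε) {c y : EE n} {k : ℕ} (hk : k ≠ 0)
    (hy : ε ≤ ‖y - c‖) : pp k (b * ‖y - c‖^2) = 0 := by
  have hb0 : 0 < b := by by_contra h; nlinarith [sq_nonneg ε]
  exact pp_eq_zero hk (by rw [← hb]; gcongr)

theorem ker_cont (b : ℝ) (k : ℕ) (c : EE n) : Continuous (fun y : EE n => pp k (b * ‖y - c‖^2)) :=
  (pp_continuous k).comp (by fun_prop)

theorem ker_integ {b ε : ℝ} (hb : b * ε^2 = 1) (hε : 0 < ε) {c : EE n} (hc : ‖c‖ ≤ 1 - ε)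
    {k : ℕ} (hk : k ≠ 0) {w : EE n → ℝ} (hw : Continuous w) :
    Integrable (fun y => w y * pp k (b * ‖y - c‖^2)) := by
  refine integ_cont (hw.mul (ker_cont b k c)) fun y hy => ?_
  rw [ker_zero hb hε hk, mul_zero]
  have := norm_sub_norm_le y c
  linarith

/-- total mass -/
def KI (n : ℕ) (b : ℝ) : ℝ := ∫ y : EE n, pp 5 (b * ‖y‖^2)

theorem ker_bd {b ε : ℝ} (hb : b * ε^2 = 1) (hε : 0 < ε) {c : EE n} (hc : ‖c‖ ≤ 1 - ε)
    {w : EE n → ℝ} (hw : Continuous w) {M : ℝ} (hM : ∀ y, ‖y - c‖ < ε → |w y| ≤ M) :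
    |∫ y, w y * pp 5 (b * ‖y - c‖^2)| ≤ M * KI n b := by
  have e : KI n b = ∫ y : EE n, pp 5 (b * ‖y - c‖^2) :=
    (integral_sub_right_eq_self (fun y : EE n => pp 5 (b * ‖y‖^2)) c).symm
  rw [e, ← integral_const_mul]
  refine (abs_integral_le_integral_abs).trans ?_
  refine integral_mono (ker_integ hb hε hc (by norm_num) hw).abs
    (ker_integ hb hε hc (by norm_num) continuous_const) fun y => ?_
  by_cases hy : ε ≤ ‖y - c‖
  · simp [ker_zero hb hε (k := 5) (by norm_num) hy]
  · have := hM y (not_le.1 hy)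
    have h2 := pp_nonneg 5 (b * ‖y - c‖^2)
    simp only [abs_mul, abs_of_nonneg h2]
    gcongr

theorem KI_ge {b ε : ℝ} (hb : b * ε^2 = 1) (hε : 0 < ε) (hε1 : ε ≤ 1/4) :
    (3/4)^5 * ((ε/2)^n * VB n) ≤ KI n b := by
  have hb0 : 0 < b := by by_contra h; nlinarith [sq_nonneg ε]
  have hI := ker_integ (n := n) (w := fun _ => 1) hb hε (c := 0) (by simp; linarith) (k := 5) (by norm_num)
    continuous_const
  simp only [one_mul, sub_zero] at hI
  rw [← vol_closedBall (0 : EE n) (by positivity), KI]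
  have : ∫ y in closedBall (0: EE n) (ε/2), ((3/4)^5 : ℝ) ≤ ∫ y in closedBall (0: EE n) (ε/2), pp 5 (b * ‖y‖^2) := by
    refine setIntegral_mono_on (by simp [isCompact_closedBall _ _ |>.measure_lt_top]) hI.integrableOn
      measurableSet_closedBall fun y hy => ?_
    have hy : ‖y‖ ≤ ε/2 := by simpa using hy
    unfold pp
    have h1 : b * ‖y‖^2 ≤ b * (ε/2)^2 := by gcongr
    gcongr
    refine le_max_of_le_right ?_
    nlinarith
  rw [setIntegral_const, smul_eq_mul, mul_comm] at this
  exact this.trans (setIntegral_le_integral hI (Eventually.of_forall fun y => pp_nonneg _ _))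

theorem approx (h : NSol L u G) {ε : ℝ} (hε : 0 < ε) (hε1 : ε ≤ 1/4) (hV : 0 < VB n) :
    ∃ A : Matrix (Fin n) (Fin n) ℝ, A.IsSymm ∧ ∀ x : EE n, ‖x‖ ≤ 1 - 2 * ε →
      |u x - quadForm A x| ≤ 5 * L * ε + 720 * ε⁻¹^3 * ((4/3)^5 * (2/ε)^n / VB n) *
        ((∫ y in closedBall (0: EE n) (1 - ε), |dot u G y|) +
        ∫ y in closedBall (0: EE n) (1 - ε), |zi u y|) := by
  set b : ℝ := ε⁻¹^2 with hbdef
  have hb : b * ε^2 = 1 := by rw [hbdef]; field_simp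
  have hL := h.hL
  have hI := KI_ge (n := n) hb hε hε1
  have hI0 : 0 < KI n b := lt_of_lt_of_le (by positivity) hI
  have cu := h.cu; have cG := h.cG
  have c0 : ‖(0 : EE n)‖ ≤ 1 - ε := by simp; linarith
  let B : Matrix (Fin n) (Fin n) ℝ := fun i j =>
    10 * b * (8 * b * (∫ y : EE n, (u y * (y i * y j)) * pp 3 (b * ‖y - 0‖^2)) -
      if i = j then ∫ y : EE n, u y * pp 4 (b * ‖y - 0‖^2) else 0)
  refine ⟨(KI n b)⁻¹ • B, ?_, ?_⟩
  · apply Matrix.IsSymm.smul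
    ext i j
    have e1 : ∀ i j : Fin n, (∫ y : EE n, (u y * (y i * y j)) * pp 3 (b * ‖y - 0‖^2)) =
        ∫ y : EE n, (u y * (y j * y i)) * pp 3 (b * ‖y - 0‖^2) := fun i j => by
      congr 1; ext y; ring
    show B j i = B i j
    simp only [B]
    rw [e1 j i]
    by_cases hij : i = j
    · simp [hij]
    · rw [if_neg hij, if_neg (Ne.symm hij)]
  intro x hx
  have hx1 : ‖x‖ ≤ 1 := by linarith
  have T := taylor_moll h hb hε hε1 hx
  have e2 : 10 * b * (8 * b * MM b u x 3 2 0 - ‖x‖^2 * MM b u x 4 0 0) = ∑ i, ∑ j, B i j * x i * x j := by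
    have i3 : ∀ i j : Fin n, Integrable fun y : EE n => (u y * (y i * y j)) * pp 3 (b * ‖y - 0‖^2) :=
      fun i j => ker_integ hb hε c0 (by norm_num) (by fun_prop)
    have m3 : MM b u x 3 2 0 = ∑ i, ∑ j, (∫ y : EE n, (u y * (y i * y j)) * pp 3 (b * ‖y - 0‖^2)) * (x i * x j) := by
      unfold MM TT
      simp_rw [← integral_mul_const]
      have : ∀ i, ∑ j, ∫ y : EE n, (u y * (y i * y j)) * pp 3 (b * ‖y - 0‖^2) * (x i * x j) =
          ∫ y : EE n, ∑ j, (u y * (y i * y j)) * pp 3 (b * ‖y - 0‖^2) * (x i * x j) := fun i =>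
        (integral_finsetSum _ fun j _ => (i3 i j).mul_const _).symm
      simp_rw [this]
      rw [← integral_finsetSum _ fun i _ => integrable_finsetSum _ fun j _ => (i3 i j).mul_const _]
      congr 1
      ext y
      have e : inner ℝ x (y - (0:ℝ) • x) = ∑ i, x i * y i := by
        rw [PiLp.inner_apply]
        simp [mul_comm]
      rw [e, sq (∑ i, x i * y i), Finset.sum_mul_sum, zero_smul, Finset.mul_sum, Finset.mul_sum]
      refine Finset.sum_congr rfl fun i _ => ?_
      rw [Finset.mul_sum, Finset.mul_sum]
      exact Finset.sum_congr rfl fun j _ => by ring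
    have m4 : MM b u x 4 0 0 = ∫ y : EE n, u y * pp 4 (b * ‖y - 0‖^2) := by
      unfold MM TT
      simp
    rw [m3, m4, EuclideanSpace.norm_sq_eq]
    simp only [B, mul_sub, sub_mul, Finset.sum_sub_distrib, Finset.mul_sum, Finset.sum_mul]
    congr 1
    · exact Finset.sum_congr rfl fun i _ => Finset.sum_congr rfl fun j _ => by ring
    · refine Finset.sum_congr rfl fun i _ => ?_
      simp
      ring
  have e3 : KI n b * quadForm ((KI n b)⁻¹ • B) x = (∑ i, ∑ j, B i j * x i * x j) / 2 := by
    unfold quadForm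
    simp only [Matrix.smul_apply, smul_eq_mul, mul_assoc, ← Finset.mul_sum]
    field_simp
  have v1 : |MM b u x 5 0 1 - KI n b * u x| ≤ 2 * L * ε * KI n b := by
    have e : MM b u x 5 0 1 - KI n b * u x = ∫ y : EE n, (u y - u x) * pp 5 (b * ‖y - x‖^2) := by
      have e : KI n b = ∫ y : EE n, pp 5 (b * ‖y - x‖^2) :=
        (integral_sub_right_eq_self (fun y : EE n => pp 5 (b * ‖y‖^2)) x).symm
      have hxc : ‖x‖ ≤ 1 - ε := by linarith
      simp_rw [sub_mul]
      rw [integral_sub (ker_integ hb hε hxc (by norm_num) cu) (ker_integ hb hε hxc (by norm_num) continuous_const),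
        integral_const_mul, e]
      unfold MM TT
      simp [mul_comm]
    rw [e]
    refine ker_bd hb hε (by linarith) (by fun_prop) fun y hy => ?_
    have : ‖y‖ ≤ ‖y - x‖ + ‖x‖ := by simpa using norm_add_le (y - x) x
    have h2 := h.u_lip (x := y) (y := x) (by linarith) (by linarith)
    refine h2.trans ?_
    gcongr
  have v0 : |MM b u x 5 0 0| ≤ 2 * L * ε * KI n b := by
    have e : MM b u x 5 0 0 = ∫ y : EE n, u y * pp 5 (b * ‖y - 0‖^2) := by
      unfold MM TT; simp
    rw [e]
    refine ker_bd hb hε c0 cu fun y hy => ?_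
    rw [sub_zero] at hy
    have h2 := h.u_lip (x := y) (y := 0) (by linarith) (by norm_num)
    rw [h.u0, sub_zero, sub_zero] at h2
    refine h2.trans ?_
    gcongr
  have v01 : |10 * b * MM b u x 4 1 0| ≤ L * ε * KI n b := by
    rw [v1_eq h hb hε (by simpa using c0), zero_smul]
    refine ker_bd hb hε c0 (by fun_prop) fun y hy => ?_
    rw [sub_zero] at hy
    have h2 := h.G_le (x := y) (by linarith)
    refine (abs_real_inner_le_norm _ _).trans ?_
    calc ‖G y‖ * ‖x‖ ≤ (L * ‖y‖) * 1 := by gcongr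
      _ ≤ L * ε := by rw [mul_one]; gcongr
  set S := (∫ y in closedBall (0: EE n) (1 - ε), |dot u G y|) +
        ∫ y in closedBall (0: EE n) (1 - ε), |zi u y| with hS
  have hS0 : 0 ≤ S := add_nonneg (integral_nonneg fun _ => abs_nonneg _) (integral_nonneg fun _ => abs_nonneg _)
  rw [e2, ← e3] at T
  have fin : KI n b * |u x - quadForm ((KI n b)⁻¹ • B) x| ≤ 5 * L * ε * KI n b + 720 * ε⁻¹^3 * S := by
    rw [← abs_of_pos hI0, ← abs_mul, abs_of_pos hI0]
    rw [abs_le] at *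
    constructor <;> nlinarith
  have hIi : 1 ≤ ((4/3)^5 * (2/ε)^n / VB n) * KI n b := by
    calc (1:ℝ) = ((4/3)^5 * (2/ε)^n / VB n) * ((3/4)^5 * ((ε/2)^n * VB n)) := by
          rw [div_pow 2 ε, div_pow ε 2]; field_simp
      _ ≤ _ := by gcongr
  have hq : 0 ≤ 720 * ε⁻¹^3 * S := by positivity
  have := mul_le_mul_of_nonneg_left hIi hq
  have f2 : KI n b * |u x - quadForm ((KI n b)⁻¹ • B) x| ≤ KI n b * (5 * L * ε + 720 * ε⁻¹^3 * ((4/3)^5 * (2/ε)^n / VB n) * S) := by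
    linarith
  exact le_of_mul_le_mul_left f2 hI0
end

end

section

section
variable {n : ℕ} {L : ℝ} {u : EE n → ℝ} {G : EE n → EE n}

theorem wt_ge {ε : ℝ} (hε : 0 < ε) (hε1 : ε ≤ 1) {x : EE n} (hx : ‖x‖ ≤ 1 - ε) : 4 * ε ≤ wt x := by
  unfold wt pp
  rw [pow_one]
  have := norm_nonneg x
  have h2 : ε ≤ max 0 (1 - ‖x‖^2) := le_max_of_le_right (by nlinarith)
  linarith

theorem wt_small {ε : ℝ} (hε : 0 < ε) {x : EE n} (hx : 1 - ε ≤ ‖x‖) : wt x ≤ 8 * ε := by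
  unfold wt pp
  rw [pow_one]
  have := norm_nonneg x
  have h2 : max 0 (1 - ‖x‖^2) ≤ 2 * ε := max_le (by positivity) (by nlinarith [sq_nonneg (1 - ‖x‖)])
  linarith

theorem phi_ge {ε : ℝ} (hε : 0 < ε) (hε1 : ε ≤ 1) {x : EE n} (hx : ‖x‖ ≤ 1 - ε) : ε^2 ≤ phi x := by
  unfold phi pp
  have := norm_nonneg x
  have h2 : ε ≤ max 0 (1 - ‖x‖^2) := le_max_of_le_right (by nlinarith)
  gcongr

theorem phi_small {ε : ℝ} (hε : 0 < ε) {x : EE n} (hx : 1 - ε ≤ ‖x‖) : phi x ≤ 4 * ε^2 := by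
  unfold phi pp
  have := norm_nonneg x
  have h2 : max 0 (1 - ‖x‖^2) ≤ 2 * ε := max_le (by positivity) (by nlinarith [sq_nonneg (1 - ‖x‖)])
  calc _ ≤ (2 * ε)^2 := by gcongr
    _ = _ := by ring

theorem gw_bound (h : NSol L u G) {η : ℝ} (hη : 0 < η) (hJ : Jn u G ≤ η^2) :
    ∫ x, |dot u G x| * wt x ≤ (2 * VB n + 1) * η := by
  have cd := dot_continuous h.cu h.cG
  have := amgm (n := n) (a := fun _ => 1) (b := fun x => |dot u G x|) continuous_const (by fun_prop) hη
  simp only [one_mul, one_pow, sq_abs] at this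
  have h1 := le_of_abs_le this
  have h2 : |∫ x : EE n, wt x| ≤ 4 * VB n := int_bd (by norm_num)
    (fun x _ => by rw [abs_of_nonneg (wt_nonneg x)]; exact wt_le x) (fun x hx => wt_zero hx)
  have h3 := le_of_abs_le h2
  have h4 : η⁻¹ * ∫ x, (dot u G x)^2 * wt x ≤ η⁻¹ * η^2 := by gcongr; exact hJ
  have h5 : η⁻¹ * η^2 = η := by field_simp
  have h6 := mul_le_mul_of_nonneg_left h3 hη.le
  linarith

theorem g_ball (h : NSol L u G) {ε : ℝ} (hε : 0 < ε) (hε1 : ε ≤ 1) :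
    ∫ x in closedBall (0 : EE n) (1 - ε), |dot u G x| ≤ ε⁻¹ * ∫ x, |dot u G x| * wt x := by
  have cd := dot_continuous h.cu h.cG
  have i1 : Integrable (fun x => ε⁻¹ * (|dot u G x| * wt x)) := (integ_wt (by fun_prop)).const_mul _
  rw [← integral_const_mul]
  refine le_trans ?_ (setIntegral_le_integral (s := closedBall (0 : EE n) (1 - ε)) i1
    (Eventually.of_forall fun x => ?_))
  · refine setIntegral_mono_on (cd.abs.continuousOn.integrableOn_compact (isCompact_closedBall _ _))
      i1.integrableOn measurableSet_closedBall fun x hx => ?_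
    have hx : ‖x‖ ≤ 1 - ε := by simpa using hx
    have := wt_ge hε hε1 hx
    have h2 : 1 ≤ ε⁻¹ * wt x := by
      rw [← inv_mul_cancel₀ hε.ne']; gcongr; linarith
    nlinarith [abs_nonneg (dot u G x)]
  · have := wt_nonneg x
    simp only [Pi.zero_apply]; positivity

/-- the matrix of `|x|² / (2 * n)` -/
theorem id_MemP (hn : 0 < n) : MemP ((n:ℝ)⁻¹ • (1 : Matrix (Fin n) (Fin n) ℝ)) := by
  constructor
  · exact Matrix.PosSemidef.one.smul (by positivity)
  · rw [Matrix.trace_smul, Matrix.trace_one]; simp; field_simp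

theorem quad_id (c : ℝ) (x : EE n) : quadForm (c • (1 : Matrix (Fin n) (Fin n) ℝ)) x = c * ‖x‖^2 / 2 := by
  unfold quadForm
  rw [EuclideanSpace.norm_sq_eq]
  simp [Matrix.one_apply, Finset.mul_sum, Finset.sum_div]
  refine Finset.sum_congr rfl fun i _ => ?_
  ring

theorem zi_int (h : NSol L u G) (hn : 0 < n)
    (he : ∀ A : Matrix (Fin n) (Fin n) ℝ, MemP A → ∫ x, quadForm A x * phi x ≤ En u G) :
    ∫ x, zi u x * (‖x‖^2 * phi x) ≤ 6 * n * L * ∫ x, |dot u G x| * wt x := by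
  have hL := h.hL
  have cu := h.cu
  have cd := dot_continuous h.cu h.cG
  have hA := id_MemP hn
  have e := En_quad h.toCW hA
  have e1 := he _ hA
  simp only [quad_id] at e e1
  have n1 : (1:ℝ) ≤ n := by exact_mod_cast hn
  have ni : (n:ℝ)⁻¹ ≤ 1 := inv_le_one_of_one_le₀ n1
  have e2 : ∫ x, zi u x * ((n:ℝ)⁻¹ * ‖x‖^2 / 2 * phi x) = ((n:ℝ)⁻¹ / 2) * ∫ x, zi u x * (‖x‖^2 * phi x) := by
    rw [← integral_const_mul]; congr 1; ext x; ring
  have e3 : |∫ x, ((u x - (n:ℝ)⁻¹ * ‖x‖^2 / 2) * dot u G x) * wt x| ≤ ∫ x, (3 * L) * (|dot u G x| * wt x) := by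
    refine abs_integral_le_integral_abs.trans ?_
    refine integral_mono (integ_wt (by fun_prop)).abs ((integ_wt (by fun_prop)).const_mul _) fun x => ?_
    by_cases hx : 1 ≤ ‖x‖
    · simp [wt_zero hx]
    · have hx := not_le.1 hx
      have h1 := h.u_le (x := x) (by linarith)
      have h2 : |u x - (n:ℝ)⁻¹ * ‖x‖^2 / 2| ≤ 3 * L := by
        have h3 : (n:ℝ)⁻¹ * ‖x‖^2 ≤ 1 * 1^2 := by gcongr
        have h4 : 0 ≤ (n:ℝ)⁻¹ * ‖x‖^2 := by positivity
        have h5 : 2 * L * ‖x‖ ≤ 2 * L := by nlinarith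
        rw [abs_le] at *
        constructor <;> linarith
      simp only [abs_mul, abs_of_nonneg (wt_nonneg x)]
      have := wt_nonneg x
      rw [← mul_assoc]
      gcongr
  rw [integral_const_mul] at e3
  have e4 := neg_le_of_abs_le e3
  rw [e2] at e
  have e5 : ((n:ℝ)⁻¹ / 2) * ∫ x, zi u x * (‖x‖^2 * phi x) ≤ 3 * L * ∫ x, |dot u G x| * wt x := by linarith
  have e6 := mul_le_mul_of_nonneg_left e5 (show (0:ℝ) ≤ 2 * n by positivity)
  have e7 : (2 * n : ℝ) * (((n:ℝ)⁻¹ / 2) * ∫ x, zi u x * (‖x‖^2 * phi x)) = ∫ x, zi u x * (‖x‖^2 * phi x) := by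
    field_simp
  rw [e7] at e6
  linarith

theorem zi_ball (h : NSol L u G) {ε a : ℝ} (hε : 0 < ε) (hε1 : ε ≤ 1) (ha : 0 < a) :
    ∫ x in closedBall (0 : EE n) (1 - ε), |zi u x| ≤
      a^n * VB n + (a^2 * ε^2)⁻¹ * ∫ x, zi u x * (‖x‖^2 * phi x) := by
  have cu := h.cu
  have i0 : Integrable (fun x => zi u x * (‖x‖^2 * phi x)) :=
    integ_bdd (zi_meas cu) (zi_abs u) (integ_phi (by fun_prop))
  have i1 : Integrable ((closedBall (0 : EE n) a).indicator (fun _ => (1:ℝ))) := by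
    rw [integrable_indicator_iff measurableSet_closedBall]
    simp [isCompact_closedBall _ _ |>.measure_lt_top]
  have e1 : ∫ x, (closedBall (0 : EE n) a).indicator (fun _ => (1:ℝ)) x = a^n * VB n := by
    rw [integral_indicator measurableSet_closedBall, setIntegral_const, vol_closedBall _ ha.le]
    simp
  rw [← e1, ← integral_const_mul, ← integral_add i1 (i0.const_mul _)]
  refine le_trans ?_ (setIntegral_le_integral (s := closedBall (0 : EE n) (1 - ε)) (i1.add (i0.const_mul _))
    (Eventually.of_forall fun x => ?_))
  · have iz : IntegrableOn (fun x => |zi u x|) (closedBall (0 : EE n) (1 - ε)) :=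
      Measure.integrableOn_of_bounded (M := 1) (isCompact_closedBall _ _).measure_lt_top.ne
        (zi_meas cu).abs.aestronglyMeasurable
        (Eventually.of_forall fun x => by simpa using zi_abs u x)
    refine setIntegral_mono_on iz (i1.add (i0.const_mul _)).integrableOn measurableSet_closedBall fun x hx => ?_
    have hx : ‖x‖ ≤ 1 - ε := by simpa using hx
    have hz := zi_nonneg u x
    have hp := phi_nonneg x
    by_cases hxa : ‖x‖ ≤ a
    · rw [indicator_of_mem (by simpa using hxa)]
      have := zi_abs u x
      have : 0 ≤ (a^2 * ε^2)⁻¹ * (zi u x * (‖x‖^2 * phi x)) := by positivity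
      linarith
    · rw [indicator_of_notMem (by simpa using hxa), zero_add, abs_of_nonneg hz]
      have h1 := phi_ge hε hε1 hx
      have h2 : a^2 * ε^2 ≤ ‖x‖^2 * phi x := by
        have := not_le.1 hxa
        gcongr
      have h3 : 1 ≤ (a^2 * ε^2)⁻¹ * (‖x‖^2 * phi x) := by
        rw [← inv_mul_cancel₀ (show a^2 * ε^2 ≠ 0 by positivity)]; gcongr
      nlinarith
  · have hz := zi_nonneg u x
    have hp := phi_nonneg x
    simp only [Pi.zero_apply, Pi.add_apply]
    have : 0 ≤ (closedBall (0 : EE n) a).indicator (fun _ => (1:ℝ)) x := indicator_nonneg (fun _ _ => zero_le_one) _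
    positivity

theorem quad_smul (A : Matrix (Fin n) (Fin n) ℝ) (c : ℝ) (x : EE n) :
    quadForm A (c • x) = c^2 * quadForm A x := by
  rw [quadForm_eq, quadForm_eq, map_smul, inner_smul_left, inner_smul_right]
  simp; ring

theorem quad_add (A B : Matrix (Fin n) (Fin n) ℝ) (x : EE n) :
    quadForm (A + B) x = quadForm A x + quadForm B x := by
  unfold quadForm
  simp only [Matrix.add_apply, add_mul, Finset.sum_add_distrib, mul_add]

theorem quad_csmul (A : Matrix (Fin n) (Fin n) ℝ) (c : ℝ) (x : EE n) :
    quadForm (c • A) x = c * quadForm A x := by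
  unfold quadForm
  simp only [Matrix.smul_apply, smul_eq_mul, mul_assoc, ← Finset.mul_sum]
  ring

/-- homogeneity -/
theorem quad_hom (A : Matrix (Fin n) (Fin n) ℝ) {a b : ℝ}
    (h : ∀ x : EE n, ‖x‖ = 1/2 → a ≤ quadForm A x ∧ quadForm A x ≤ b) (x : EE n) :
    4 * a * ‖x‖^2 ≤ quadForm A x ∧ quadForm A x ≤ 4 * b * ‖x‖^2 := by
  by_cases hx : x = 0
  · subst hx
    have : quadForm A (0 : EE n) = 0 := by simp [quadForm]
    rw [this]; simp
  · have hx0 : 0 < ‖x‖ := norm_pos_iff.2 hx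
    have := h ((1/2 * ‖x‖⁻¹) • x) (by
      rw [norm_smul, Real.norm_eq_abs, abs_of_pos (by positivity)]; field_simp)
    rw [quad_smul] at this
    have e : quadForm A x = 4 * ‖x‖^2 * ((1/2 * ‖x‖⁻¹)^2 * quadForm A x) := by field_simp; norm_num
    have h4 : 0 < 4 * ‖x‖^2 := by positivity
    constructor
    · nlinarith
    · nlinarith

theorem quad_bounds (h : NSol L u G) {A : Matrix (Fin n) (Fin n) ℝ} {δ ε : ℝ} (hε : ε ≤ 1/4)
    (hq : ∀ x : EE n, ‖x‖ ≤ 1 - 2 * ε → |u x - quadForm A x| ≤ δ) (x : EE n) :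
    4 * (-δ) * ‖x‖^2 ≤ quadForm A x ∧ quadForm A x ≤ 4 * (L + δ) * ‖x‖^2 := by
  refine quad_hom A (fun x hx => ?_) x
  have h1 := h.nonneg x (by rw [hx]; norm_num)
  have h2 := le_of_abs_le (h.u_le (x := x) (by rw [hx]; norm_num))
  have h3 := abs_le.1 (hq x (by rw [hx]; linarith))
  rw [hx] at h2
  constructor <;> linarith

end

end

section

section
variable {n : ℕ} {L : ℝ} {u : EE n → ℝ} {G : EE n → EE n}

theorem trace_id (h : NSol L u G) {A : Matrix (Fin n) (Fin n) ℝ} (hA : A.IsSymm) :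
    (1 - A.trace) * ∫ x : EE n, phi x = (∫ x, zi u x * phi x) + 2 * (∫ x, (u x - quadForm A x) * wt x)
      - ∫ x, dot u G x * wt x := by
  have cu := h.cu; have cG := h.cG
  have cq := quadForm_continuous A
  have cd := dot_continuous h.cu h.cG
  have w1 := h.weak _ _ phi_test
  have w2 := (quad_CW hA).weak _ _ phi_test
  have ip : Integrable (fun x : EE n => phi x) := by simpa using integ_phi (n := n) (f := fun _ => 1) continuous_const
  have iz := integ_bdd (zi_meas cu) (zi_abs u) ip
  have iu : Integrable (fun x => u x * wt x) := integ_wt cu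
  have iq : Integrable (fun x => quadForm A x * wt x) := integ_wt cq
  have ig : Integrable (fun x => dot u G x * wt x) := integ_wt cd
  have e1 : ∫ x, inner ℝ (G x) (-(wt x) • x) = (∫ x, dot u G x * wt x) - 2 * ∫ x, u x * wt x := by
    rw [← integral_const_mul, ← integral_sub ig (iu.const_mul 2)]
    congr 1; ext x
    rw [inner_smul_right, real_inner_comm]; unfold dot; ring
  have e2 : ∫ x, inner ℝ (Aq A x) (-(wt x) • x) = - (2 * ∫ x, quadForm A x * wt x) := by
    rw [← integral_const_mul, ← integral_neg]
    congr 1; ext x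
    rw [inner_smul_right, real_inner_comm, quadForm_eq]; ring
  have e3 : ∫ x, posInd u x * phi x = (∫ x : EE n, phi x) - ∫ x, zi u x * phi x := by
    rw [← integral_sub ip iz]
    congr 1; ext x; rw [posInd_eq]; ring
  have e4 : ∫ x, (u x - quadForm A x) * wt x = (∫ x, u x * wt x) - ∫ x, quadForm A x * wt x := by
    rw [← integral_sub iu iq]
    congr 1; ext x; ring
  rw [e1, e3] at w1
  rw [e2, integral_const_mul] at w2
  rw [e4]
  linarith

theorem phi_int_ge (n : ℕ) : (1/4) * ((1/2)^n * VB n) ≤ ∫ x : EE n, phi x := by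
  have hI : Integrable (fun x : EE n => phi x) := by simpa using integ_phi (n := n) (f := fun _ => 1) continuous_const
  rw [← vol_closedBall (0 : EE n) (by positivity)]
  have : ∫ y in closedBall (0: EE n) (1/2), (1/4 : ℝ) ≤ ∫ y in closedBall (0: EE n) (1/2), phi y := by
    refine setIntegral_mono_on (by simp [isCompact_closedBall _ _ |>.measure_lt_top]) hI.integrableOn
      measurableSet_closedBall fun y hy => ?_
    have hy : ‖y‖ ≤ 1/2 := by simpa using hy
    have := phi_ge (n := n) (ε := 1/2) (x := y) (by norm_num) (by norm_num) (by linarith)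
    linarith
  rw [setIntegral_const, smul_eq_mul, mul_comm] at this
  exact this.trans (setIntegral_le_integral hI (Eventually.of_forall fun y => phi_nonneg _))

theorem zi_phi (h : NSol L u G) {ε : ℝ} (hε : 0 < ε) :
    ∫ x, zi u x * phi x ≤ (∫ x in closedBall (0 : EE n) (1 - ε), |zi u x|) + 4 * ε^2 * VB n := by
  have cu := h.cu
  have ip : Integrable (fun x : EE n => phi x) := by simpa using integ_phi (n := n) (f := fun _ => 1) continuous_const
  have iz := integ_bdd (zi_meas cu) (zi_abs u) ip
  have i1 : Integrable ((closedBall (0 : EE n) 1).indicator (fun _ => 4 * ε^2)) := by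
    rw [integrable_indicator_iff measurableSet_closedBall]
    exact continuousOn_const.integrableOn_compact (isCompact_closedBall _ _)
  have e1 : ∫ x, (closedBall (0 : EE n) 1).indicator (fun _ => 4 * ε^2) x = 4 * ε^2 * VB n := by
    rw [integral_indicator measurableSet_closedBall, setIntegral_const, VB]
    simp [mul_comm]
  have i2 : Integrable ((closedBall (0 : EE n) (1 - ε)).indicator (fun x => |zi u x|)) := by
    rw [integrable_indicator_iff measurableSet_closedBall]
    exact Measure.integrableOn_of_bounded (M := 1) (isCompact_closedBall _ _).measure_lt_top.ne
        (zi_meas cu).abs.aestronglyMeasurable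
        (Eventually.of_forall fun x => by simpa using zi_abs u x)
  rw [← integral_indicator measurableSet_closedBall, ← e1, ← integral_add i2 i1]
  refine integral_mono iz (i2.add i1) fun x => ?_
  have hz := zi_nonneg u x
  have hz1 := zi_le u x
  have hp := phi_nonneg x
  have hp1 := phi_le x
  have a1 : 0 ≤ (closedBall (0 : EE n) 1).indicator (fun _ => 4 * ε^2) x :=
    indicator_nonneg (fun _ _ => by positivity) _
  have a2 : 0 ≤ (closedBall (0 : EE n) (1 - ε)).indicator (fun x => |zi u x|) x :=
    indicator_nonneg (fun _ _ => by positivity) _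
  by_cases hx : ‖x‖ ≤ 1 - ε
  · rw [indicator_of_mem (by simpa using hx), abs_of_nonneg hz]
    nlinarith
  · by_cases hx1 : 1 ≤ ‖x‖
    · rw [phi_zero hx1, mul_zero]; positivity
    · have := phi_small hε (not_le.1 hx).le
      have e : (closedBall (0 : EE n) 1).indicator (fun _ => 4 * ε^2) x = 4 * ε^2 :=
        indicator_of_mem (by simpa using (not_le.1 hx1).le) _
      rw [e]
      nlinarith

/-- integral bound with boundary layer -/
theorem layer {w : EE n → ℝ} {ε a M : ℝ} (hε : 0 < ε) (ha : 0 ≤ a) (hM : 0 ≤ M)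
    (h1 : ∀ x, ‖x‖ ≤ 1 - 2 * ε → |w x| ≤ a) (h2 : ∀ x, ‖x‖ ≤ 1 → |w x| ≤ M) :
    |∫ x, w x * wt x| ≤ (4 * a + 16 * M * ε) * VB n := by
  refine int_bd (by positivity) (fun x hx => ?_) (fun x hx => by rw [wt_zero hx, mul_zero])
  rw [abs_mul, abs_of_nonneg (wt_nonneg x)]
  have k1 := wt_nonneg x
  have k2 := wt_le x
  by_cases hx2 : ‖x‖ ≤ 1 - 2 * ε
  · have := h1 x hx2
    calc |w x| * wt x ≤ a * 4 := by gcongr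
      _ ≤ _ := by nlinarith [mul_nonneg hM hε.le]
  · have := h2 x hx.le
    have k3 := wt_small (ε := 2 * ε) (by positivity) (not_le.1 hx2).le
    calc |w x| * wt x ≤ M * (8 * (2 * ε)) := by gcongr
      _ ≤ _ := by nlinarith [mul_nonneg hM hε.le]

theorem uq_bound (h : NSol L u G) {A : Matrix (Fin n) (Fin n) ℝ} {δ ε : ℝ} (hε : ε ≤ 1/4) (hδ : 0 ≤ δ)
    (hq : ∀ x : EE n, ‖x‖ ≤ 1 - 2 * ε → |u x - quadForm A x| ≤ δ) {x : EE n} (hx : ‖x‖ ≤ 1) :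
    |quadForm A x| ≤ 4 * L + 4 * δ ∧ |u x - quadForm A x| ≤ 6 * L + 4 * δ := by
  have hL := h.hL
  have b := quad_bounds h hε hq x
  have hx2 : ‖x‖^2 ≤ 1 := pow_le_one₀ (norm_nonneg _) hx
  have hx0 : 0 ≤ ‖x‖^2 := by positivity
  have h2 := h.u_le (x := x) (by linarith)
  have h3 : 2 * L * ‖x‖ ≤ 2 * L := by nlinarith
  have c1 : |quadForm A x| ≤ 4 * L + 4 * δ := by
    rw [abs_le]; constructor <;> nlinarith
  refine ⟨c1, ?_⟩
  rw [abs_le] at *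
  constructor <;> linarith

theorem trace_bound (h : NSol L u G) {A : Matrix (Fin n) (Fin n) ℝ} (hA : A.IsSymm) {ε K Z W : ℝ}
    (hε : 0 < ε) (hε1 : ε ≤ 1/4) (hK : 0 ≤ K)
    (hq : ∀ x : EE n, ‖x‖ ≤ 1 - 2 * ε → |u x - quadForm A x| ≤ K * ε)
    (hZ : ∫ x in closedBall (0 : EE n) (1 - ε), |zi u x| ≤ Z * ε)
    (hW : ∫ x, |dot u G x| * wt x ≤ W * ε) :
    |A.trace - 1| ≤ (Z + 4 * VB n + 2 * (4 * K + 16 * (6 * L + 4 * K)) * VB n + W) /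
      ((1/4) * ((1/2)^n * VB n)) * ε := by
  have hL := h.hL
  have hV := VB_pos n
  have cd := dot_continuous h.cu h.cG
  have t := trace_id h hA
  have z := zi_phi h hε
  have z0 : 0 ≤ ∫ x, zi u x * phi x := integral_nonneg fun x => mul_nonneg (zi_nonneg _ _) (phi_nonneg _)
  have l := layer (w := fun x => u x - quadForm A x) hε (a := K * ε) (M := 6 * L + 4 * K)
    (by positivity) (by positivity) hq
    (fun x hx => (uq_bound h hε1 (by positivity) hq hx).2.trans (by nlinarith))
  have g : |∫ x, dot u G x * wt x| ≤ W * ε := by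
    refine (abs_integral_le_integral_abs).trans (le_trans (le_of_eq ?_) hW)
    congr 1; ext x; rw [abs_mul, abs_of_nonneg (wt_nonneg x)]
  have p := phi_int_ge n
  have e2 : 4 * ε^2 * VB n ≤ 4 * VB n * ε := by nlinarith [mul_pos hV hε]
  have tot : |(1 - A.trace) * ∫ x : EE n, phi x| ≤
      (Z + 4 * VB n + 2 * (4 * K + 16 * (6 * L + 4 * K)) * VB n + W) * ε := by
    rw [t]
    rw [abs_le] at *
    constructor <;> linarith
  have hc : 0 < (1/4) * ((1/2)^n * VB n) := by positivity
  rw [abs_mul, abs_of_pos (hc.trans_le p), abs_sub_comm] at tot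
  have := mul_le_mul_of_nonneg_left p (abs_nonneg (A.trace - 1))
  rw [div_mul_eq_mul_div, le_div_iff₀ hc]
  linarith

theorem psd_of_quad {A : Matrix (Fin n) (Fin n) ℝ} (hA : A.IsSymm) (h : ∀ x : EE n, 0 ≤ quadForm A x) :
    A.PosSemidef := by
  refine Matrix.PosSemidef.of_dotProduct_mulVec_nonneg ?_ fun x => ?_
  · simpa [Matrix.IsHermitian, Matrix.IsSymm] using hA
  · have := h (WithLp.toLp 2 x)
    unfold quadForm at this
    have e : star x ⬝ᵥ A.mulVec x = ∑ i, ∑ j, A i j * x i * x j := by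
      simp only [dotProduct, Matrix.mulVec, star_trivial, Finset.mul_sum]
      refine Finset.sum_congr rfl fun i _ => Finset.sum_congr rfl fun j _ => by ring
    rw [e]
    simp only at this
    linarith

theorem fix_quad (h : NSol L u G) {A : Matrix (Fin n) (Fin n) ℝ} (hA : A.IsSymm) {ε K T : ℝ}
    (hε : 0 < ε) (hε1 : ε ≤ 1/4) (hK : 0 ≤ K) (hT : 0 ≤ T)
    (hq : ∀ x : EE n, ‖x‖ ≤ 1 - 2 * ε → |u x - quadForm A x| ≤ K * ε)
    (htr : |A.trace - 1| ≤ T * ε) (hs : (T + 8 * K * n) * ε ≤ 1/2) :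
    ∃ B : Matrix (Fin n) (Fin n) ℝ, MemP B ∧
      ∀ x : EE n, ‖x‖ ≤ 1 → |quadForm B x - quadForm A x| ≤
        2 * ((T + 8 * K * n) * (4 * L + 4 * K) + 4 * K) * ε := by
  have hL := h.hL
  set s := A.trace + 8 * K * ε * n with hsdef
  have hs1 : |s - 1| ≤ (T + 8 * K * n) * ε := by
    have : 0 ≤ 8 * K * ε * n := by positivity
    rw [abs_le] at *
    constructor <;> linarith
  have hs2 : 1/2 ≤ s := by
    have := abs_le.1 hs1; linarith
  have s0 : 0 < s := by linarith
  have e1 : ∀ x, quadForm (s⁻¹ • (A + (8 * K * ε) • (1 : Matrix (Fin n) (Fin n) ℝ))) x =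
      s⁻¹ * (quadForm A x + 4 * K * ε * ‖x‖^2) := by
    intro x
    rw [quad_csmul, quad_add, quad_id]; ring
  refine ⟨s⁻¹ • (A + (8 * K * ε) • (1 : Matrix (Fin n) (Fin n) ℝ)), ⟨?_, ?_⟩, ?_⟩
  · refine psd_of_quad ((hA.add (Matrix.isSymm_one.smul _)).smul _) fun x => ?_
    rw [e1]
    have := (quad_bounds h hε1 hq x).1
    have : 0 ≤ quadForm A x + 4 * K * ε * ‖x‖^2 := by linarith
    positivity
  · rw [Matrix.trace_smul, Matrix.trace_add, Matrix.trace_smul, Matrix.trace_one, smul_eq_mul, smul_eq_mul,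
      Fintype.card_fin, ← hsdef]
    exact inv_mul_cancel₀ s0.ne'
  · intro x hx
    rw [e1]
    have hb := (uq_bound h hε1 (by positivity) hq hx).1
    have hb' : |quadForm A x| ≤ 4 * L + 4 * K := hb.trans (by nlinarith)
    have hx2 : ‖x‖^2 ≤ 1 := pow_le_one₀ (norm_nonneg _) hx
    have e : s⁻¹ * (quadForm A x + 4 * K * ε * ‖x‖^2) - quadForm A x =
      s⁻¹ * (-((s - 1) * quadForm A x) + 4 * K * ε * ‖x‖^2) := by field_simp; ring
    rw [e, abs_mul, abs_of_pos (inv_pos.2 s0)]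
    have si : s⁻¹ ≤ 2 := by
      rw [inv_le_comm₀ s0 (by norm_num)]; linarith
    have m1 : |(s - 1) * quadForm A x| ≤ ((T + 8 * K * n) * ε) * (4 * L + 4 * K) := by
      rw [abs_mul]; gcongr
    have m2 : |-((s - 1) * quadForm A x) + 4 * K * ε * ‖x‖^2| ≤
        ((T + 8 * K * n) * (4 * L + 4 * K) + 4 * K) * ε := by
      have : 0 ≤ 4 * K * ε * ‖x‖^2 := by positivity
      have : 4 * K * ε * ‖x‖^2 ≤ 4 * K * ε * 1 := by gcongr
      rw [abs_le] at *
      constructor <;> linarith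
    calc _ ≤ 2 * (((T + 8 * K * n) * (4 * L + 4 * K) + 4 * K) * ε) := by gcongr
      _ = _ := by ring
end

end

section

theorem key (n : ℕ) (hn : 0 < n) (L : ℝ) (hL : 1 ≤ L) :
    ∃ C ε0 : ℝ, 0 < C ∧ 0 < ε0 ∧ ∀ (u : EE n → ℝ) (G : EE n → EE n), NSol L u G →
      (∀ A : Matrix (Fin n) (Fin n) ℝ, MemP A → ∫ x, quadForm A x * phi x ≤ En u G) →
      ∀ ε, 0 < ε → ε ≤ ε0 → Jn u G ≤ (ε^(3*n+14))^2 →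
      ∃ B : Matrix (Fin n) (Fin n) ℝ, MemP B ∧ ∫ x, (u x - quadForm B x)^2 * wt x ≤ C * ε := by
  have hV := VB_pos n
  obtain ⟨V, hVV⟩ : ∃ V, V = VB n := ⟨_, rfl⟩
  rw [← hVV] at hV
  obtain ⟨C1, hC1⟩ : ∃ C1, C1 = 2 * V + 1 := ⟨_, rfl⟩
  have C1p : 0 < C1 := by rw [hC1]; positivity
  obtain ⟨Z, hZ⟩ : ∃ Z, Z = V + 6 * n * L * C1 := ⟨_, rfl⟩
  have Zp : 0 < Z := by rw [hZ]; positivity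
  obtain ⟨K, hK⟩ : ∃ K, K = 5 * L + 720 * ((4/3)^5 * 2^n / V) * (C1 + Z) := ⟨_, rfl⟩
  have Kp : 0 < K := by rw [hK]; positivity
  obtain ⟨T, hT⟩ : ∃ T, T = (Z + 4 * V + 2 * (4 * K + 16 * (6 * L + 4 * K)) * V + C1) /
      ((1/4) * ((1/2)^n * V)) := ⟨_, rfl⟩
  have Tp : 0 < T := by rw [hT]; positivity
  obtain ⟨C6, hC6⟩ : ∃ C6, C6 = T + 8 * K * n := ⟨_, rfl⟩
  have C6p : 0 < C6 := by rw [hC6]; positivity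
  obtain ⟨C7, hC7⟩ : ∃ C7, C7 = K + 2 * (C6 * (4 * L + 4 * K) + 4 * K) := ⟨_, rfl⟩
  have C7p : 0 < C7 := by rw [hC7]; positivity
  obtain ⟨M, hM⟩ : ∃ M, M = 6 * L + 4 * K + C7 := ⟨_, rfl⟩
  have Mp : 0 < M := by rw [hM]; positivity
  refine ⟨(4 * C7^2 + 16 * M^2) * V, min (1/4) (1/(2 * C6)), by positivity, by positivity, ?_⟩
  intro u G h he ε hε hε0 hJ
  have hε1 : ε ≤ 1/4 := hε0.trans (min_le_left _ _)
  have hε2 : C6 * ε ≤ 1/2 := by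
    have := hε0.trans (min_le_right _ _)
    rw [le_div_iff₀ (by positivity)] at this
    linarith
  have hεle : ε ≤ 1 := by linarith
  have pw : ∀ {i j : ℕ}, i ≤ j → ε^j ≤ ε^i := fun hij => pow_le_pow_of_le_one hε.le hεle hij
  -- first bounds
  have W1 : ∫ x, |dot u G x| * wt x ≤ C1 * ε^(3*n+14) := by
    rw [hC1, hVV]; exact gw_bound h (by positivity) hJ
  have Wb : ∫ x, |dot u G x| * wt x ≤ C1 * ε := W1.trans (by
    have := pw (show 1 ≤ 3*n+14 by omega)
    rw [pow_one] at this; gcongr)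
  have gb : ∫ x in closedBall (0 : EE n) (1 - ε), |dot u G x| ≤ C1 * ε^(n+4) := by
    refine (g_ball h hε hεle).trans ?_
    calc _ ≤ ε⁻¹ * (C1 * ε^(3*n+14)) := by gcongr
      _ = C1 * ε^(3*n+13) := by rw [pow_succ ε (3*n+13)]; field_simp
      _ ≤ _ := by gcongr ?_ * ?_; exact pw (by omega)
  have zb : ∫ x in closedBall (0 : EE n) (1 - ε), |zi u x| ≤ Z * ε^(n+4) := by
    refine (zi_ball h hε hεle (a := ε^(n+4)) (by positivity)).trans ?_
    have zz := zi_int h hn he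
    have e1 : ∫ x, zi u x * (‖x‖^2 * phi x) ≤ 6 * n * L * (C1 * ε^(3*n+14)) := zz.trans (by gcongr)
    have e2 : ((ε^(n+4))^2 * ε^2)⁻¹ * (6 * n * L * (C1 * ε^(3*n+14))) = 6 * n * L * C1 * ε^(n+4) := by
      have : ε^(3*n+14) = (ε^(n+4))^2 * ε^2 * ε^(n+4) := by ring
      rw [this]; field_simp
    have e3 : ((ε^(n+4))^2 * ε^2)⁻¹ * (∫ x, zi u x * (‖x‖^2 * phi x)) ≤ 6 * n * L * C1 * ε^(n+4) := by
      rw [← e2]; gcongr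
    have e4 : (ε^(n+4))^n ≤ ε^(n+4) := by
      calc (ε^(n+4))^n ≤ (ε^(n+4))^1 := pow_le_pow_of_le_one (by positivity) (pow_le_one₀ hε.le hεle) hn
        _ = _ := pow_one _
    have e5 := mul_le_mul_of_nonneg_right e4 hV.le
    rw [hZ, ← hVV]
    linarith
  have zb1 : ∫ x in closedBall (0 : EE n) (1 - ε), |zi u x| ≤ Z * ε := zb.trans (by
    have := pw (show 1 ≤ n + 4 by omega)
    rw [pow_one] at this; gcongr)
  obtain ⟨A, hA, hq0⟩ := approx h hε hε1 (VB_pos n)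
  have hq : ∀ x : EE n, ‖x‖ ≤ 1 - 2 * ε → |u x - quadForm A x| ≤ K * ε := by
    intro x hx
    refine (hq0 x hx).trans ?_
    rw [← hVV]
    have s := add_le_add gb zb
    rw [← add_mul] at s
    have e : 720 * ε⁻¹^3 * ((4/3)^5 * (2/ε)^n / V) * ((C1 + Z) * ε^(n+4)) =
        720 * ((4/3)^5 * 2^n / V) * (C1 + Z) * ε := by
      rw [div_pow 2 ε, pow_add]; field_simp
    calc _ ≤ 5 * L * ε + 720 * ε⁻¹^3 * ((4/3)^5 * (2/ε)^n / V) * ((C1 + Z) * ε^(n+4)) := by gcongr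
      _ = _ := by rw [e, hK]; ring
  have tr : |A.trace - 1| ≤ T * ε := by
    have := trace_bound h hA hε hε1 Kp.le hq zb1 Wb
    rw [← hVV, ← hT] at this
    exact this
  obtain ⟨B, hB, hBA⟩ := fix_quad h hA hε hε1 Kp.le Tp.le hq tr (by rw [← hC6]; exact hε2)
  refine ⟨B, hB, ?_⟩
  rw [← hC6] at hBA
  have b1 : ∀ x : EE n, ‖x‖ ≤ 1 - 2 * ε → |u x - quadForm B x| ≤ C7 * ε := by
    intro x hx
    have h1 := hq x hx
    have h2 := hBA x (by linarith)
    rw [hC7]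
    rw [abs_le] at *
    constructor <;> linarith
  have b2 : ∀ x : EE n, ‖x‖ ≤ 1 → |u x - quadForm B x| ≤ M := by
    intro x hx
    have h1 := (uq_bound h hε1 (by positivity) hq hx).2
    have h2 := hBA x hx
    have h3 : K * ε ≤ K * 1 := by gcongr
    have h4 : 2 * (C6 * (4 * L + 4 * K) + 4 * K) * ε ≤ 2 * (C6 * (4 * L + 4 * K) + 4 * K) * 1 := by gcongr
    rw [hM, hC7]
    rw [abs_le] at *
    constructor <;> linarith
  have l := layer (w := fun x => (u x - quadForm B x)^2) hε (a := (C7 * ε)^2) (M := M^2)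
    (by positivity) (by positivity)
    (fun x hx => by rw [abs_pow]; have := b1 x hx; gcongr)
    (fun x hx => by rw [abs_pow]; have := b2 x hx; gcongr)
  refine (le_of_abs_le l).trans ?_
  rw [← hVV]
  have : (4 * (C7 * ε)^2 + 16 * M^2 * ε) ≤ (4 * C7^2 + 16 * M^2) * ε := by
    have : ε^2 ≤ ε := by nlinarith
    have := mul_le_mul_of_nonneg_left this (show 0 ≤ 4 * C7^2 by positivity)
    linarith
  have := mul_le_mul_of_nonneg_right this hV.le
  linarith

section
variable {n : ℕ} {L : ℝ} {u : EE n → ℝ} {G : EE n → EE n}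

theorem f_le (h : NSol L u G) {A B : Matrix (Fin n) (Fin n) ℝ} (hA : MemP A) (hB : MemP B) :
    En u G - ∫ x, quadForm A x * phi x ≤ |∫ x, (u x - quadForm B x) * dot u G x * wt x| := by
  rw [P_energy hA hB, En_quad h.toCW hB]
  have hp : ∫ x, zi u x * (quadForm B x * phi x) ≥ 0 := integral_nonneg fun x => by
    have h1 := zi_nonneg u x
    have h2 := phi_nonneg x
    have h3 : 0 ≤ quadForm B x := by
      have := hB.1.dotProduct_mulVec_nonneg x.ofLp
      have e : star x.ofLp ⬝ᵥ B.mulVec x.ofLp = ∑ i, ∑ j, B i j * x i * x j := by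
        simp only [dotProduct, Matrix.mulVec, star_trivial, Finset.mul_sum]
        refine Finset.sum_congr rfl fun i _ => Finset.sum_congr rfl fun j _ => by ring
      rw [e] at this
      unfold quadForm; positivity
    simp only [Pi.zero_apply]
    positivity
  have := neg_abs_le (∫ x, (u x - quadForm B x) * dot u G x * wt x)
  linarith

theorem f_bdd (h : NSol L u G) (hn : 0 < n) {A : Matrix (Fin n) (Fin n) ℝ} (hA : MemP A) :
    En u G - ∫ x, quadForm A x * phi x ≤ 60 * L^2 * VB n := by
  have hL := h.hL
  refine (f_le h hA (id_MemP hn)).trans ?_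
  refine int_bd (by positivity) (fun x hx => ?_) (fun x hx => by rw [wt_zero hx, mul_zero])
  rw [quad_id]
  have n1 : (1:ℝ) ≤ n := by exact_mod_cast hn
  have ni : (n:ℝ)⁻¹ ≤ 1 := inv_le_one_of_one_le₀ n1
  have h1 := h.u_le (x := x) (by linarith)
  have h2 : |u x - (n:ℝ)⁻¹ * ‖x‖^2 / 2| ≤ 3 * L := by
    have h3 : (n:ℝ)⁻¹ * ‖x‖^2 ≤ 1 * 1^2 := by gcongr
    have h4 : 0 ≤ (n:ℝ)⁻¹ * ‖x‖^2 := by positivity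
    have h5 : 2 * L * ‖x‖ ≤ 2 * L := by nlinarith
    rw [abs_le] at *
    constructor <;> linarith
  have hd := h.dot_le hx.le
  have k1 := wt_nonneg x
  have k2 := wt_le x
  rw [abs_mul, abs_mul, abs_of_nonneg k1]
  calc _ ≤ (3 * L) * (5 * L) * 4 := by gcongr
    _ = _ := by ring
end

theorem loj (n : ℕ) (hn : 0 < n) (L : ℝ) (hL : 1 ≤ L) :
    ∃ c : ℝ, 0 < c ∧ ∀ (u : EE n → ℝ) (G : EE n → EE n), NSol L u G →
      (∀ A : Matrix (Fin n) (Fin n) ℝ, MemP A → ∫ x, quadForm A x * phi x ≤ En u G) →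
      ∀ A : Matrix (Fin n) (Fin n) ℝ, MemP A → 0 < En u G - ∫ x, quadForm A x * phi x →
      c * (En u G - ∫ x, quadForm A x * phi x)^((4 * (3*n+14) : ℝ)/(2*(3*n+14)+1)) ≤ Jn u G := by
  obtain ⟨C, ε0, hC, hε0, hk⟩ := key n hn L hL
  have hV := VB_pos n
  obtain ⟨m, hm⟩ : ∃ m : ℕ, m = 3 * n + 14 := ⟨_, rfl⟩
  have hmr : (3 * n + 14 : ℝ) = m := by rw [hm]; push_cast; ring
  obtain ⟨δ0, hδ0, hδ1⟩ : ∃ δ0 : ℝ, 0 < δ0 ∧ δ0^2 ≤ ε0 := ⟨Real.sqrt ε0, by positivity, by rw [Real.sq_sqrt hε0.le]⟩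
  obtain ⟨D, hD⟩ : ∃ D, D = C + 1 + 60 * L^2 * VB n / δ0^(2*m+1) := ⟨_, rfl⟩
  have Dp : 0 < D := by rw [hD]; positivity
  refine ⟨D^(-((4 * (3*n+14) : ℝ)/(2*(3*n+14)+1))), by positivity, ?_⟩
  intro u G h he A hA hf
  obtain ⟨f, hff⟩ : ∃ f, f = En u G - ∫ x, quadForm A x * phi x := ⟨_, rfl⟩
  have fb := f_bdd h hn hA
  rw [← hff] at hf fb ⊢
  rw [hmr]
  obtain ⟨δ, hδ⟩ : ∃ δ, δ = (f/D)^((1:ℝ)/(2*m+1)) := ⟨_, rfl⟩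
  have δp : 0 < δ := by rw [hδ]; positivity
  have p1 : δ^(2*m+1) = f/D := by
    rw [hδ, ← Real.rpow_natCast, ← Real.rpow_mul (by positivity)]
    push_cast
    rw [one_div_mul_cancel (by positivity), Real.rpow_one]
  have p2 : D^(-((4 * m : ℝ)/(2*m+1))) * f^((4 * m : ℝ)/(2*m+1)) = δ^(4*m) := by
    rw [hδ, ← Real.rpow_natCast _ (4*m), ← Real.rpow_mul (by positivity), Real.rpow_neg Dp.le]
    push_cast
    rw [show (1:ℝ) / (2*m+1) * (4 * m) = (4 * m : ℝ)/(2*m+1) by ring, Real.div_rpow hf.le Dp.le]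
    ring
  rw [p2]
  by_contra hJ
  have hJ := (not_lt.1 (fun hh => hJ hh.le) : Jn u G ≤ δ^(4*m))
  have dle : δ ≤ δ0 := by
    refine le_of_pow_le_pow_left₀ (n := 2*m+1) (by omega) hδ0.le ?_
    rw [p1, div_le_iff₀ Dp, hD]
    have : δ0^(2*m+1) * (60 * L^2 * VB n / δ0^(2*m+1)) = 60 * L^2 * VB n := by field_simp
    have : 0 ≤ δ0^(2*m+1) * (C + 1) := by positivity
    linarith
  obtain ⟨B, hB, hBb⟩ := hk u G h he (δ^2) (by positivity) (le_trans (by gcongr) hδ1) (by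
    rw [← hm]; refine hJ.trans (le_of_eq ?_); rw [← pow_mul, ← pow_mul]; congr 1; ring)
  have fl := f_le h hA hB
  rw [← hff] at fl
  have cd := dot_continuous h.cu h.cG
  have cu := h.cu
  have cq := quadForm_continuous B
  have am := amgm (a := fun x => u x - quadForm B x) (b := dot u G) (by fun_prop) cd (l := δ^(2*m-1)) (by positivity)
  have m1 : δ^(2*m-1) * δ^2 = δ^(2*m+1) := by rw [← pow_add]; congr 1; omega
  have m2 : (δ^(2*m-1))⁻¹ * δ^(4*m) = δ^(2*m+1) := by
    have : δ^(4*m) = δ^(2*m-1) * δ^(2*m+1) := by rw [← pow_add]; congr 1; omega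
    rw [this]; field_simp
  have a1 : δ^(2*m-1) * (∫ x, (u x - quadForm B x)^2 * wt x) ≤ C * δ^(2*m+1) := by
    calc _ ≤ δ^(2*m-1) * (C * δ^2) := by gcongr
      _ = _ := by rw [← m1]; ring
  have a2 : (δ^(2*m-1))⁻¹ * (∫ x, (dot u G x)^2 * wt x) ≤ δ^(2*m+1) := by
    rw [← m2]; gcongr; exact hJ
  have fin : f ≤ (1/2) * ((C + 1) * δ^(2*m+1)) := by linarith
  rw [p1] at fin
  have : (C + 1) * (f / D) ≤ f := by
    rw [← mul_div_assoc, div_le_iff₀ Dp, hD]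
    have : 0 ≤ f * (60 * L^2 * VB n / δ0^(2*m+1)) := by positivity
    linarith
  linarith

end

/-- the exponent -/
def epsN (n : ℕ) : ℝ := 1 / ((2 * (3*n+14) - 1) * (n + 2))

theorem epsN_pos (n : ℕ) : 0 < epsN n := by
  unfold epsN
  have : (0:ℝ) ≤ n := by positivity
  have : (0:ℝ) < 2 * (3*n+14) - 1 := by linarith
  positivity

theorem rate (n : ℕ) (hn : 0 < n) (L : ℝ) (hL : 1 ≤ L) :
    ∃ C : ℝ, 0 ≤ C ∧ ∀ (u : EE n → ℝ) (G : EE n → EE n) (A : Matrix (Fin n) (Fin n) ℝ),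
      NSol L u G → MemP A →
      (∀ η : ℝ, 0 < η → ∃ T, ∀ t, T ≤ t → ∀ x : EE n, ‖x‖ ≤ 1 → |Uf u t x - quadForm A x| ≤ η) →
      ∀ t : ℝ, 0 < t → ∀ y : EE n, ‖y‖ ≤ 1/2 → |Uf u t y - quadForm A y| ≤ C * t ^ (-epsN n) := by
  obtain ⟨c, hc, hloj⟩ := loj n hn L hL
  have hV := VB_pos n
  have nn : (0:ℝ) ≤ n := by positivity
  obtain ⟨m, hm⟩ : ∃ m : ℝ, m = 3 * n + 14 := ⟨_, rfl⟩
  have hm1 : 14 ≤ m := by linarith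
  have hm2 : 0 < 2 * m - 1 := by linarith
  have hm3 : 0 < 2 * m + 1 := by linarith
  obtain ⟨α, hα⟩ : ∃ α : ℝ, α = (2 * m - 1) / (2 * m + 1) := ⟨_, rfl⟩
  have αp : 0 < α := by rw [hα]; positivity
  have αe : (4 * m) / (2 * m + 1) = 1 + α := by rw [hα]; field_simp; ring
  obtain ⟨δ, hδ⟩ : ∃ δ : ℝ, δ = 1 / (2 * m - 1) := ⟨_, rfl⟩
  have δp : 0 < δ := by rw [hδ]; positivity
  have αδ : 1 / α = 1 + 2 * δ := by rw [hα, hδ]; field_simp; ring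
  obtain ⟨C0, hC0⟩ : ∃ C0, C0 = 64 * L^2 * VB n := ⟨_, rfl⟩
  have C0p : 0 ≤ C0 := by rw [hC0]; positivity
  obtain ⟨C1, hC1⟩ : ∃ C1, C1 = ((α * c) ^ (-(1/α)) + (C0 + (1 + δ) * (α * c) ^ (-(1/α))) / δ) := ⟨_, rfl⟩
  have C1p : 0 ≤ C1 := by rw [hC1]; positivity
  obtain ⟨C2, hC2⟩ : ∃ C2, C2 = (4 * (16 * L)^n / VB n) * C1 := ⟨_, rfl⟩
  have C2p : 0 ≤ C2 := by rw [hC2]; positivity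
  refine ⟨C2 ^ ((1:ℝ)/(n+2)), by positivity, ?_⟩
  intro u G A h hA hlim t ht y hy
  have cq := quadForm_continuous A
  have hq : ∀ x : EE n, ‖x‖ ≤ 1 → |quadForm A x| ≤ 2 * L := fun x hx => lim_bound h hlim hx
  have hE := fun t (ht : 0 < t) => Ef_ge h hA hlim ht
  have D1 := ode_D (f := fun t => Ef u G t - ∫ x, quadForm A x * phi x) (J := Jf u G) (D := Df u (quadForm A))
    hc αp C0p δp αδ (fun t ht => (Ef_deriv h ht).sub_const _) (fun t ht => sub_nonneg.2 (hE t ht))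
    (fun t => Jf_nonneg t)
    (fun t ht hf => by
      have := hloj _ _ (flow_NSol h ht.le) (fun B hB => by
        rw [P_energy hB hA]; exact hE t ht) A hA hf
      rw [← hm, αe] at this
      exact this)
    (fun t ht => Df_deriv h cq hq ht)
    (fun t ht l hl => by
      have hf := flow_NSol h ht.le
      have cU := hf.cu
      have am := amgm (a := fun x => Uf u t x - quadForm A x) (b := gf u G t) (by fun_prop)
        (dot_continuous hf.cu hf.cG) hl
      have db := mul_le_mul_of_nonneg_left (Df_bound h hq ht.le) hl.le
      rw [← hC0] at db
      rw [abs_mul, abs_two]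
      have e1 : Df u (quadForm A) t = ∫ x, (Uf u t x - quadForm A x)^2 * wt x := rfl
      have e2 : Jf u G t = ∫ x, (gf u G t x)^2 * wt x := rfl
      rw [e1] at db
      rw [e2]
      linarith)
    (Df_tendsto h hlim) ht
  rw [← hC1] at D1
  have hf := flow_NSol h ht.le
  have cU := hf.cu
  have sb := sup_bound (w := fun x => Uf u t x - quadForm A x) (by fun_prop) hL
    (fun x z hx hz => by
      have h1 := hf.u_lip (x := x) (y := z) (by linarith) (by linarith)
      have h2 := lim_lip h hlim hx hz
      rw [abs_le] at *
      constructor <;> linarith)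
    (fun x hx => by
      have h1 := hf.u_le (x := x) (by linarith)
      have h2 := hq x hx
      have h3 : 2 * L * ‖x‖ ≤ 2 * L := by nlinarith
      rw [abs_le] at *
      constructor <;> linarith) hy
  have s2 : |Uf u t y - quadForm A y|^(n+2) ≤ C2 * t^(-δ) := by
    refine sb.trans ?_
    rw [hC2, mul_assoc]
    have : ∫ x, (Uf u t x - quadForm A x)^2 * wt x ≤ C1 * t^(-δ) := D1
    gcongr
  have e1 : C2 * t^(-δ) = (C2 ^ ((1:ℝ)/(n+2)) * t ^ (-epsN n))^(n+2) := by
    have tp : 0 ≤ t := ht.le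
    rw [mul_pow, ← Real.rpow_natCast, ← Real.rpow_natCast, ← Real.rpow_mul C2p, ← Real.rpow_mul tp]
    push_cast
    rw [one_div_mul_cancel (by positivity), Real.rpow_one]
    congr 2
    rw [hδ, epsN, ← hm]; field_simp
  rw [e1] at s2
  exact le_of_pow_le_pow_left₀ (by omega) (by positivity) s2

theorem Tst.compact {n : ℕ} {ψ : EE n → ℝ} {g : EE n → EE n} (h : Tst ψ g) :
    HasCompactSupport ψ := by
  apply HasCompactSupport.of_support_subset_isCompact (isCompact_closedBall (0 : EE n) 1)
  intro x hx
  by_contra hc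
  rw [mem_closedBall_zero_iff, not_le] at hc
  exact hx (h.zero x hc.le).1

theorem Tst.lip {n : ℕ} {ψ : EE n → ℝ} {g : EE n → EE n} (h : Tst ψ g) :
    ∃ C, LipschitzWith C ψ := by
  apply ContDiff.lipschitzWith_of_hasCompactSupport (𝕂 := ℝ) (n := 1) h.compact _ (by simp)
  rw [contDiff_one_iff_fderiv]
  refine ⟨fun x => HasFDerivAt.differentiableAt (h.grad x), ?_⟩
  have : fderiv ℝ ψ = fun x => innerSL ℝ (g x) := by
    funext x
    exact HasFDerivAt.fderiv (h.grad x)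
  rw [this]
  exact (innerSL ℝ).continuous.comp h.cont

theorem weak_of_lip {n : ℕ} {F : EE n → EE n} {C : ℝ≥0} (hF : LipschitzWith C F)
    {k : EE n → ℝ}
    (hae : ∀ᵐ x : EE n, ‖x‖ < 1 → DifferentiableAt ℝ F x →
      ∑ i : Fin n, fderiv ℝ F x (EuclideanSpace.single i 1) i = k x)
    {ψ : EE n → ℝ} {g : EE n → EE n} (h : Tst ψ g) :
    ∫ x, inner ℝ (F x) (g x) = - ∫ x, k x * ψ x := by
  obtain ⟨D, hD⟩ := h.lip
  have hFi : ∀ i : Fin n, LipschitzWith (‖(EuclideanSpace.proj i : EE n →L[ℝ] ℝ)‖₊ * C)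
      (fun x => F x i) := fun i =>
    (EuclideanSpace.proj i : EE n →L[ℝ] ℝ).lipschitz.comp hF
  have hgi : ∀ i : Fin n, Continuous (fun x => g x i) := fun i =>
    (EuclideanSpace.proj i : EE n →L[ℝ] ℝ).continuous.comp h.cont
  have key : ∀ i : Fin n, ∫ x, lineDeriv ℝ (fun x => F x i) x (EuclideanSpace.single i 1) * ψ x
      = - ∫ x, F x i * g x i := by
    intro i
    rw [LipschitzWith.integral_lineDeriv_mul_eq (hFi i) hD h.compact, ← integral_neg]
    congr 1
    funext x
    rw [((h.grad x).lineDeriv _).lineDeriv]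
    rw [inner_neg_right, real_inner_comm, EuclideanSpace.inner_single_left]
    simp
    ring
  have i1 : ∀ i : Fin n, Integrable (fun x => F x i * g x i) := fun i => by
    apply integ_cont ((hFi i).continuous.mul (hgi i))
    intro x hx
    simp [(h.zero x hx).2]
  have i2 : ∀ i : Fin n, Integrable
      (fun x => lineDeriv ℝ (fun x => F x i) x (EuclideanSpace.single i 1) * ψ x) := fun i => by
    apply integ_bdd (C := (‖(EuclideanSpace.proj i : EE n →L[ℝ] ℝ)‖₊ * C : ℝ≥0) *
      ‖(EuclideanSpace.single i 1 : EE n)‖)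
    · exact measurable_lineDeriv (hFi i).continuous
    · intro x
      exact norm_lineDeriv_le_of_lipschitz ℝ (hFi i)
    · exact integ_cont h.continuous fun x hx => (h.zero x hx).1
  have e1 : ∫ x, inner ℝ (F x) (g x) = ∑ i, ∫ x, F x i * g x i := by
    rw [← integral_finset_sum _ (fun i _ => i1 i)]
    congr 1
    funext x
    simp [PiLp.inner_apply, mul_comm]
  have e2 : ∫ x, k x * ψ x = ∑ i : Fin n,
      ∫ x, lineDeriv ℝ (fun x => F x i) x (EuclideanSpace.single i 1) * ψ x := by
    rw [← integral_finset_sum _ (fun i _ => i2 i)]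
    apply integral_congr_ae
    filter_upwards [hae, hF.ae_differentiableAt] with x h1 h2
    by_cases hx : ‖x‖ < 1
    · rw [← h1 hx h2, Finset.sum_mul]
      refine Finset.sum_congr rfl fun i _ => ?_
      congr 1
      have : HasFDerivAt (fun x => F x i)
          ((EuclideanSpace.proj i : EE n →L[ℝ] ℝ).comp (fderiv ℝ F x)) x :=
        (EuclideanSpace.proj i : EE n →L[ℝ] ℝ).hasFDerivAt.comp x h2.hasFDerivAt
      rw [(this.hasLineDerivAt _).lineDeriv]
      rfl
    · simp [(h.zero x (not_lt.1 hx)).1]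
  rw [e1, e2, ← Finset.sum_neg_distrib]
  refine Finset.sum_congr rfl fun i _ => ?_
  rw [key, neg_neg]

theorem ae_affine {n : ℕ} (x0 : EE n) {R : ℝ} (hR : 0 < R) {P : EE n → Prop}
    (h : ∀ᵐ z : EE n, P z) : ∀ᵐ x : EE n, P (x0 + R • x) := by
  have q1 : Measure.QuasiMeasurePreserving (fun x : EE n => R • x) volume volume := by
    refine ⟨measurable_const_smul R, ?_⟩
    rw [Measure.map_addHaar_smul _ hR.ne']
    exact Measure.smul_absolutelyContinuous
  have q2 := (measurePreserving_add_left (volume : Measure (EE n)) x0).quasiMeasurePreserving.comp q1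
  exact q2.ae h

theorem mkNSol {n : ℕ} {Ω : Set (EE n)} {u : EE n → ℝ} (hΩ : IsOpen Ω)
    (hu : IsObstacleSol Ω u) {x0 : EE n} {R : ℝ} (hR : 0 < R)
    (hB : closedBall x0 (2 * R) ⊆ Ω) {L0 : ℝ≥0}
    (hLip : LipschitzOnWith L0 (gradient u) (closedBall x0 (2 * R))) (h0 : u x0 = 0) :
    ∃ u' F, NSol (max 1 (L0 : ℝ)) u' F ∧
      ∀ x : EE n, ‖x‖ ≤ 3/2 → u' x = u (x0 + R • x) / R ^ 2 := by
  obtain ⟨hd, -, hnn, hlap⟩ := hu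
  rw [ae_restrict_iff' hΩ.measurableSet] at hlap
  have hmem : ∀ x : EE n, ‖x‖ ≤ 3/2 → x0 + R • x ∈ closedBall x0 (2 * R) := by
    intro x hx
    rw [mem_closedBall, dist_eq_norm, add_sub_cancel_left, norm_smul, Real.norm_of_nonneg hR.le]
    nlinarith
  have hmO : ∀ x : EE n, ‖x‖ ≤ 3/2 → x0 + R • x ∈ Ω := fun x hx => hB (hmem x hx)
  have hl1 : LipschitzOnWith L0 (fun x => R⁻¹ • gradient u (x0 + R • x))
      (closedBall (0 : EE n) (3/2)) := by
    apply LipschitzOnWith.of_dist_le_mul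
    intro x hx y hy
    rw [mem_closedBall_zero_iff] at hx hy
    have := hLip.dist_le_mul _ (hmem x hx) _ (hmem y hy)
    rw [dist_add_left, dist_smul₀, Real.norm_of_nonneg hR.le] at this
    rw [dist_smul₀, Real.norm_of_nonneg (inv_nonneg.2 hR.le)]
    calc R⁻¹ * dist (gradient u (x0 + R • x)) (gradient u (x0 + R • y))
        ≤ R⁻¹ * (L0 * (R * dist x y)) := by gcongr
      _ = L0 * dist x y := by field_simp
  obtain ⟨F, hF, hFe⟩ := hl1.extend_finite_dimension
  have hFx : ∀ x : EE n, ‖x‖ ≤ 3/2 → F x = R⁻¹ • gradient u (x0 + R • x) := fun x hx =>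
    (hFe (mem_closedBall_zero_iff.2 hx)).symm
  set ρ : EE n → EE n := fun x => ((3/2) / max (3/2) ‖x‖) • x with hρ
  have hmx : ∀ x : EE n, 0 < max (3/2) ‖x‖ := fun x => lt_max_of_lt_left (by norm_num)
  have hρc : Continuous ρ := by
    have h1 : Continuous fun x : EE n => (3/2) / max (3/2) ‖x‖ :=
      continuous_const.div (continuous_const.max continuous_norm) fun x => (hmx x).ne'
    exact h1.smul continuous_id
  have hρ1 : ∀ x, ‖x‖ ≤ 3/2 → ρ x = x := by
    intro x hx
    simp only [hρ]
    rw [max_eq_left hx]; norm_num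
  have hρ2 : ∀ x, ‖ρ x‖ ≤ 3/2 := by
    intro x
    simp only [hρ]
    rw [norm_smul, Real.norm_of_nonneg (div_nonneg (by norm_num) (hmx x).le), div_mul_eq_mul_div,
      div_le_iff₀ (hmx x)]
    have := le_max_right (3/2) ‖x‖
    nlinarith
  set u' : EE n → ℝ := fun x => u (x0 + R • ρ x) / R ^ 2 with hu'
  have hue : ∀ x : EE n, ‖x‖ ≤ 3/2 → u' x = u (x0 + R • x) / R ^ 2 := by
    intro x hx
    simp only [hu']
    rw [hρ1 x hx]
  have hcu : Continuous u' := by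
    apply Continuous.div_const
    rw [continuous_iff_continuousAt]
    intro x
    have h1 : ContinuousAt u (x0 + R • ρ x) := (hd _ (hmO _ (hρ2 x))).continuousAt
    have h2 : ContinuousAt (fun x => x0 + R • ρ x) x := by fun_prop
    exact ContinuousAt.comp (f := fun x => x0 + R • ρ x) h1 h2
  have hnear : ∀ x : EE n, ‖x‖ < 3/2 → ∀ᶠ y in 𝓝 x, ‖y‖ < 3/2 := fun x hx =>
    continuous_norm.continuousAt.eventually_lt_const hx
  have hgrad : ∀ x, ‖x‖ < 3/2 → HG u' (F x) x := by
    intro x hx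
    have h1 := (hd _ (hmO x hx.le)).hasGradientAt
    rw [hasGradientAt_iff_hasFDerivAt] at h1
    have h2 : HasFDerivAt (fun x : EE n => x0 + R • x) (R • ContinuousLinearMap.id ℝ (EE n)) x :=
      ((hasFDerivAt_id x).const_smul R).const_add x0
    have h3 := (h1.comp x h2).mul_const ((R ^ 2)⁻¹)
    have h4 : HG (fun x => u (x0 + R • x) * (R ^ 2)⁻¹) (F x) x := by
      refine HasFDerivAt.congr_fderiv h3 ?_
      ext v
      rw [hFx x hx.le]
      simp [inner_smul_left]
      field_simp
    refine h4.congr ?_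
    filter_upwards [hnear x hx] with y hy
    rw [hue y hy.le, div_eq_mul_inv]
  have hF0 : F 0 = 0 := by
    rw [hFx 0 (by simp; norm_num)]
    have h1 : IsLocalMin u x0 := by
      have : Ω ∈ 𝓝 x0 := hΩ.mem_nhds (hB (mem_closedBall_self (by positivity)))
      filter_upwards [this] with y hy
      rw [h0]; exact hnn y hy
    have : gradient u x0 = 0 := by
      unfold gradient
      rw [h1.fderiv_eq_zero]; simp
    simp [this]
  have hdiv : ∀ᵐ x : EE n, ‖x‖ < 1 → DifferentiableAt ℝ F x →
      ∑ i : Fin n, fderiv ℝ F x (EuclideanSpace.single i 1) i = posInd u' x := by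
    filter_upwards [ae_affine x0 hR hlap] with x hx hx1 hx2
    have hx' : ‖x‖ < 3/2 := by linarith
    have h1 := hx (hmO x hx'.le)
    have hinv : R⁻¹ • (x0 + R • x - x0) = x := by
      rw [add_sub_cancel_left, smul_smul, inv_mul_cancel₀ hR.ne', one_smul]
    have hA : HasFDerivAt (fun z : EE n => R⁻¹ • (z - x0)) (R⁻¹ • ContinuousLinearMap.id ℝ (EE n))
        (x0 + R • x) := ((hasFDerivAt_id _).sub_const x0).const_smul R⁻¹
    have hF1 : HasFDerivAt F (fderiv ℝ F x) (R⁻¹ • (x0 + R • x - x0)) := by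
      rw [hinv]; exact hx2.hasFDerivAt
    have h2 := (hF1.comp (x0 + R • x) hA).const_smul R
    have h3 : HasFDerivAt (gradient u) (fderiv ℝ F x) (x0 + R • x) := by
      have h4 : HasFDerivAt (fun z => R • F (R⁻¹ • (z - x0))) (fderiv ℝ F x) (x0 + R • x) := by
        refine HasFDerivAt.congr_fderiv h2 ?_
        ext1 v
        simp [smul_smul, hR.ne']
      refine h4.congr_of_eventuallyEq ?_
      have hc : ∀ᶠ z in 𝓝 (x0 + R • x), ‖R⁻¹ • (z - x0)‖ < 3/2 := by
        have hcc : Continuous (fun z : EE n => ‖R⁻¹ • (z - x0)‖) := by fun_prop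
        refine hcc.continuousAt.eventually_lt_const ?_
        beta_reduce
        rw [hinv]; exact hx'
      filter_upwards [hc] with z hz
      rw [hFx _ hz.le, smul_smul, smul_smul, mul_inv_cancel₀ hR.ne', one_smul, one_smul,
        add_sub_cancel]
    unfold lapGrad at h1
    rw [h3.fderiv] at h1
    rw [h1]
    unfold posInd
    rw [hue x hx'.le]
    congr 1
    rw [eq_iff_iff]
    exact (div_pos_iff_of_pos_right (by positivity)).symm
  refine ⟨u', F, ⟨⟨hcu, hF.continuous, hgrad, posInd_meas hcu, ⟨1, fun x => posInd_abs u' x⟩,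
    fun ψ g h => weak_of_lip hF hdiv h⟩, le_max_left _ _, ?_, ?_, ?_, hF0⟩, hue⟩
  · intro x y hx hy
    rw [hFx x hx.le, hFx y hy.le, ← dist_eq_norm, ← dist_eq_norm]
    refine (hl1.dist_le_mul _ (mem_closedBall_zero_iff.2 hx.le) _
      (mem_closedBall_zero_iff.2 hy.le)).trans ?_
    gcongr
    exact le_max_right _ _
  · intro x hx
    rw [hue x hx.le]
    exact div_nonneg (hnn _ (hmO x hx.le)) (by positivity)
  · rw [hue 0 (by simp; norm_num)]
    simp [h0]

theorem quad_zero {n : ℕ} (A : Matrix (Fin n) (Fin n) ℝ) : quadForm A (0 : EE n) = 0 := by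
  simp [quadForm]

theorem blowup_unif {n : ℕ} {u : EE n → ℝ} {x0 : EE n} {A : Matrix (Fin n) (Fin n) ℝ}
    (h : IsBlowup u x0 A) {η : ℝ} (hη : 0 < η) :
    ∃ s, 0 < s ∧ ∀ r, 0 < r → r < s → ∀ x : EE n, ‖x‖ ≤ 1 →
      |u (x0 + r • x) / r ^ 2 - quadForm A x| < η := by
  have h1 := (tendstoLocallyUniformlyOn_iff_tendstoUniformlyOn_of_compact
    (isCompact_closedBall (0 : EE n) 1)).1
    (h.2.tendstoLocallyUniformlyOn (s := closedBall (0 : EE n) 1))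
  rw [Metric.tendstoUniformlyOn_iff] at h1
  have h2 := h1 η hη
  rw [eventually_nhdsWithin_iff, Metric.eventually_nhds_iff] at h2
  obtain ⟨s, hs, h3⟩ := h2
  refine ⟨s, hs, fun r hr hrs x hx => ?_⟩
  have := h3 (y := r) (by rw [Real.dist_eq, sub_zero, abs_of_pos hr]; exact hrs) hr x
    (mem_closedBall_zero_iff.2 hx)
  rwa [dist_comm, Real.dist_eq] at this

theorem blowup_zero {n : ℕ} {u : EE n → ℝ} {x0 : EE n} {A : Matrix (Fin n) (Fin n) ℝ}
    (h : IsBlowup u x0 A) : u x0 = 0 := by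
  obtain ⟨s, hs, h1⟩ := blowup_unif h (η := 1) one_pos
  by_contra hc
  have hp : 0 < |u x0| := abs_pos.2 hc
  have hb : ∀ r, 0 < r → r < s → |u x0| < r ^ 2 := by
    intro r hr hrs
    have := h1 r hr hrs 0 (by simp)
    rw [smul_zero, add_zero, quad_zero, sub_zero, abs_div, abs_of_pos (by positivity : 0 < r ^ 2),
      div_lt_one (by positivity)] at this
    exact this
  have hm : 0 < min (s/2) (min 1 |u x0|) := lt_min (by linarith) (lt_min one_pos hp)
  have h2 := hb _ hm ((min_le_left _ _).trans_lt (by linarith))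
  have h3 : min (s/2) (min 1 |u x0|) ≤ 1 := (min_le_right _ _).trans (min_le_left _ _)
  have h4 : min (s/2) (min 1 |u x0|) ≤ |u x0| := (min_le_right _ _).trans (min_le_right _ _)
  nlinarith

theorem final_aux {n : ℕ} (hn : 0 < n) {Ω : Set (EE n)} (hΩ : IsOpen Ω) {u : EE n → ℝ}
    (hu : IsObstacleSol Ω u) {K : Set (EE n)} (hK : K ⊆ Ω) (hKc : IsCompact K) :
    ∃ C : ℝ, ∃ r1 : ℝ, 0 < r1 ∧ ∀ x0 ∈ K, ∀ A : Matrix (Fin n) (Fin n) ℝ, IsBlowup u x0 A →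
      ∀ r : ℝ, 0 < r → r < r1 → ∀ x ∈ ball (0 : EE n) r,
        |u (x0 + x) - quadForm A x| ≤ C * r ^ 2 * |Real.log r| ^ (-epsN n) := by
  obtain ⟨δ, hδ, hδK⟩ := hKc.exists_cthickening_subset_open hΩ hK
  obtain ⟨L0, hL0⟩ := hu.2.1 _ hδK hKc.cthickening
  obtain ⟨C, hC, hrate⟩ := rate n hn (max 1 (L0 : ℝ)) (le_max_left _ _)
  set R : ℝ := δ / 2 with hRd
  have hR : 0 < R := by positivity
  refine ⟨4 * C * 2 ^ (epsN n), min (1/2) ((R/2)^2), by positivity, ?_⟩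
  intro x0 hx0 A hA r hr hr1 x hx
  have hball : closedBall x0 (2 * R) ⊆ cthickening δ K := by
    have := closedBall_subset_cthickening hx0 δ
    rwa [hRd, mul_div_cancel₀ _ (two_ne_zero)]
  obtain ⟨u', F, hN, hue⟩ := mkNSol hΩ hu hR (hball.trans hδK) (hL0.mono hball) (blowup_zero hA)
  have hUf : ∀ t : ℝ, 0 ≤ t → ∀ x : EE n, ‖x‖ ≤ 1 →
      Uf u' t x = u (x0 + (R * Real.exp (-t)) • x) / (R * Real.exp (-t)) ^ 2 := by
    intro t ht x hx
    have he : Real.exp (-t) ≤ 1 := Real.exp_le_one_iff.2 (by linarith)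
    have hp := Real.exp_pos (-t)
    unfold Uf
    rw [hue, smul_smul]
    · have : Real.exp (2*t) = (Real.exp (-t) ^ 2)⁻¹ := by
        rw [← Real.exp_nat_mul, ← Real.exp_neg]; congr 1; push_cast; ring
      rw [this]
      field_simp
    · rw [norm_smul, Real.norm_of_nonneg hp.le]
      nlinarith [norm_nonneg x]
  have hlim : ∀ η > 0, ∃ T, ∀ t, T ≤ t → ∀ x : EE n, ‖x‖ ≤ 1 →
      |Uf u' t x - quadForm A x| ≤ η := by
    intro η hη
    obtain ⟨s, hs, h1⟩ := blowup_unif hA hη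
    have hlt : Tendsto (fun t : ℝ => R * Real.exp (-t)) atTop (𝓝 (R * 0)) :=
      (Real.tendsto_exp_neg_atTop_nhds_zero).const_mul R
    rw [mul_zero] at hlt
    obtain ⟨T, hT⟩ := eventually_atTop.1 (hlt.eventually_lt_const hs)
    refine ⟨max T 0, fun t ht x hx => ?_⟩
    rw [hUf t ((le_max_right _ _).trans ht) x hx]
    exact (h1 _ (mul_pos hR (Real.exp_pos _)) (hT t ((le_max_left _ _).trans ht)) x hx).le
  have hr2 : r < 1/2 := hr1.trans_le (min_le_left _ _)
  have hr3 : r < (R/2)^2 := hr1.trans_le (min_le_right _ _)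
  have hlogr : Real.log r < 0 := Real.log_neg hr (by linarith)
  have hlog : Real.log r / 2 < Real.log (R/2) := by
    have := Real.log_lt_log hr hr3
    rw [Real.log_pow] at this
    push_cast at this
    linarith
  set t : ℝ := Real.log (R/2) - Real.log r with ht
  have htl : |Real.log r| / 2 ≤ t := by
    rw [abs_of_neg hlogr]; linarith
  have ht0 : 0 < t := by
    have : 0 < |Real.log r| := abs_pos.2 hlogr.ne
    linarith
  have hexp : R * Real.exp (-t) = 2 * r := by
    rw [ht, neg_sub, Real.exp_sub, Real.exp_log hr, Real.exp_log (by positivity)]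
    field_simp
  rw [mem_ball_zero_iff] at hx
  set y : EE n := (2 * r)⁻¹ • x with hy
  have hyx : (2 * r) • y = x := by
    rw [hy, smul_smul, mul_inv_cancel₀ (by positivity), one_smul]
  have hyn : ‖y‖ ≤ 1/2 := by
    rw [hy, norm_smul, Real.norm_of_nonneg (by positivity), inv_mul_le_iff₀ (by positivity)]
    linarith
  have h1 := hrate u' F A hN hA.1 hlim t ht0 y hyn
  rw [hUf t ht0.le y (by linarith), hexp, hyx] at h1
  have hq : quadForm A x = (2 * r)^2 * quadForm A y := by rw [← quad_smul, hyx]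
  have e1 : u (x0 + x) - quadForm A x
      = (2 * r)^2 * (u (x0 + x) / (2 * r)^2 - quadForm A y) := by
    rw [hq]; field_simp
  have hpw : t ^ (-epsN n) ≤ 2 ^ (epsN n) * |Real.log r| ^ (-epsN n) := by
    have hap : 0 < |Real.log r| := abs_pos.2 hlogr.ne
    calc t ^ (-epsN n) ≤ (|Real.log r| / 2) ^ (-epsN n) :=
          Real.rpow_le_rpow_of_nonpos (by positivity) htl (by linarith [epsN_pos n])
      _ = 2 ^ (epsN n) * |Real.log r| ^ (-epsN n) := by
          rw [Real.div_rpow hap.le (by norm_num), Real.rpow_neg (by norm_num : (0:ℝ) ≤ 2)]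
          rw [div_inv_eq_mul, mul_comm]
  rw [e1, abs_mul, abs_of_pos (by positivity : 0 < (2 * r)^2)]
  calc (2 * r)^2 * |u (x0 + x) / (2 * r)^2 - quadForm A y|
      ≤ (2 * r)^2 * (C * (2 ^ (epsN n) * |Real.log r| ^ (-epsN n))) := by
        gcongr
        exact h1.trans (by gcongr)
    _ = _ := by ring

/-- Colombo–Spolaor–Velichkov, n ≥ 3: there exists `ε > 0`
depending only on the dimension `n ≥ 3` such that, for every solution of the
normalized obstacle problem and every compact `K ⊆ Ω`, there is a constant `C`
with `sup_{B_r(0)} |u(x0 + ·) - p_{*,x0}| ≤ C r² |log r|^{-ε}` for every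
singular point `x0 ∈ Σ ∩ K` and every sufficiently small `r > 0`. -/
theorem colombo_spolaor_velichkov_log_epsilon
    (n : ℕ) (hn : 3 ≤ n) :
    ∃ ε : ℝ, 0 < ε ∧
      ∀ (Ω : Set (EuclideanSpace ℝ (Fin n))), IsOpen Ω →
        ∀ u : EuclideanSpace ℝ (Fin n) → ℝ, IsObstacleSol Ω u →
          ∀ K : Set (EuclideanSpace ℝ (Fin n)), K ⊆ Ω → IsCompact K →
            ∃ C : ℝ, ∃ r1 : ℝ, 0 < r1 ∧
              ∀ x0, IsSingularPt Ω u x0 → x0 ∈ K →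
                ∀ A : Matrix (Fin n) (Fin n) ℝ, IsBlowup u x0 A →
                  ∀ r : ℝ, 0 < r → r < r1 → ball x0 r ⊆ Ω →
                    ∀ x ∈ ball (0 : EuclideanSpace ℝ (Fin n)) r,
                      |u (x0 + x) - quadForm A x| ≤
                        C * r ^ 2 * |Real.log r| ^ (-ε) := by
  refine ⟨epsN n, epsN_pos n, fun Ω hΩ u hu K hK hKc => ?_⟩
  obtain ⟨C, r1, hr1, h⟩ := final_aux (by omega : 0 < n) hΩ hu hK hKc
  exact ⟨C, r1, hr1, fun x0 _ hx0 A hA r hr hrr _ x hx => h x0 hx0 A hA r hr hrr x hx⟩
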